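/- arXiv:2408.08523 — 2 statements merged into one kernel-verified Lean document; each statement's English description precedes it below -/
import Mathlib

section
/- For every sufficiently small ε > 0 there exists γ0 > 0 such that for every γ ∈ (0, γ0) there exists n0 ∈ ℕ such that the following holds for all n ≥ n0. Let H be a balanced 4-partite 4-graph with vertex classes V1, V2, V3, V4, each of size n, such that H is not ε-close to H'_{1,3}(n) and d_H({x,y}) ≥ (5/9 − γ)n² for every x ∈ V1 and every y ∈ V2 ∪ V3 ∪ V4. Then there exists a spanning subhypergraph F of H such that (i) |d_F(v) − n/ln n| ≤ n^{0.9} for every vertex v, and (ii) d_F({x,y}) ≤ n^{0.1} for every pair of distinct vertices x, y. -/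
open Finset

/-- The number of edges of `E` containing both vertices `x` and `y`. -/
def hdeg2 {α : Type} [DecidableEq α] (E : Finset (Finset α)) (x y : α) : ℕ :=
  (E.filter (fun e => x ∈ e ∧ y ∈ e)).card

/-- `E` is the edge set of a 4-partite 4-graph with classes `V1, V2, V3, V4`. -/
def IsPartite4 {α : Type} [DecidableEq α] (V1 V2 V3 V4 : Finset α)
    (E : Finset (Finset α)) : Prop :=
  ∀ e ∈ E, e ⊆ V1 ∪ V2 ∪ V3 ∪ V4 ∧ (e ∩ V1).card = 1 ∧ (e ∩ V2).card = 1 ∧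
    (e ∩ V3).card = 1 ∧ (e ∩ V4).card = 1

/-- The edge set of `H'₁,₃(n)` for the choice `W2, W3, W4` of the partition
sets: all quadruples with one vertex in each class that meet `W2 ∪ W3 ∪ W4`
and meet `(V2 \ W2) ∪ (V3 \ W3) ∪ (V4 \ W4)`. -/
def H13edges {α : Type} [DecidableEq α] (V1 V2 V3 V4 W2 W3 W4 : Finset α) :
    Finset (Finset α) :=
  (V1 ∪ V2 ∪ V3 ∪ V4).powerset.filter (fun e =>
    (e ∩ V1).card = 1 ∧ (e ∩ V2).card = 1 ∧ (e ∩ V3).card = 1 ∧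
    (e ∩ V4).card = 1 ∧ (e ∩ (W2 ∪ W3 ∪ W4)).Nonempty ∧
    (e ∩ ((V2 \ W2) ∪ (V3 \ W3) ∪ (V4 \ W4))).Nonempty)

/-- `W2, W3, W4` is a valid choice of partition sets for `H'₁,₃(n)`:
`Wi ⊆ Vi`, `|Wi| ∈ {⌊n/3⌋, ⌈n/3⌉}` and `|W2| + |W3| + |W4| = n`. -/
def IsWChoice {α : Type} [DecidableEq α] (n : ℕ) (V2 V3 V4 W2 W3 W4 : Finset α) :
    Prop :=
  W2 ⊆ V2 ∧ W3 ⊆ V3 ∧ W4 ⊆ V4 ∧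
  (W2.card = n / 3 ∨ W2.card = (n + 2) / 3) ∧
  (W3.card = n / 3 ∨ W3.card = (n + 2) / 3) ∧
  (W4.card = n / 3 ∨ W4.card = (n + 2) / 3) ∧
  W2.card + W3.card + W4.card = n

/-- `H` (with edge set `E`) is `ε`-close to `H'₁,₃(n)`: for some valid choice of
the partition sets `W2, W3, W4`, at most `ε n⁴` edges of `H'₁,₃(n)` are missing
from `E`. -/
def CloseToH13 {α : Type} [DecidableEq α] (ε : ℝ) (n : ℕ)
    (V1 V2 V3 V4 : Finset α) (E : Finset (Finset α)) : Prop :=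
  ∃ W2 W3 W4 : Finset α, IsWChoice n V2 V3 V4 W2 W3 W4 ∧
    (((H13edges V1 V2 V3 V4 W2 W3 W4) \ E).card : ℝ) ≤ ε * n ^ 4


/-- The number of edges of `E` containing the vertex `v` (the vertex degree). -/
def hdeg {α : Type} [DecidableEq α] (E : Finset (Finset α)) (v : α) : ℕ :=
  (E.filter (fun e => v ∈ e)).card

open scoped BigOperators


lemma srs_select {α : Type} (V : Finset α) (a G : α → ℝ) (hV : V.Nonempty)
    (hG : ∀ z ∈ V, 0 ≤ G z) (K C : ℝ) (hK : 1 < K) (hC : 0 < C)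
    (hpos : 0 < 𝔼 z ∈ V, a z)
    (h : K * (C * 𝔼 z ∈ V, G z) ≤ 𝔼 z ∈ V, a z) :
    ∃ z ∈ V, C * G z ≤ a z ∧ 𝔼 z' ∈ V, max (a z' - a z) 0 ≤ (𝔼 z ∈ V, a z) / K := by
  classical
  have hCG : C * 𝔼 z ∈ V, G z ≤ (𝔼 z ∈ V, a z) / K := by
    rw [le_div_iff₀ (by linarith)]; linarith
  have hlt : (𝔼 z ∈ V, a z) / K < 𝔼 z ∈ V, a z := by
    rw [div_lt_iff₀ (by linarith)]; nlinarith
  set S := V.filter (fun z => C * G z ≤ a z ∧ 0 < a z) with hS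
  have hne : S.Nonempty := by
    by_contra hcon
    rw [Finset.not_nonempty_iff_eq_empty] at hcon
    have : 𝔼 z ∈ V, a z ≤ 𝔼 z ∈ V, C * G z := by
      apply Finset.expect_le_expect
      intro z hz
      by_contra hc
      push Not at hc
      have h0 : 0 ≤ C * G z := mul_nonneg hC.le (hG z hz)
      have : z ∈ S := by
        simp only [hS, Finset.mem_filter]; exact ⟨hz, hc.le, by linarith⟩
      rw [hcon] at this; simp at this
    rw [← Finset.mul_expect] at this
    linarith
  obtain ⟨z, hz, hmax⟩ := Finset.exists_max_image S a hne
  have hz' := hz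
  simp only [hS, Finset.mem_filter] at hz'
  refine ⟨z, hz'.1, hz'.2.1, ?_⟩
  refine le_trans ?_ hCG
  rw [Finset.mul_expect]
  apply Finset.expect_le_expect
  intro y hy
  have h0 : 0 ≤ C * G y := mul_nonneg hC.le (hG y hy)
  apply max_le _ h0
  by_contra hc
  push Not at hc
  have hzp := hz'.2.2
  have : y ∈ S := by
    simp only [hS, Finset.mem_filter]; exact ⟨hy, by linarith, by linarith⟩
  have := hmax y this
  linarith

/-- the two-rectangle form, basic lower bound -/
lemma srs_Q_bound (u v x y : ℝ) (hx : 0 ≤ x) (hy : 0 ≤ y) (hxu : x ≤ 2 - u) (hyv : y ≤ 2 - v)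
    (hu : 0 ≤ u) (hv : 0 ≤ v) (q : ℝ)
    (h00 : q ≤ u * v / 4) (h10 : q ≤ v / 2) (h01 : q ≤ u / 2) (h11 : q ≤ 1 - (2 - u) * (2 - v)) :
    q ≤ (u * v + u * y + v * x - 3 * x * y) / 4 := by
  -- bilinear
  have key : ∀ y', 0 ≤ y' → y' ≤ 2 - v → q ≤ (u * v + u * y') / 4 →
      q ≤ (u * v + u * y' + v * (2 - u) - 3 * (2 - u) * y') / 4 →
      q ≤ (u * v + u * y' + v * x - 3 * x * y') / 4 := by
    intro y' h1 h2 h3 h4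
    rcases le_total 0 (v - 3 * y') with h | h
    · nlinarith [mul_nonneg hx h]
    · nlinarith [mul_nonneg (sub_nonneg.2 hxu) (neg_nonneg.2 h)]
  apply key y hy hyv
  · nlinarith [mul_nonneg hu hy]
  · rcases le_total 0 (u - 3 * (2 - u)) with h | h
    · nlinarith [mul_nonneg hy h]
    · nlinarith [mul_nonneg (sub_nonneg.2 hyv) (neg_nonneg.2 h)]

/-- upper bound, sorted -/
lemma srs_upper_sorted (u v w x y t : ℝ) (hx : 0 ≤ x) (hy : 0 ≤ y) (hxu : x ≤ 2 - u)
    (hyv : y ≤ 2 - v) (huv : v ≤ u) (hvw : w ≤ v) (ht : 0 ≤ t) (ht' : t < 1/100)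
    (hQ : (u * v + u * y + v * x - 3 * x * y) / 4 ≤ 4/9 + t) : u + v + w ≤ 4 + 6 * t := by
  by_contra hc
  push Not at hc
  have h1 : u ≤ 2 := by linarith
  have h2 : (4 + 6 * t - u) / 2 < v := by linarith
  have h3 : 4/3 + 2 * t < u := by linarith
  set t' := min (1/18) ((u+v+w-4)/6) with htt
  have h4 : t < t' := by
    apply lt_min <;> linarith
  have h5 : t' ≤ 1/18 := min_le_left _ _
  have h6 : 6 * t' ≤ u+v+w-4 := by
    have := min_le_right (1/18) ((u+v+w-4)/6); linarith
  have hv1 : (4 + 6 * t' - u)/2 ≤ v := by linarith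
  have := srs_Q_bound u v x y hx hy hxu hyv (by linarith) (by linarith) (4/9 + t') 
    (by nlinarith) (by linarith) (by linarith) (by nlinarith)
  linarith

lemma srs_stab_sorted (u v w x y r : ℝ) (hx : 0 ≤ x) (hy : 0 ≤ y) (hxu : x ≤ 2 - u)
    (hyv : y ≤ 2 - v) (huv : v ≤ u) (hvw : w ≤ v) (hr : 0 ≤ r) (hr' : r < 1/1000)
    (hQ : (u * v + u * y + v * x - 3 * x * y) / 4 ≤ 4/9 + r) (hs : 4 - r ≤ u + v + w) :
    u ≤ 4/3 + 15 * r := by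
  by_contra hc
  push Not at hc
  have h1 : u ≤ 2 := by linarith
  have h2 : (4 - r - u) / 2 ≤ v := by linarith
  have h3 : 4/9 + r < u * v / 4 := by nlinarith
  set q := min (u * v / 4) (1/2 - r) with hq
  have h4 : 4/9 + r < q := lt_min h3 (by linarith)
  have h5 : q ≤ u * v / 4 := min_le_left _ _
  have h6 : q ≤ 1/2 - r := min_le_right _ _
  have := srs_Q_bound u v x y hx hy hxu hyv (by linarith) (by linarith) q
    h5 (by linarith) (by linarith) (by nlinarith)
  linarith

lemma srs_diff (u v x y r : ℝ) (hx : 0 ≤ x) (hy : 0 ≤ y) (hxu : x ≤ 2 - u)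
    (hyv : y ≤ 2 - v) (hr : 0 ≤ r) (hr' : r < 1/1000)
    (hu : 4/3 - 31 * r ≤ u) (hv : 4/3 - 31 * r ≤ v)
    (hQ : (u * v + u * y + v * x - 3 * x * y) / 4 ≤ 4/9 + r) : x + y ≤ 600 * r := by
  have h1 : 3 * x ≤ 2 + 93 * r := by linarith
  have h2 : 3 * y ≤ 2 + 93 * r := by linarith
  have a1 : u - 3 / 2 * x ≥ 1/3 - 78 * r := by linarith
  have a2 : v - 3 / 2 * y ≥ 1/3 - 78 * r := by linarith
  have a3 := mul_nonneg hy (sub_nonneg.2 a1)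
  have a4 := mul_nonneg hx (sub_nonneg.2 a2)
  have a5 := mul_nonneg (sub_nonneg.2 hu) (sub_nonneg.2 hv)
  nlinarith


lemma srs_six_upper (f1 f2 g1 g2 h1 h2 t : ℝ) (hf : f1 ≤ f2) (hg : g1 ≤ g2) (hh : h1 ≤ h2)
    (hf1 : f2 ≤ 1) (hg1 : g2 ≤ 1) (hh1 : h2 ≤ 1) (ht : 0 ≤ t) (ht' : t < 1/1000)
    (Qfg : f1 * g2 + f2 * g1 - f1 * g1 ≤ 4/9 + t) (Qfh : f1 * h2 + f2 * h1 - f1 * h1 ≤ 4/9 + t)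
    (Qgh : g1 * h2 + g2 * h1 - g1 * h1 ≤ 4/9 + t) :
    f1 + f2 + g1 + g2 + h1 + h2 ≤ 4 + 6 * t := by
  have key : ∀ f1 f2 g1 g2 h1 h2 : ℝ, f1 ≤ f2 → g1 ≤ g2 → f2 ≤ 1 → g2 ≤ 1 →
      f1 * g2 + f2 * g1 - f1 * g1 ≤ 4/9 + t → g1 + g2 ≤ f1 + f2 → h1 + h2 ≤ g1 + g2 →
      f1 + f2 + g1 + g2 + h1 + h2 ≤ 4 + 6 * t := by
    intro f1 f2 g1 g2 h1 h2 hf hg hf1 hg1 Q h3 h4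
    have := srs_upper_sorted (f1 + f2) (g1 + g2) (h1 + h2) (f2 - f1) (g2 - g1) t (by linarith)
      (by linarith) (by linarith) (by linarith) h3 h4 ht (by linarith) (by nlinarith)
    linarith
  rcases le_total (f1 + f2) (g1 + g2) with h | h <;>
  rcases le_total (f1 + f2) (h1 + h2) with h' | h' <;>
  rcases le_total (g1 + g2) (h1 + h2) with h'' | h''
  · linarith [key h1 h2 g1 g2 f1 f2 hh hg hh1 hg1 (by linarith) h'' h]
  · linarith [key g1 g2 h1 h2 f1 f2 hg hh hg1 hh1 (by linarith) h'' h']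
  · linarith [key h1 h2 g1 g2 f1 f2 hh hg hh1 hg1 (by linarith) h'' h]
  · linarith [key g1 g2 f1 f2 h1 h2 hg hf hg1 hf1 (by linarith) h h']
  · linarith [key h1 h2 f1 f2 g1 g2 hh hf hh1 hf1 (by linarith) h' h]
  · linarith [key f1 f2 h1 h2 g1 g2 hf hh hf1 hh1 (by linarith) (by linarith) (by linarith)]
  · linarith [key f1 f2 h1 h2 g1 g2 hf hh hf1 hh1 (by linarith) h' h'']
  · linarith [key f1 f2 g1 g2 h1 h2 hf hg hf1 hg1 (by linarith) h h'']

lemma srs_six_stab (f1 f2 g1 g2 h1 h2 r : ℝ) (hf : f1 ≤ f2) (hg : g1 ≤ g2) (hh : h1 ≤ h2)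
    (hf1 : f2 ≤ 1) (hg1 : g2 ≤ 1) (hh1 : h2 ≤ 1) (ht : 0 ≤ r) (ht' : r < 1/1000)
    (Qfg : f1 * g2 + f2 * g1 - f1 * g1 ≤ 4/9 + r) (Qfh : f1 * h2 + f2 * h1 - f1 * h1 ≤ 4/9 + r)
    (Qgh : g1 * h2 + g2 * h1 - g1 * h1 ≤ 4/9 + r) (hs : 4 - r ≤ f1 + f2 + g1 + g2 + h1 + h2) :
    2/3 - 400 * r ≤ f1 ∧ 2/3 - 400 * r ≤ g1 ∧ 2/3 - 400 * r ≤ h1 := by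
  have key : ∀ f1 f2 g1 g2 h1 h2 : ℝ, f1 ≤ f2 → g1 ≤ g2 → f2 ≤ 1 → g2 ≤ 1 →
      f1 * g2 + f2 * g1 - f1 * g1 ≤ 4/9 + r → g1 + g2 ≤ f1 + f2 → h1 + h2 ≤ g1 + g2 →
      4 - r ≤ f1 + f2 + g1 + g2 + h1 + h2 → f1 + f2 ≤ 4/3 + 15 * r := by
    intro f1 f2 g1 g2 h1 h2 hf hg hf1 hg1 Q h3 h4 h5
    have := srs_stab_sorted (f1 + f2) (g1 + g2) (h1 + h2) (f2 - f1) (g2 - g1) r (by linarith)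
      (by linarith) (by linarith) (by linarith) h3 h4 ht (by linarith) (by nlinarith) (by linarith)
    linarith
  have hall : f1 + f2 ≤ 4/3 + 15 * r ∧ g1 + g2 ≤ 4/3 + 15 * r ∧ h1 + h2 ≤ 4/3 + 15 * r := by
    rcases le_total (f1 + f2) (g1 + g2) with h | h <;>
    rcases le_total (f1 + f2) (h1 + h2) with h' | h' <;>
    rcases le_total (g1 + g2) (h1 + h2) with h'' | h''
    · have := key h1 h2 g1 g2 f1 f2 hh hg hh1 hg1 (by linarith) h'' h (by linarith)
      refine ⟨?_, ?_, ?_⟩ <;> linarith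
    · have := key g1 g2 h1 h2 f1 f2 hg hh hg1 hh1 (by linarith) h'' h' (by linarith)
      refine ⟨?_, ?_, ?_⟩ <;> linarith
    · have := key h1 h2 g1 g2 f1 f2 hh hg hh1 hg1 (by linarith) h'' h (by linarith)
      refine ⟨?_, ?_, ?_⟩ <;> linarith
    · have := key g1 g2 f1 f2 h1 h2 hg hf hg1 hf1 (by linarith) h h' (by linarith)
      refine ⟨?_, ?_, ?_⟩ <;> linarith
    · have := key h1 h2 f1 f2 g1 g2 hh hf hh1 hf1 (by linarith) h' h (by linarith)
      refine ⟨?_, ?_, ?_⟩ <;> linarith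
    · have := key f1 f2 h1 h2 g1 g2 hf hh hf1 hh1 (by linarith) (by linarith) (by linarith)
        (by linarith)
      refine ⟨?_, ?_, ?_⟩ <;> linarith
    · have := key f1 f2 h1 h2 g1 g2 hf hh hf1 hh1 (by linarith) h' h'' (by linarith)
      refine ⟨?_, ?_, ?_⟩ <;> linarith
    · have := key f1 f2 g1 g2 h1 h2 hf hg hf1 hg1 (by linarith) h h'' (by linarith)
      refine ⟨?_, ?_, ?_⟩ <;> linarith
  obtain ⟨a1, a2, a3⟩ := hall
  have d1 := srs_diff (f1 + f2) (g1 + g2) (f2 - f1) (g2 - g1) r (by linarith) (by linarith)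
    (by linarith) (by linarith) ht ht' (by linarith) (by linarith) (by nlinarith)
  have d2 := srs_diff (f1 + f2) (h1 + h2) (f2 - f1) (h2 - h1) r (by linarith) (by linarith)
    (by linarith) (by linarith) ht ht' (by linarith) (by linarith) (by nlinarith)
  refine ⟨?_, ?_, ?_⟩ <;> linarith

/-- distribution function of `X` on `V` under the uniform measure -/
noncomputable def srs_cdf {α : Type} (V : Finset α) (X : α → ℝ) (l : ℝ) : ℝ :=
  𝔼 u ∈ V, if X u < l then (1 : ℝ) else 0

lemma srs_cdf_mono {α : Type} (V : Finset α) (X : α → ℝ) {l m : ℝ} (h : l ≤ m) :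
    srs_cdf V X l ≤ srs_cdf V X m := by
  apply Finset.expect_le_expect
  intro u _
  split_ifs <;> first | linarith | norm_num

lemma srs_cdf_le_one {α : Type} (V : Finset α) (hV : V.Nonempty) (X : α → ℝ) (l : ℝ) :
    srs_cdf V X l ≤ 1 := by
  have : srs_cdf V X l ≤ 𝔼 u ∈ V, (1 : ℝ) := by
    apply Finset.expect_le_expect
    intro u _
    split_ifs <;> norm_num
  rwa [Finset.expect_const hV] at this

lemma srs_cdf_sum {α : Type} (V : Finset α) (hV : V.Nonempty) (X : α → ℝ)
    (hX : ∀ u ∈ V, 0 ≤ X u) (N : ℕ) (hN : 0 < N) :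
    (N : ℝ) - 1 - N * 𝔼 u ∈ V, X u ≤ ∑ k ∈ Finset.Icc 1 (N - 1), srs_cdf V X (k / N) := by
  unfold srs_cdf
  rw [← Finset.expect_sum_comm]
  have h1 : (N : ℝ) - 1 - N * 𝔼 u ∈ V, X u = 𝔼 u ∈ V, ((N : ℝ) - 1 - N * X u) := by
    rw [Finset.expect_sub_distrib, Finset.expect_const hV, Finset.mul_expect]
  rw [h1]
  apply Finset.expect_le_expect
  intro u hu
  have h0 := hX u hu
  rw [Finset.sum_boole]
  have hNr : (0 : ℝ) < N := by exact_mod_cast hN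
  have hsub : Finset.Icc (⌊(N : ℝ) * X u⌋₊ + 1) (N - 1) ⊆
      {k ∈ Finset.Icc 1 (N - 1) | X u < (k : ℝ) / N} := by
    intro k hk
    simp only [Finset.mem_Icc, Finset.mem_filter] at hk ⊢
    refine ⟨⟨by omega, hk.2⟩, ?_⟩
    rw [lt_div_iff₀ hNr]
    have := Nat.lt_of_floor_lt (show ⌊(N : ℝ) * X u⌋₊ < k by omega)
    linarith
  have hc := Finset.card_le_card hsub
  rw [Nat.card_Icc] at hc
  have hfl := Nat.floor_le (show 0 ≤ (N : ℝ) * X u by positivity)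
  have hc2 : N ≤ ((Finset.Icc 1 (N - 1)).filter (fun k : ℕ => X u < (k : ℝ) / N)).card + ⌊(N : ℝ) * X u⌋₊ + 1 := by
    omega
  have hc3 : (N : ℝ) ≤ ((Finset.Icc 1 (N - 1)).filter (fun k : ℕ => X u < (k : ℝ) / N)).card + ⌊(N : ℝ) * X u⌋₊ + 1 := by
    exact_mod_cast hc2
  linarith

lemma srs_cdf_pair {α : Type} (V W : Finset α) (hV : V.Nonempty) (hW : W.Nonempty) (X Y : α → ℝ)
    (t l : ℝ) (hl : l ≤ 1/2)
    (h : 5/9 - t ≤ 𝔼 u ∈ V, 𝔼 v ∈ W, if 1 ≤ X u + Y v then (1 : ℝ) else 0) :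
    srs_cdf V X l * srs_cdf W Y (1 - l) + srs_cdf V X (1 - l) * srs_cdf W Y l
      - srs_cdf V X l * srs_cdf W Y l ≤ 4/9 + t := by
  have h2 : srs_cdf V X l * srs_cdf W Y (1 - l) + srs_cdf V X (1 - l) * srs_cdf W Y l
      - srs_cdf V X l * srs_cdf W Y l
      ≤ 𝔼 u ∈ V, 𝔼 v ∈ W, ((1 : ℝ) - if 1 ≤ X u + Y v then (1 : ℝ) else 0) := by
    unfold srs_cdf
    rw [Finset.expect_mul_expect, Finset.expect_mul_expect, Finset.expect_mul_expect,
      ← Finset.expect_add_distrib, ← Finset.expect_sub_distrib]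
    apply Finset.expect_le_expect
    intro u _
    rw [← Finset.expect_add_distrib, ← Finset.expect_sub_distrib]
    apply Finset.expect_le_expect
    intro v _
    split_ifs <;> first | linarith | norm_num
  simp only [Finset.expect_sub_distrib, Finset.expect_const hV, Finset.expect_const hW] at h2
  linarith

lemma srs_prob_stab (s : ℝ) (hs : 0 < s) : ∃ t : ℝ, 0 < t ∧ t ≤ s ∧
    ∀ (α : Type) (V2 V3 V4 : Finset α), V2.Nonempty → V3.Nonempty → V4.Nonempty →
    ∀ (X2 X3 X4 : α → ℝ) (μ : ℝ), (∀ u ∈ V2, 0 ≤ X2 u) → (∀ u ∈ V3, 0 ≤ X3 u) →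
    (∀ u ∈ V4, 0 ≤ X4 u) → 0 ≤ μ →
    (5/9 - t ≤ 𝔼 u ∈ V2, 𝔼 v ∈ V3, if 1 ≤ X2 u + X3 v then (1 : ℝ) else 0) →
    (5/9 - t ≤ 𝔼 u ∈ V2, 𝔼 v ∈ V4, if 1 ≤ X2 u + X4 v then (1 : ℝ) else 0) →
    (5/9 - t ≤ 𝔼 u ∈ V3, 𝔼 v ∈ V4, if 1 ≤ X3 u + X4 v then (1 : ℝ) else 0) →
    (𝔼 u ∈ V2, X2 u) + (𝔼 u ∈ V3, X3 u) + (𝔼 u ∈ V4, X4 u) ≤ 1 + t - μ →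
    μ ≤ s ∧ 2/3 - s ≤ srs_cdf V2 X2 (1/5) ∧ 2/3 - s ≤ srs_cdf V3 X3 (1/5) ∧
      2/3 - s ≤ srs_cdf V4 X4 (1/5) := by
  obtain ⟨r, hr0, hr1, hrs⟩ : ∃ r : ℝ, 0 < r ∧ r < 1/1000 ∧ 400 * r ≤ s :=
    ⟨min (1/2000) (s/400), by positivity, by
      have := min_le_left (1/2000) (s/400); linarith, by
      have := min_le_right (1/2000) (s/400); linarith⟩
  obtain ⟨M, hM⟩ := exists_nat_gt (4 / r)
  have hMr : 4 < M * r := by rwa [div_lt_iff₀ hr0] at hM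
  have hM0 : (0 : ℝ) < M := lt_trans (by positivity) hM
  have hM0' : 0 < M := by exact_mod_cast hM0
  have hM1 : (1 : ℝ) ≤ M := by exact_mod_cast hM0'
  obtain ⟨t, ht0, ht1, ht2⟩ : ∃ t : ℝ, 0 < t ∧ t ≤ r / 10 ∧ 40 * M * t ≤ 1 := by
    refine ⟨min (r/10) (1 / (40 * M)), by positivity, min_le_left _ _, ?_⟩
    have := min_le_right (r/10) (1 / (40 * (M:ℝ)))
    rw [le_div_iff₀ (by positivity)] at this
    linarith
  refine ⟨t, ht0, by linarith, ?_⟩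
  intro α V2 V3 V4 n2 n3 n4 X2 X3 X4 μ p2 p3 p4 hμ h23 h24 h34 hmean
  set N := 5 * M with hN
  have hN0 : 0 < N := by omega
  have hNr : (N : ℝ) = 5 * M := by rw [hN]; push_cast; ring
  have hNr0 : (0 : ℝ) < N := by exact_mod_cast hN0
  set T : ℝ → ℝ := fun l => srs_cdf V2 X2 l + srs_cdf V3 X3 l + srs_cdf V4 X4 l with hT
  have upper : ∀ l : ℝ, l ≤ 1/2 → T l + T (1 - l) ≤ 4 + 6 * t := by
    intro l hl
    have hl' : l ≤ 1 - l := by linarith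
    have := srs_six_upper _ _ _ _ _ _ t (srs_cdf_mono V2 X2 hl') (srs_cdf_mono V3 X3 hl')
      (srs_cdf_mono V4 X4 hl') (srs_cdf_le_one V2 n2 X2 _) (srs_cdf_le_one V3 n3 X3 _)
      (srs_cdf_le_one V4 n4 X4 _) ht0.le (by linarith) (srs_cdf_pair V2 V3 n2 n3 X2 X3 t l hl h23)
      (srs_cdf_pair V2 V4 n2 n4 X2 X4 t l hl h24) (srs_cdf_pair V3 V4 n3 n4 X3 X4 t l hl h34)
    simp only [hT]; linarith
  have upper' : ∀ l : ℝ, T l + T (1 - l) ≤ 4 + 6 * t := by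
    intro l
    rcases le_total l (1/2) with hl | hl
    · exact upper l hl
    · have := upper (1 - l) (by linarith)
      rw [sub_sub_cancel] at this; linarith
  have stab : ∀ l : ℝ, l ≤ 1/5 → 4 - r ≤ T l + T (1 - l) → 2/3 - s ≤ srs_cdf V2 X2 (1/5) ∧
      2/3 - s ≤ srs_cdf V3 X3 (1/5) ∧ 2/3 - s ≤ srs_cdf V4 X4 (1/5) := by
    intro l hl hge
    have hl' : l ≤ 1 - l := by linarith
    have hl2 : l ≤ 1/2 := by linarith
    have q1 := srs_cdf_pair V2 V3 n2 n3 X2 X3 t l hl2 h23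
    have q2 := srs_cdf_pair V2 V4 n2 n4 X2 X4 t l hl2 h24
    have q3 := srs_cdf_pair V3 V4 n3 n4 X3 X4 t l hl2 h34
    have := srs_six_stab _ _ _ _ _ _ r (srs_cdf_mono V2 X2 hl') (srs_cdf_mono V3 X3 hl')
      (srs_cdf_mono V4 X4 hl') (srs_cdf_le_one V2 n2 X2 _) (srs_cdf_le_one V3 n3 X3 _)
      (srs_cdf_le_one V4 n4 X4 _) hr0.le hr1 (by linarith) (by linarith) (by linarith)
      (by simp only [hT] at hge; linarith)
    have m2 := srs_cdf_mono V2 X2 hl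
    have m3 := srs_cdf_mono V3 X3 hl
    have m4 := srs_cdf_mono V4 X4 hl
    refine ⟨?_, ?_, ?_⟩ <;> linarith [this.1, this.2.1, this.2.2]
  have s2 := srs_cdf_sum V2 n2 X2 p2 N hN0
  have s3 := srs_cdf_sum V3 n3 X3 p3 N hN0
  have s4 := srs_cdf_sum V4 n4 X4 p4 N hN0
  have hsum : 2 * (N : ℝ) - 3 - N * t + N * μ ≤ ∑ k ∈ Finset.Icc 1 (N - 1), T (k / N) := by
    simp only [hT, Finset.sum_add_distrib]
    nlinarith
  have hrefl : ∑ k ∈ Finset.Icc 1 (N - 1), T (1 - k / N) = ∑ k ∈ Finset.Icc 1 (N - 1), T (k / N) := by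
    apply Finset.sum_nbij' (fun k => N - k) (fun k => N - k)
    · intro k hk; simp only [Finset.mem_Icc] at hk ⊢; omega
    · intro k hk; simp only [Finset.mem_Icc] at hk ⊢; omega
    · intro k hk; simp only [Finset.mem_Icc] at hk; omega
    · intro k hk; simp only [Finset.mem_Icc] at hk; omega
    · intro k hk
      simp only [Finset.mem_Icc] at hk
      rw [Nat.cast_sub (by omega)]
      congr 1
      field_simp
  have htot : 4 * (N : ℝ) - 6 - 2 * N * t + 2 * N * μ ≤
      ∑ k ∈ Finset.Icc 1 (N - 1), (T (k / N) + T (1 - k / N)) := by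
    rw [Finset.sum_add_distrib, hrefl]; linarith
  have hcard : ((Finset.Icc 1 (N - 1)).card : ℝ) = N - 1 := by
    rw [Nat.card_Icc, Nat.add_sub_cancel, Nat.cast_sub (by omega)]; simp
  have hμs : μ ≤ s := by
    have : ∑ k ∈ Finset.Icc 1 (N - 1), (T (k / N) + T (1 - k / N)) ≤
        ∑ k ∈ Finset.Icc 1 (N - 1), (4 + 6 * t) := Finset.sum_le_sum (fun k _ => upper' _)
    rw [Finset.sum_const, nsmul_eq_mul, hcard] at this
    have h1 : (N : ℝ) * μ ≤ 1 + 4 * N * t := by nlinarith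
    rw [hNr] at h1
    by_contra hc
    push Not at hc
    have : r * M < μ * M := mul_lt_mul_of_pos_right (by linarith) hM0
    nlinarith
  refine ⟨hμs, ?_⟩
  by_contra hc
  have hlow : ∀ l : ℝ, l ≤ 1/5 → T l + T (1 - l) ≤ 4 - r := by
    intro l hl
    by_contra h'
    push Not at h'
    exact hc (stab l hl h'.le)
  have : ∑ k ∈ Finset.Icc 1 (N - 1), (T (k / N) + T (1 - k / N)) ≤
      ∑ k ∈ Finset.Icc 1 (N - 1), ((4 + 6 * t) - if k ≤ M then r else 0) := by
    apply Finset.sum_le_sum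
    intro k hk
    split_ifs with hkM
    · have : (k : ℝ) / N ≤ 1/5 := by
        rw [div_le_iff₀ hNr0, hNr]
        have : (k : ℝ) ≤ M := by exact_mod_cast hkM
        linarith
      have := hlow _ this
      linarith
    · have := upper' (k / N); linarith
  rw [Finset.sum_sub_distrib, Finset.sum_const, nsmul_eq_mul, hcard, ← Finset.sum_filter,
    Finset.sum_const, nsmul_eq_mul] at this
  have hM' : (Finset.Icc 1 (N - 1)).filter (fun k => k ≤ M) = Finset.Icc 1 M := by
    ext k; simp only [Finset.mem_filter, Finset.mem_Icc]; omega
  rw [hM', Nat.card_Icc, Nat.add_sub_cancel] at this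
  have : (M : ℝ) * r ≤ 2 + 8 * N * t := by nlinarith
  rw [hNr] at this
  nlinarith


lemma srs_link_one {α : Type} (V3 V4 : Finset α) (h : α → α → ℝ)
    (h0 : ∀ v w, 0 ≤ h v w) (h1 : ∀ v w, h v w ≤ 1) (b3 b4 : α → ℝ) (B α3 α4 s θ γ : ℝ)
    (hs : 0 < s) (hθ : 0 < θ) (hθ1 : θ < 1) (hB : B + α3 + α4 = s)
    (hg : 𝔼 v ∈ V3, 𝔼 w ∈ V4, h v w * max (B + b3 v + b4 w) 0 ≤ θ ^ 2 * s)
    (hdeg : 5/9 - γ ≤ 𝔼 v ∈ V3, 𝔼 w ∈ V4, h v w) :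
    5/9 - (γ + θ) ≤ 𝔼 v ∈ V3, 𝔼 w ∈ V4,
      if 1 ≤ max (α3 - b3 v) 0 / ((1 - θ) * s) + max (α4 - b4 w) 0 / ((1 - θ) * s)
        then (1 : ℝ) else 0 := by
  have hd : 0 < (1 - θ) * s := mul_pos (by linarith) hs
  have hts : 0 < θ * s := mul_pos hθ hs
  have key : 𝔼 v ∈ V3, 𝔼 w ∈ V4, h v w ≤ 𝔼 v ∈ V3, 𝔼 w ∈ V4,
      ((if 1 ≤ max (α3 - b3 v) 0 / ((1 - θ) * s) + max (α4 - b4 w) 0 / ((1 - θ) * s)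
        then (1 : ℝ) else 0) + (h v w * max (B + b3 v + b4 w) 0) / (θ * s)) := by
    apply Finset.expect_le_expect
    intro v _
    apply Finset.expect_le_expect
    intro w _
    have hnn : 0 ≤ (h v w * max (B + b3 v + b4 w) 0) / (θ * s) :=
      div_nonneg (mul_nonneg (h0 v w) (le_max_right _ _)) hts.le
    split_ifs with hc
    · linarith [h1 v w]
    · push Not at hc
      rw [← add_div, div_lt_one hd] at hc
      have e1 := le_max_left (α3 - b3 v) 0
      have e2 := le_max_left (α4 - b4 w) 0
      have e3 := le_max_left (B + b3 v + b4 w) 0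
      have : θ * s ≤ max (B + b3 v + b4 w) 0 := by nlinarith
      rw [zero_add, le_div_iff₀ hts]
      exact mul_le_mul_of_nonneg_left this (h0 v w)
  simp only [Finset.expect_add_distrib, ← Finset.expect_div] at key
  have : (𝔼 v ∈ V3, 𝔼 w ∈ V4, h v w * max (B + b3 v + b4 w) 0) / (θ * s) ≤ θ := by
    rw [div_le_iff₀ hts]; nlinarith
  linarith

lemma srs_mean_split {α : Type} (V : Finset α) (hV : V.Nonempty) (b : α → ℝ) (c : ℝ) :
    𝔼 u ∈ V, max (c - b u) 0 = c - (𝔼 u ∈ V, b u) + 𝔼 u ∈ V, max (b u - c) 0 := by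
  have : 𝔼 u ∈ V, max (c - b u) 0 = 𝔼 u ∈ V, (c - b u + max (b u - c) 0) := by
    apply Finset.expect_congr rfl
    intro u _
    rcases le_total (b u) c with h | h
    · rw [max_eq_left (by linarith), max_eq_right (by linarith)]; ring
    · rw [max_eq_right (by linarith), max_eq_left (by linarith)]; ring
  rw [this, Finset.expect_add_distrib, Finset.expect_sub_distrib, Finset.expect_const hV]

/-- stage two selection in one class -/
lemma srs_stage {α : Type} (V : Finset α) (hV : V.Nonempty) (b G : α → ℝ) (c K : ℝ)
    (hG : ∀ z ∈ V, 0 ≤ G z) (hK : 1 < K) (D : ℝ) (hD : 0 < D)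
    (hpos : 0 < c + 𝔼 z ∈ V, b z)
    (h : K * (D * 𝔼 z ∈ V, G z) ≤ c + 𝔼 z ∈ V, b z) :
    ∃ z ∈ V, D * G z ≤ c + b z ∧ 𝔼 z' ∈ V, max (b z' - b z) 0 ≤ (c + 𝔼 z ∈ V, b z) / K := by
  have e : 𝔼 z ∈ V, (c + b z) = c + 𝔼 z ∈ V, b z := by
    rw [Finset.expect_add_distrib, Finset.expect_const hV]
  obtain ⟨z, hz, h1, h2⟩ := srs_select V (fun z => c + b z) G hV hG K D hK hD (by rw [e]; exact hpos)
    (by rw [e]; exact h)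
  refine ⟨z, hz, h1, ?_⟩
  simp only [e, add_sub_add_left_eq_sub] at h2
  exact h2

set_option maxHeartbeats 2000000 in
lemma srs_dual (σ : ℝ) (hσ : 0 < σ) : ∃ C γ0 : ℝ, 0 < C ∧ 0 < γ0 ∧
    ∀ (α : Type) [DecidableEq α] (V1 V2 V3 V4 : Finset α), V1.Nonempty → V2.Nonempty → V3.Nonempty →
    V4.Nonempty → ∀ (h : α → α → α → α → ℝ), (∀ x u v w, 0 ≤ h x u v w) →
    (∀ x u v w, h x u v w ≤ 1) → 
    (∀ x ∈ V1, ∀ u ∈ V2, 5/9 - γ0 ≤ 𝔼 v ∈ V3, 𝔼 w ∈ V4, h x u v w) →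
    (∀ x ∈ V1, ∀ v ∈ V3, 5/9 - γ0 ≤ 𝔼 u ∈ V2, 𝔼 w ∈ V4, h x u v w) →
    (∀ x ∈ V1, ∀ w ∈ V4, 5/9 - γ0 ≤ 𝔼 u ∈ V2, 𝔼 v ∈ V3, h x u v w) →
    ∀ (a b2 b3 b4 : α → ℝ),
    C * (𝔼 x ∈ V1, 𝔼 u ∈ V2, 𝔼 v ∈ V3, 𝔼 w ∈ V4,
      h x u v w * max (a x + b2 u + b3 v + b4 w) 0) <
      (𝔼 x ∈ V1, a x) + (𝔼 u ∈ V2, b2 u) + (𝔼 v ∈ V3, b3 v) + (𝔼 w ∈ V4, b4 w) →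
    ∃ U1 U2 U3 U4 : Finset α, U1 ⊆ V1 ∧ U2 ⊆ V2 ∧ U3 ⊆ V3 ∧ U4 ⊆ V4 ∧
      (1 - σ ≤ 𝔼 x ∈ V1, if x ∈ U1 then (1 : ℝ) else 0) ∧
      (2/3 - σ ≤ 𝔼 x ∈ V2, if x ∈ U2 then (1 : ℝ) else 0) ∧
      (2/3 - σ ≤ 𝔼 x ∈ V3, if x ∈ U3 then (1 : ℝ) else 0) ∧
      (2/3 - σ ≤ 𝔼 x ∈ V4, if x ∈ U4 then (1 : ℝ) else 0) ∧
      𝔼 x ∈ V1, 𝔼 u ∈ V2, 𝔼 v ∈ V3, 𝔼 w ∈ V4,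
        (if x ∈ U1 ∧ u ∈ U2 ∧ v ∈ U3 ∧ w ∈ U4 then h x u v w else 0) ≤ σ := by
  obtain ⟨t, ht0, hts, hstab⟩ := srs_prob_stab (σ / 20) (by positivity)
  obtain ⟨θ, hθ0, hθt, hθ1⟩ : ∃ θ : ℝ, 0 < θ ∧ θ ≤ t / 2 ∧ θ ≤ 1/2 :=
    ⟨min (t/2) (1/2), by positivity, min_le_left _ _, min_le_right _ _⟩
  obtain ⟨K, hK100, hKθ⟩ : ∃ K : ℝ, 100 ≤ K ∧ 2 ≤ θ ^ 2 * K := by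
    refine ⟨max 100 (2 / θ ^ 2), le_max_left _ _, ?_⟩
    have := le_max_right 100 (2 / θ ^ 2)
    rw [div_le_iff₀ (by positivity)] at this
    linarith
  have hK0 : 0 < K := by linarith
  refine ⟨K ^ 3, t / 2, by positivity, by positivity, ?_⟩
  intro α _ V1 V2 V3 V4 n1 n2 n3 n4 h h0 h1 d2 d3 d4 a b2 b3 b4 hA
  set m2 := 𝔼 u ∈ V2, b2 u with hm2
  set m3 := 𝔼 u ∈ V3, b3 u with hm3
  set m4 := 𝔼 u ∈ V4, b4 u with hm4
  set m1 := 𝔼 u ∈ V1, a u with hm1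
  have hGnn : ∀ x u v w, 0 ≤ h x u v w * max (a x + b2 u + b3 v + b4 w) 0 :=
    fun x u v w => mul_nonneg (h0 x u v w) (le_max_right _ _)
  set G : α → ℝ := fun x => 𝔼 u ∈ V2, 𝔼 v ∈ V3, 𝔼 w ∈ V4,
      h x u v w * max (a x + b2 u + b3 v + b4 w) 0 with hG
  have hGn : ∀ x ∈ V1, 0 ≤ G x := fun x _ => Finset.expect_nonneg fun u _ =>
    Finset.expect_nonneg fun v _ => Finset.expect_nonneg fun w _ => hGnn x u v w
  set f := 𝔼 x ∈ V1, G x with hf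
  have hf0 : 0 ≤ f := Finset.expect_nonneg hGn
  set A := m1 + m2 + m3 + m4 with hAdef
  have hApos : 0 < A := lt_of_le_of_lt (by positivity) hA
  obtain ⟨x, hx, hx1, hx2⟩ := srs_stage V1 n1 a G (m2 + m3 + m4) K hGn (by linarith) (K ^ 2)
    (by positivity) (by rw [← hm1]; linarith) (by rw [← hm1]; linarith only [hA, hAdef, show K * (K ^ 2 * f) = K ^ 3 * f by ring])
  rw [← hm1] at hx2
  have hAeq : m2 + m3 + m4 + m1 = A := by rw [hAdef]; ring
  rw [hAeq] at hx2
  set Ax := m2 + m3 + m4 + a x with hAx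
  have hAK : A / K ≤ A / 100 := by gcongr
  have hsplit1 := srs_mean_split V1 n1 a (a x)
  have hnn1 : 0 ≤ 𝔼 u ∈ V1, max (a x - a u) 0 := Finset.expect_nonneg fun _ _ => le_max_right _ _
  have hAxA : A ≤ 2 * Ax := by linarith
  have hAx0 : 0 < Ax := by linarith
  -- stage two
  have hGx : K * (K * G x) ≤ Ax := by linarith [hx1, show K * (K * G x) = K ^ 2 * G x by ring]
  have hG2 : G x = 𝔼 u ∈ V2, 𝔼 v ∈ V3, 𝔼 w ∈ V4,
      h x u v w * max (a x + b2 u + b3 v + b4 w) 0 := rfl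
  have hG3 : G x = 𝔼 v ∈ V3, 𝔼 u ∈ V2, 𝔼 w ∈ V4,
      h x u v w * max (a x + b2 u + b3 v + b4 w) 0 := by
    rw [hG2, Finset.expect_comm]
  have hG4 : G x = 𝔼 w ∈ V4, 𝔼 u ∈ V2, 𝔼 v ∈ V3,
      h x u v w * max (a x + b2 u + b3 v + b4 w) 0 := by
    rw [hG2, Finset.expect_comm]
    rw [Finset.expect_comm]
    conv_rhs => rw [Finset.expect_comm]
    apply Finset.expect_congr rfl
    intro u _
    rw [Finset.expect_comm]
  obtain ⟨u2, hu2, hu2a, hu2b⟩ := srs_stage V2 n2 b2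
    (fun u => 𝔼 v ∈ V3, 𝔼 w ∈ V4, h x u v w * max (a x + b2 u + b3 v + b4 w) 0)
    (a x + m3 + m4) K (fun u _ => Finset.expect_nonneg fun v _ => Finset.expect_nonneg
      fun w _ => hGnn x u v w) (by linarith) K hK0 (by rw [← hm2]; linarith)
      (by rw [← hm2, ← hG2]; linarith)
  obtain ⟨u3, hu3, hu3a, hu3b⟩ := srs_stage V3 n3 b3
    (fun v => 𝔼 u ∈ V2, 𝔼 w ∈ V4, h x u v w * max (a x + b2 u + b3 v + b4 w) 0)
    (a x + m2 + m4) K (fun v _ => Finset.expect_nonneg fun u _ => Finset.expect_nonneg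
      fun w _ => hGnn x u v w) (by linarith) K hK0 (by rw [← hm3]; linarith)
      (by rw [← hm3, ← hG3]; linarith)
  obtain ⟨u4, hu4, hu4a, hu4b⟩ := srs_stage V4 n4 b4
    (fun w => 𝔼 u ∈ V2, 𝔼 v ∈ V3, h x u v w * max (a x + b2 u + b3 v + b4 w) 0)
    (a x + m2 + m3) K (fun w _ => Finset.expect_nonneg fun u _ => Finset.expect_nonneg
      fun v _ => hGnn x u v w) (by linarith) K hK0 (by rw [← hm4]; linarith)
      (by rw [← hm4, ← hG4]; linarith)
  rw [← hm2, show a x + m3 + m4 + m2 = Ax by rw [hAx]; ring] at hu2b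
  rw [← hm3, show a x + m2 + m4 + m3 = Ax by rw [hAx]; ring] at hu3b
  rw [← hm4, show a x + m2 + m3 + m4 = Ax by rw [hAx]; ring] at hu4b
  have hAxK : Ax / K ≤ Ax / 100 := by gcongr
  have sp2 := srs_mean_split V2 n2 b2 (b2 u2)
  have sp3 := srs_mean_split V3 n3 b3 (b3 u3)
  have sp4 := srs_mean_split V4 n4 b4 (b4 u4)
  rw [← hm2] at sp2
  rw [← hm3] at sp3
  rw [← hm4] at sp4
  rw [← hm1] at hsplit1
  have nn2 : 0 ≤ 𝔼 u ∈ V2, max (b2 u2 - b2 u) 0 := Finset.expect_nonneg fun _ _ => le_max_right _ _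
  have nn3 : 0 ≤ 𝔼 u ∈ V3, max (b3 u3 - b3 u) 0 := Finset.expect_nonneg fun _ _ => le_max_right _ _
  have nn4 : 0 ≤ 𝔼 u ∈ V4, max (b4 u4 - b4 u) 0 := Finset.expect_nonneg fun _ _ => le_max_right _ _
  set s := a x + b2 u2 + b3 u3 + b4 u4 with hs
  have hsAx : Ax / 2 ≤ s := by linarith
  have hs0 : 0 < s := by linarith
  have hg : ∀ g B : ℝ, K * g ≤ B → B ≤ 2 * s → g ≤ θ ^ 2 * s := by
    intro g B h1 h2
    have : K * g ≤ K * (θ ^ 2 * s) := by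
      have h3 := mul_le_mul_of_nonneg_right hKθ hs0.le
      linarith only [h1, h2, h3, show K * (θ ^ 2 * s) = θ ^ 2 * K * s by ring]
    exact le_of_mul_le_mul_left this hK0
  have l2 := srs_link_one V3 V4 (fun v w => h x u2 v w) (fun _ _ => h0 _ _ _ _)
    (fun _ _ => h1 _ _ _ _) b3 b4 (a x + b2 u2) (b3 u3) (b4 u4) s θ (t / 2) hs0 hθ0
    (by linarith) hs.symm (hg _ _ hu2a (by linarith)) (d2 x hx u2 hu2)
  have l3 := srs_link_one V2 V4 (fun u w => h x u u3 w) (fun _ _ => h0 _ _ _ _)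
    (fun _ _ => h1 _ _ _ _) b2 b4 (a x + b3 u3) (b2 u2) (b4 u4) s θ (t / 2) hs0 hθ0
    (by linarith) (by rw [hs]; ring) (hg _ _ (by
      simp only [show ∀ u w, a x + b3 u3 + b2 u + b4 w = a x + b2 u + b3 u3 + b4 w from
        fun u w => by ring]
      exact hu3a) (by linarith)) (d3 x hx u3 hu3)
  have l4 := srs_link_one V2 V3 (fun u v => h x u v u4) (fun _ _ => h0 _ _ _ _)
    (fun _ _ => h1 _ _ _ _) b2 b3 (a x + b4 u4) (b2 u2) (b3 u3) s θ (t / 2) hs0 hθ0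
    (by linarith) (by rw [hs]; ring) (hg _ _ (by
      simp only [show ∀ u v, a x + b4 u4 + b2 u + b3 v = a x + b2 u + b3 v + b4 u4 from
        fun u w => by ring]
      exact hu4a) (by linarith)) (d4 x hx u4 hu4)
  have hd : 0 < (1 - θ) * s := mul_pos (by linarith) hs0
  set X2 : α → ℝ := fun u => max (b2 u2 - b2 u) 0 / ((1 - θ) * s) with hX2
  set X3 : α → ℝ := fun u => max (b3 u3 - b3 u) 0 / ((1 - θ) * s) with hX3
  set X4 : α → ℝ := fun u => max (b4 u4 - b4 u) 0 / ((1 - θ) * s) with hX4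
  have st := hstab α V2 V3 V4 n2 n3 n4 X2 X3 X4 (Ax / (2 * s))
    (fun u _ => div_nonneg (le_max_right _ _) hd.le)
    (fun u _ => div_nonneg (le_max_right _ _) hd.le)
    (fun u _ => div_nonneg (le_max_right _ _) hd.le) (by positivity)
    (by linarith [l4]) (by linarith [l3]) (by linarith [l2])
    (by
      simp only [hX2, hX3, hX4]
      rw [← Finset.expect_div, ← Finset.expect_div, ← Finset.expect_div, ← add_div, ← add_div,
        div_le_iff₀ hd]
      have e1 : (1 + t - Ax / (2 * s)) * ((1 - θ) * s)
          = (1 + t) * (1 - θ) * s - (1 - θ) * (Ax / 2) := by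
        field_simp
      rw [e1]
      have e2 : 1 ≤ (1 + t) * (1 - θ) := by nlinarith only [ht0, hθ0, hθt, hθ1, mul_le_mul_of_nonneg_left hθ1 ht0.le]
      have e3 : s ≤ (1 + t) * (1 - θ) * s := by nlinarith only [e2, hs0]
      have e4 : (1 - θ) * (Ax / 2) ≤ Ax / 2 := by nlinarith only [hθ0, hAx0]
      linarith)
  obtain ⟨c1, c2, c3, c4⟩ := st
  rw [div_le_iff₀ (by positivity)] at c1
  have hloc : ∀ (b : α → ℝ) (c : ℝ) (u : α), max (c - b u) 0 / ((1 - θ) * s) < 1/5 →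
      c - s / 5 ≤ b u := by
    intro b c u hlt
    rw [div_lt_iff₀ hd] at hlt
    have := le_max_left (c - b u) 0
    nlinarith only [this, hlt, mul_pos hθ0 hs0]
  have hcdf : ∀ (V : Finset α) (X : α → ℝ), srs_cdf V X (1/5) =
      𝔼 z ∈ V, if z ∈ V.filter (fun z => X z < 1/5) then (1 : ℝ) else 0 := by
    intro V X
    unfold srs_cdf
    apply Finset.expect_congr rfl
    intro z hz
    simp [hz]
  refine ⟨V1.filter (fun z => a x - a z < s / 5), V2.filter (fun z => X2 z < 1/5),
    V3.filter (fun z => X3 z < 1/5), V4.filter (fun z => X4 z < 1/5), Finset.filter_subset _ _,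
    Finset.filter_subset _ _, Finset.filter_subset _ _, Finset.filter_subset _ _, ?_, ?_, ?_, ?_, ?_⟩
  · have : 𝔼 z ∈ V1, (1 - 5 / s * max (a x - a z) 0) ≤
        𝔼 z ∈ V1, if z ∈ V1.filter (fun z => a x - a z < s / 5) then (1 : ℝ) else 0 := by
      apply Finset.expect_le_expect
      intro z hz
      simp only [Finset.mem_filter, hz, true_and]
      split_ifs with hc
      · have : 0 ≤ 5 / s * max (a x - a z) 0 := by positivity
        linarith
      · push Not at hc
        have h1 : s / 5 ≤ max (a x - a z) 0 := le_trans hc (le_max_left _ _)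
        have h2 : 5 / s * (s / 5) ≤ 5 / s * max (a x - a z) 0 := by gcongr
        have h3 : 5 / s * (s / 5) = 1 := by field_simp
        linarith
    rw [Finset.expect_sub_distrib, Finset.expect_const n1, ← Finset.mul_expect] at this
    have h5 : 5 / s * 𝔼 z ∈ V1, max (a x - a z) 0 ≤ σ := by
      rw [div_mul_eq_mul_div, div_le_iff₀ hs0]
      linarith
    linarith
  · rw [← hcdf]; linarith
  · rw [← hcdf]; linarith
  · rw [← hcdf]; linarith
  · have : 𝔼 x' ∈ V1, 𝔼 u ∈ V2, 𝔼 v ∈ V3, 𝔼 w ∈ V4,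
        (if x' ∈ V1.filter (fun z => a x - a z < s / 5) ∧ u ∈ V2.filter (fun z => X2 z < 1/5) ∧
          v ∈ V3.filter (fun z => X3 z < 1/5) ∧ w ∈ V4.filter (fun z => X4 z < 1/5)
          then h x' u v w else 0) ≤
        𝔼 x' ∈ V1, 𝔼 u ∈ V2, 𝔼 v ∈ V3, 𝔼 w ∈ V4,
          5 / s * (h x' u v w * max (a x' + b2 u + b3 v + b4 w) 0) := by
      apply Finset.expect_le_expect
      intro x' _
      apply Finset.expect_le_expect
      intro u _
      apply Finset.expect_le_expect
      intro v _
      apply Finset.expect_le_expect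
      intro w _
      have hh := hGnn x' u v w
      split_ifs with hc
      · simp only [Finset.mem_filter] at hc
        obtain ⟨⟨_, q1⟩, ⟨_, q2⟩, ⟨_, q3⟩, ⟨_, q4⟩⟩ := hc
        have q2' := hloc b2 (b2 u2) u q2
        have q3' := hloc b3 (b3 u3) v q3
        have q4' := hloc b4 (b4 u4) w q4
        have : s / 5 ≤ max (a x' + b2 u + b3 v + b4 w) 0 :=
          le_trans (by linarith) (le_max_left _ _)
        have h2 : 5 / s * (h x' u v w * (s / 5)) ≤
          5 / s * (h x' u v w * max (a x' + b2 u + b3 v + b4 w) 0) := by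
          have := h0 x' u v w
          gcongr
        have h3 : 5 / s * (h x' u v w * (s / 5)) = h x' u v w := by field_simp
        linarith
      · positivity
    simp only [← Finset.mul_expect] at this
    refine le_trans this ?_
    change 5 / s * f ≤ σ
    rw [div_mul_eq_mul_div, div_le_iff₀ hs0]
    have hfK : 100 * f ≤ K ^ 3 * f := by
      apply mul_le_mul_of_nonneg_right _ hf0
      calc (100 : ℝ) ≤ K := hK100
        _ = K ^ 1 := (pow_one K).symm
        _ ≤ K ^ 3 := pow_le_pow_right₀ (by linarith) (by norm_num)
    have hf2 : 100 * f ≤ A := by linarith only [hfK, hA]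
    have c1' : Ax ≤ σ / 10 * s := by linarith only [c1]
    linarith only [hf2, c1', hAxA, mul_pos hσ hs0]


lemma srs_decomp {α : Type} [DecidableEq α] {V1 V2 V3 V4 : Finset α} {e : Finset α}
    (hsub : e ⊆ V1 ∪ V2 ∪ V3 ∪ V4) (h1 : (e ∩ V1).card = 1) (h2 : (e ∩ V2).card = 1)
    (h3 : (e ∩ V3).card = 1) (h4 : (e ∩ V4).card = 1) :
    ∃ x ∈ V1, ∃ u ∈ V2, ∃ v ∈ V3, ∃ w ∈ V4, e = {x, u, v, w} := by
  obtain ⟨x, hx⟩ := Finset.card_eq_one.1 h1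
  obtain ⟨u, hu⟩ := Finset.card_eq_one.1 h2
  obtain ⟨v, hv⟩ := Finset.card_eq_one.1 h3
  obtain ⟨w, hw⟩ := Finset.card_eq_one.1 h4
  have hx' := Finset.ext_iff.1 hx
  have hu' := Finset.ext_iff.1 hu
  have hv' := Finset.ext_iff.1 hv
  have hw' := Finset.ext_iff.1 hw
  simp only [Finset.mem_inter, Finset.mem_singleton] at hx' hu' hv' hw'
  refine ⟨x, ((hx' x).2 rfl).2, u, ((hu' u).2 rfl).2, v, ((hv' v).2 rfl).2, w,
    ((hw' w).2 rfl).2, ?_⟩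
  ext z
  simp only [Finset.mem_insert, Finset.mem_singleton]
  constructor
  · intro hz
    have := hsub hz
    simp only [Finset.mem_union] at this
    rcases this with ((h | h) | h) | h
    · exact Or.inl ((hx' z).1 ⟨hz, h⟩)
    · exact Or.inr (Or.inl ((hu' z).1 ⟨hz, h⟩))
    · exact Or.inr (Or.inr (Or.inl ((hv' z).1 ⟨hz, h⟩)))
    · exact Or.inr (Or.inr (Or.inr ((hw' z).1 ⟨hz, h⟩)))
  · rintro (rfl | rfl | rfl | rfl)
    · exact ((hx' z).2 rfl).1
    · exact ((hu' z).2 rfl).1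
    · exact ((hv' z).2 rfl).1
    · exact ((hw' z).2 rfl).1

/-- the four classes are pairwise disjoint -/
structure SrsDisj {α : Type} (V1 V2 V3 V4 : Finset α) : Prop where
  d12 : Disjoint V1 V2
  d13 : Disjoint V1 V3
  d14 : Disjoint V1 V4
  d23 : Disjoint V2 V3
  d24 : Disjoint V2 V4
  d34 : Disjoint V3 V4

lemma srs_mem1 {α : Type} [DecidableEq α] {V1 V2 V3 V4 : Finset α} (hd : SrsDisj V1 V2 V3 V4)
    {x u v w z : α} (hu : u ∈ V2) (hv : v ∈ V3) (hw : w ∈ V4)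
    (hz : z ∈ V1) (h : z ∈ ({x, u, v, w} : Finset α)) : z = x := by
  simp only [Finset.mem_insert, Finset.mem_singleton] at h
  rcases h with h | rfl | rfl | rfl
  · exact h
  · exact absurd hu (Finset.disjoint_left.1 hd.d12 hz)
  · exact absurd hv (Finset.disjoint_left.1 hd.d13 hz)
  · exact absurd hw (Finset.disjoint_left.1 hd.d14 hz)

lemma srs_mem2 {α : Type} [DecidableEq α] {V1 V2 V3 V4 : Finset α} (hd : SrsDisj V1 V2 V3 V4)
    {x u v w z : α} (hx : x ∈ V1) (hv : v ∈ V3) (hw : w ∈ V4)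
    (hz : z ∈ V2) (h : z ∈ ({x, u, v, w} : Finset α)) : z = u := by
  simp only [Finset.mem_insert, Finset.mem_singleton] at h
  rcases h with rfl | h | rfl | rfl
  · exact absurd hz (Finset.disjoint_left.1 hd.d12 hx)
  · exact h
  · exact absurd hv (Finset.disjoint_left.1 hd.d23 hz)
  · exact absurd hw (Finset.disjoint_left.1 hd.d24 hz)

lemma srs_mem3 {α : Type} [DecidableEq α] {V1 V2 V3 V4 : Finset α} (hd : SrsDisj V1 V2 V3 V4)
    {x u v w z : α} (hx : x ∈ V1) (hu : u ∈ V2) (hw : w ∈ V4)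
    (hz : z ∈ V3) (h : z ∈ ({x, u, v, w} : Finset α)) : z = v := by
  simp only [Finset.mem_insert, Finset.mem_singleton] at h
  rcases h with rfl | rfl | h | rfl
  · exact absurd hz (Finset.disjoint_left.1 hd.d13 hx)
  · exact absurd hz (Finset.disjoint_left.1 hd.d23 hu)
  · exact h
  · exact absurd hw (Finset.disjoint_left.1 hd.d34 hz)

lemma srs_mem4 {α : Type} [DecidableEq α] {V1 V2 V3 V4 : Finset α} (hd : SrsDisj V1 V2 V3 V4)
    {x u v w z : α} (hx : x ∈ V1) (hu : u ∈ V2) (hv : v ∈ V3)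
    (hz : z ∈ V4) (h : z ∈ ({x, u, v, w} : Finset α)) : z = w := by
  simp only [Finset.mem_insert, Finset.mem_singleton] at h
  rcases h with rfl | rfl | rfl | h
  · exact absurd hz (Finset.disjoint_left.1 hd.d14 hx)
  · exact absurd hz (Finset.disjoint_left.1 hd.d24 hu)
  · exact absurd hz (Finset.disjoint_left.1 hd.d34 hv)
  · exact h

lemma srs_tuple_sum {α : Type} [DecidableEq α] {V1 V2 V3 V4 : Finset α}
    (hd : SrsDisj V1 V2 V3 V4) {E : Finset (Finset α)} (hE : IsPartite4 V1 V2 V3 V4 E)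
    (φ : Finset α → ℝ) :
    ∑ e ∈ E, φ e = ∑ x ∈ V1, ∑ u ∈ V2, ∑ v ∈ V3, ∑ w ∈ V4,
      if ({x, u, v, w} : Finset α) ∈ E then φ {x, u, v, w} else 0 := by
  set T : α × α × α × α → Finset α := fun p => {p.1, p.2.1, p.2.2.1, p.2.2.2} with hT
  set P := (V1 ×ˢ V2 ×ˢ V3 ×ˢ V4).filter (fun p => T p ∈ E) with hP
  have himg : E = P.image T := by
    ext e
    simp only [Finset.mem_image, hP, Finset.mem_filter, Finset.mem_product]
    constructor
    · intro he
      obtain ⟨a0, a1, a2, a3, a4⟩ := hE e he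
      obtain ⟨x, hx, u, hu, v, hv, w, hw, rfl⟩ := srs_decomp a0 a1 a2 a3 a4
      exact ⟨(x, u, v, w), ⟨⟨hx, hu, hv, hw⟩, he⟩, rfl⟩
    · rintro ⟨p, ⟨_, hp⟩, rfl⟩
      exact hp
  have hinj : Set.InjOn T P := by
    rintro ⟨x, u, v, w⟩ hp ⟨x', u', v', w'⟩ hq hpq
    simp only [hP, Finset.coe_filter, Finset.mem_product, Set.mem_setOf_eq] at hp hq
    obtain ⟨⟨hx, hu, hv, hw⟩, _⟩ := hp
    obtain ⟨⟨hx', hu', hv', hw'⟩, _⟩ := hq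
    simp only [hT] at hpq
    have e1 := srs_mem1 hd hu' hv' hw' hx (hpq ▸ (by simp : x ∈ ({x, u, v, w} : Finset α)))
    have e2 := srs_mem2 hd hx' hv' hw' hu (hpq ▸ (by simp : u ∈ ({x, u, v, w} : Finset α)))
    have e3 := srs_mem3 hd hx' hu' hw' hv (hpq ▸ (by simp : v ∈ ({x, u, v, w} : Finset α)))
    have e4 := srs_mem4 hd hx' hu' hv' hw (hpq ▸ (by simp : w ∈ ({x, u, v, w} : Finset α)))
    rw [e1, e2, e3, e4]
  have hsum : ∑ e ∈ E, φ e = ∑ p ∈ P, φ (T p) := by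
    conv_lhs => rw [himg]
    exact Finset.sum_image hinj
  rw [hsum, hP, Finset.sum_filter, Finset.sum_product]
  apply Finset.sum_congr rfl
  intro x _
  rw [Finset.sum_product]
  apply Finset.sum_congr rfl
  intro u _
  rw [Finset.sum_product]

lemma srs_deg12 {α : Type} [DecidableEq α] {V1 V2 V3 V4 : Finset α}
    (hd : SrsDisj V1 V2 V3 V4) {E : Finset (Finset α)} (hE : IsPartite4 V1 V2 V3 V4 E)
    {x y : α} (hx : x ∈ V1) (hy : y ∈ V2) :
    (hdeg2 E x y : ℝ) ≤ ∑ v ∈ V3, ∑ w ∈ V4, if ({x, y, v, w} : Finset α) ∈ E then (1 : ℝ) else 0 := by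
  rw [← Finset.sum_product', Finset.sum_boole]
  norm_cast
  refine le_trans (Finset.card_le_card ?_) (Finset.card_image_le (f := fun p : α × α => ({x, y, p.1, p.2} : Finset α)))
  intro e he
  simp only [Finset.mem_filter] at he
  obtain ⟨he, hxe, hye⟩ := he
  obtain ⟨a0, a1, a2, a3, a4⟩ := hE e he
  obtain ⟨x', hx', u, hu, v, hv, w, hw, rfl⟩ := srs_decomp a0 a1 a2 a3 a4
  obtain rfl := srs_mem1 hd hu hv hw hx hxe
  obtain rfl := srs_mem2 hd hx' hv hw hy hye
  exact Finset.mem_image.2 ⟨(v, w), by simp [hv, hw, he], rfl⟩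

lemma srs_deg13 {α : Type} [DecidableEq α] {V1 V2 V3 V4 : Finset α}
    (hd : SrsDisj V1 V2 V3 V4) {E : Finset (Finset α)} (hE : IsPartite4 V1 V2 V3 V4 E)
    {x y : α} (hx : x ∈ V1) (hy : y ∈ V3) :
    (hdeg2 E x y : ℝ) ≤ ∑ v ∈ V2, ∑ w ∈ V4, if ({x, v, y, w} : Finset α) ∈ E then (1 : ℝ) else 0 := by
  rw [← Finset.sum_product', Finset.sum_boole]
  norm_cast
  refine le_trans (Finset.card_le_card ?_) (Finset.card_image_le (f := fun p : α × α => ({x, p.1, y, p.2} : Finset α)))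
  intro e he
  simp only [Finset.mem_filter] at he
  obtain ⟨he, hxe, hye⟩ := he
  obtain ⟨a0, a1, a2, a3, a4⟩ := hE e he
  obtain ⟨x', hx', u, hu, v, hv, w, hw, rfl⟩ := srs_decomp a0 a1 a2 a3 a4
  obtain rfl := srs_mem1 hd hu hv hw hx hxe
  obtain rfl := srs_mem3 hd hx' hu hw hy hye
  exact Finset.mem_image.2 ⟨(u, w), by simp [hu, hw, he], rfl⟩

lemma srs_deg14 {α : Type} [DecidableEq α] {V1 V2 V3 V4 : Finset α}
    (hd : SrsDisj V1 V2 V3 V4) {E : Finset (Finset α)} (hE : IsPartite4 V1 V2 V3 V4 E)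
    {x y : α} (hx : x ∈ V1) (hy : y ∈ V4) :
    (hdeg2 E x y : ℝ) ≤ ∑ v ∈ V2, ∑ w ∈ V3, if ({x, v, w, y} : Finset α) ∈ E then (1 : ℝ) else 0 := by
  rw [← Finset.sum_product', Finset.sum_boole]
  norm_cast
  refine le_trans (Finset.card_le_card ?_) (Finset.card_image_le (f := fun p : α × α => ({x, p.1, p.2, y} : Finset α)))
  intro e he
  simp only [Finset.mem_filter] at he
  obtain ⟨he, hxe, hye⟩ := he
  obtain ⟨a0, a1, a2, a3, a4⟩ := hE e he
  obtain ⟨x', hx', u, hu, v, hv, w, hw, rfl⟩ := srs_decomp a0 a1 a2 a3 a4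
  obtain rfl := srs_mem1 hd hu hv hw hx hxe
  obtain rfl := srs_mem4 hd hx' hu hv hy hye
  exact Finset.mem_image.2 ⟨(u, v), by simp [hu, hv, he], rfl⟩

lemma srs_miss {α : Type} (V2 V3 V4 : Finset α) (n2 : V2.Nonempty) (n3 : V3.Nonempty)
    (n4 : V4.Nonempty) (i2 i3 i4 : α → ℝ) (g : α → α → α → ℝ) (γ δ : ℝ)
    (h20 : ∀ u, 0 ≤ i2 u) (h21 : ∀ u, i2 u ≤ 1)
    (hg : ∀ u ∈ V2, 5/9 - γ ≤ 𝔼 v ∈ V3, 𝔼 w ∈ V4, g u v w)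
    (hδ : 0 ≤ δ) (hq : 4/9 + γ - (𝔼 v ∈ V3, i3 v) * (𝔼 w ∈ V4, i4 w) ≤ δ) :
    𝔼 u ∈ V2, 𝔼 v ∈ V3, 𝔼 w ∈ V4, i2 u * (1 - i3 v * i4 w) * (1 - g u v w) ≤
      δ + 𝔼 u ∈ V2, 𝔼 v ∈ V3, 𝔼 w ∈ V4, i2 u * i3 v * i4 w * g u v w := by
  have : 𝔼 u ∈ V2, 𝔼 v ∈ V3, 𝔼 w ∈ V4, i2 u * (1 - i3 v * i4 w) * (1 - g u v w) ≤
      𝔼 u ∈ V2, (δ + 𝔼 v ∈ V3, 𝔼 w ∈ V4, i2 u * i3 v * i4 w * g u v w) := by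
    apply Finset.expect_le_expect
    intro u hu
    have e : 𝔼 v ∈ V3, 𝔼 w ∈ V4, i2 u * (1 - i3 v * i4 w) * (1 - g u v w) =
        i2 u * (1 - (𝔼 v ∈ V3, 𝔼 w ∈ V4, g u v w) - (𝔼 v ∈ V3, i3 v) * (𝔼 w ∈ V4, i4 w)) +
        𝔼 v ∈ V3, 𝔼 w ∈ V4, i2 u * i3 v * i4 w * g u v w := by
      rw [Finset.expect_mul_expect]
      have c1 : (1 : ℝ) = 𝔼 v ∈ V3, 𝔼 w ∈ V4, (1 : ℝ) := by
        simp [Finset.expect_const n3, Finset.expect_const n4]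
      conv_rhs => rw [c1]
      simp only [← Finset.expect_sub_distrib, Finset.mul_expect, ← Finset.expect_add_distrib]
      apply Finset.expect_congr rfl
      intro v _
      apply Finset.expect_congr rfl
      intro w _
      ring
    rw [e]
    have h1 := hg u hu
    have h2 : i2 u * (1 - (𝔼 v ∈ V3, 𝔼 w ∈ V4, g u v w) - (𝔼 v ∈ V3, i3 v) * (𝔼 w ∈ V4, i4 w))
        ≤ i2 u * δ := mul_le_mul_of_nonneg_left (by linarith) (h20 u)
    have h3 : i2 u * δ ≤ 1 * δ := mul_le_mul_of_nonneg_right (h21 u) hδ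
    linarith
  rwa [Finset.expect_add_distrib, Finset.expect_const n2] at this

lemma srs_expect_ind {α : Type} [DecidableEq α] (V U : Finset α) (h : U ⊆ V) :
    𝔼 x ∈ V, (if x ∈ U then (1 : ℝ) else 0) = (U.card : ℝ) / V.card := by
  rw [Finset.expect_eq_sum_div_card, Finset.sum_boole, Finset.filter_mem_eq_inter,
    Finset.inter_eq_right.2 h]

lemma srs_resize {α : Type} [DecidableEq α] (V U' : Finset α) (n m : ℕ) (σ : ℝ) (hV : V.card = n)
    (hn : 0 < n) (hU' : U' ⊆ V) (hm : m ≤ n) (hm2 : (m : ℝ) ≤ 2 / 3 * n + 1) (hσ : 0 ≤ σ)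
    (h : 2/3 - σ ≤ 𝔼 x ∈ V, (if x ∈ U' then (1 : ℝ) else 0)) :
    ∃ U ⊆ V, U.card = m ∧ 𝔼 x ∈ V, (if x ∈ U \ U' then (1 : ℝ) else 0) ≤ σ + 1 / n := by
  rw [srs_expect_ind V U' hU', hV] at h
  have hn' : (0 : ℝ) < n := by exact_mod_cast hn
  rcases le_total m U'.card with hc | hc
  · obtain ⟨U, hU, hUc⟩ := Finset.exists_subset_card_eq hc
    refine ⟨U, hU.trans hU', hUc, ?_⟩
    rw [Finset.sdiff_eq_empty_iff_subset.2 hU]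
    simp
    positivity
  · obtain ⟨U, h1, h2, h3⟩ := Finset.exists_subsuperset_card_eq hU' hc (hV ▸ hm)
    refine ⟨U, h2, h3, ?_⟩
    rw [srs_expect_ind V _ (Finset.sdiff_subset.trans h2), hV, Finset.card_sdiff_of_subset h1, h3,
      Nat.cast_sub hc]
    rw [le_div_iff₀ hn'] at h
    rw [div_le_iff₀ hn', add_mul, one_div, inv_mul_cancel₀ hn'.ne']
    linarith


lemma srs_E4 {α : Type} (V1 V2 V3 V4 : Finset α) (n : ℕ) (h1 : V1.card = n) (h2 : V2.card = n)
    (h3 : V3.card = n) (h4 : V4.card = n) (f : α → α → α → α → ℝ) :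
    𝔼 x ∈ V1, 𝔼 u ∈ V2, 𝔼 v ∈ V3, 𝔼 w ∈ V4, f x u v w =
      (∑ x ∈ V1, ∑ u ∈ V2, ∑ v ∈ V3, ∑ w ∈ V4, f x u v w) / (n : ℝ) ^ 4 := by
  simp only [Finset.expect_eq_sum_div_card, h1, h2, h3, h4, ← Finset.sum_div]
  rw [div_div, div_div, div_div]
  congr 1
  ring

lemma srs_miss_total {α : Type} (V1 V2 V3 V4 : Finset α) (n1 : V1.Nonempty) (n2 : V2.Nonempty)
    (n3 : V3.Nonempty) (n4 : V4.Nonempty) (i2 i3 i4 : α → ℝ) (h : α → α → α → α → ℝ) (γ δ : ℝ)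
    (h20 : ∀ u, 0 ≤ i2 u) (h21 : ∀ u, i2 u ≤ 1) (h30 : ∀ u, 0 ≤ i3 u) (h31 : ∀ u, i3 u ≤ 1)
    (h40 : ∀ u, 0 ≤ i4 u) (h41 : ∀ u, i4 u ≤ 1)
    (g2 : ∀ x ∈ V1, ∀ u ∈ V2, 5/9 - γ ≤ 𝔼 v ∈ V3, 𝔼 w ∈ V4, h x u v w)
    (g3 : ∀ x ∈ V1, ∀ v ∈ V3, 5/9 - γ ≤ 𝔼 u ∈ V2, 𝔼 w ∈ V4, h x u v w)
    (g4 : ∀ x ∈ V1, ∀ w ∈ V4, 5/9 - γ ≤ 𝔼 u ∈ V2, 𝔼 v ∈ V3, h x u v w)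
    (hδ : 0 ≤ δ) (hq2 : 4/9 + γ - (𝔼 v ∈ V3, i3 v) * (𝔼 w ∈ V4, i4 w) ≤ δ)
    (hq3 : 4/9 + γ - (𝔼 v ∈ V2, i2 v) * (𝔼 w ∈ V4, i4 w) ≤ δ)
    (hq4 : 4/9 + γ - (𝔼 v ∈ V2, i2 v) * (𝔼 w ∈ V3, i3 w) ≤ δ) :
    𝔼 x ∈ V1, 𝔼 u ∈ V2, 𝔼 v ∈ V3, 𝔼 w ∈ V4, (i2 u * (1 - i3 v * i4 w) * (1 - h x u v w) +
      i3 v * (1 - i2 u * i4 w) * (1 - h x u v w) + i4 w * (1 - i2 u * i3 v) * (1 - h x u v w)) ≤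
      3 * (δ + 𝔼 x ∈ V1, 𝔼 u ∈ V2, 𝔼 v ∈ V3, 𝔼 w ∈ V4, i2 u * i3 v * i4 w * h x u v w) := by
  have key : ∀ x ∈ V1, 𝔼 u ∈ V2, 𝔼 v ∈ V3, 𝔼 w ∈ V4, (i2 u * (1 - i3 v * i4 w) * (1 - h x u v w) +
      i3 v * (1 - i2 u * i4 w) * (1 - h x u v w) + i4 w * (1 - i2 u * i3 v) * (1 - h x u v w)) ≤
      3 * (δ + 𝔼 u ∈ V2, 𝔼 v ∈ V3, 𝔼 w ∈ V4, i2 u * i3 v * i4 w * h x u v w) := by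
    intro x hx
    have a2 := srs_miss V2 V3 V4 n2 n3 n4 i2 i3 i4 (fun u v w => h x u v w) γ δ h20 h21 (g2 x hx) hδ hq2
    have a3 := srs_miss V3 V2 V4 n3 n2 n4 i3 i2 i4 (fun v u w => h x u v w) γ δ h30 h31 (g3 x hx) hδ hq3
    have a4 := srs_miss V4 V2 V3 n4 n2 n3 i4 i2 i3 (fun w u v => h x u v w) γ δ h40 h41 (g4 x hx) hδ hq4
    rw [Finset.expect_comm, Finset.expect_comm V3 V2] at a3
    rw [Finset.expect_comm, Finset.expect_comm V4 V2] at a4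
    have c : ∀ F : α → α → α → ℝ, 𝔼 u ∈ V2, 𝔼 w ∈ V4, 𝔼 v ∈ V3, F w u v =
        𝔼 u ∈ V2, 𝔼 v ∈ V3, 𝔼 w ∈ V4, F w u v := fun F =>
      Finset.expect_congr rfl (fun u _ => Finset.expect_comm _ _ _)
    rw [c (fun w u v => i4 w * (1 - i2 u * i3 v) * (1 - h x u v w)),
      c (fun w u v => i4 w * i2 u * i3 v * h x u v w)] at a4
    simp only [Finset.expect_add_distrib]
    have e3 : 𝔼 u ∈ V2, 𝔼 v ∈ V3, 𝔼 w ∈ V4, i3 v * i2 u * i4 w * h x u v w =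
        𝔼 u ∈ V2, 𝔼 v ∈ V3, 𝔼 w ∈ V4, i2 u * i3 v * i4 w * h x u v w :=
      Finset.expect_congr rfl fun u _ => Finset.expect_congr rfl fun v _ =>
        Finset.expect_congr rfl fun w _ => by ring
    have e4 : 𝔼 u ∈ V2, 𝔼 v ∈ V3, 𝔼 w ∈ V4, i4 w * i2 u * i3 v * h x u v w =
        𝔼 u ∈ V2, 𝔼 v ∈ V3, 𝔼 w ∈ V4, i2 u * i3 v * i4 w * h x u v w :=
      Finset.expect_congr rfl fun u _ => Finset.expect_congr rfl fun v _ =>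
        Finset.expect_congr rfl fun w _ => by ring
    rw [e3] at a3
    rw [e4] at a4
    linarith
  calc _ ≤ 𝔼 x ∈ V1, 3 * (δ + 𝔼 u ∈ V2, 𝔼 v ∈ V3, 𝔼 w ∈ V4, i2 u * i3 v * i4 w * h x u v w) :=
        Finset.expect_le_expect key
    _ = _ := by
      rw [← Finset.mul_expect, Finset.expect_add_distrib, Finset.expect_const n1]

lemma srs_kappa {α : Type} [DecidableEq α] (V1 V2 V3 V4 : Finset α) (n1 : V1.Nonempty)
    (n2 : V2.Nonempty) (n3 : V3.Nonempty) (n4 : V4.Nonempty) (h : α → α → α → α → ℝ)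
    (h0 : ∀ x u v w, 0 ≤ h x u v w) (h1 : ∀ x u v w, h x u v w ≤ 1)
    (U1' U2 U2' U3 U3' U4 U4' : Finset α) :
    𝔼 x ∈ V1, 𝔼 u ∈ V2, 𝔼 v ∈ V3, 𝔼 w ∈ V4, (if u ∈ U2 then (1 : ℝ) else 0) *
      (if v ∈ U3 then (1 : ℝ) else 0) * (if w ∈ U4 then (1 : ℝ) else 0) * h x u v w ≤
    (𝔼 x ∈ V1, 𝔼 u ∈ V2, 𝔼 v ∈ V3, 𝔼 w ∈ V4,
      if x ∈ U1' ∧ u ∈ U2' ∧ v ∈ U3' ∧ w ∈ U4' then h x u v w else 0) +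
    (1 - 𝔼 x ∈ V1, if x ∈ U1' then (1 : ℝ) else 0) +
    (𝔼 u ∈ V2, if u ∈ U2 \ U2' then (1 : ℝ) else 0) +
    (𝔼 v ∈ V3, if v ∈ U3 \ U3' then (1 : ℝ) else 0) +
    (𝔼 w ∈ V4, if w ∈ U4 \ U4' then (1 : ℝ) else 0) := by
  have b1 : (1 - 𝔼 x ∈ V1, if x ∈ U1' then (1 : ℝ) else 0) =
      𝔼 x ∈ V1, 𝔼 u ∈ V2, 𝔼 v ∈ V3, 𝔼 w ∈ V4, (1 - if x ∈ U1' then (1 : ℝ) else 0) := by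
    simp only [Finset.expect_const n2, Finset.expect_const n3, Finset.expect_const n4]
    rw [Finset.expect_sub_distrib, Finset.expect_const n1]
  have b2 : (𝔼 u ∈ V2, if u ∈ U2 \ U2' then (1 : ℝ) else 0) =
      𝔼 x ∈ V1, 𝔼 u ∈ V2, 𝔼 v ∈ V3, 𝔼 w ∈ V4, if u ∈ U2 \ U2' then (1 : ℝ) else 0 := by
    simp only [Finset.expect_const n1, Finset.expect_const n3, Finset.expect_const n4]
  have b3 : (𝔼 u ∈ V3, if u ∈ U3 \ U3' then (1 : ℝ) else 0) =
      𝔼 x ∈ V1, 𝔼 u ∈ V2, 𝔼 v ∈ V3, 𝔼 w ∈ V4, if v ∈ U3 \ U3' then (1 : ℝ) else 0 := by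
    simp only [Finset.expect_const n1, Finset.expect_const n2, Finset.expect_const n4]
  have b4 : (𝔼 u ∈ V4, if u ∈ U4 \ U4' then (1 : ℝ) else 0) =
      𝔼 x ∈ V1, 𝔼 u ∈ V2, 𝔼 v ∈ V3, 𝔼 w ∈ V4, if w ∈ U4 \ U4' then (1 : ℝ) else 0 := by
    simp only [Finset.expect_const n1, Finset.expect_const n2, Finset.expect_const n3]
  rw [b1, b2, b3, b4]
  simp only [← Finset.expect_add_distrib]
  refine Finset.expect_le_expect fun x _ => Finset.expect_le_expect fun u _ =>
    Finset.expect_le_expect fun v _ => Finset.expect_le_expect fun w _ => ?_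
  have p0 := h0 x u v w
  have p1 := h1 x u v w
  simp only [Finset.mem_sdiff]
  by_cases c1 : x ∈ U1' <;> by_cases c2 : u ∈ U2' <;> by_cases c3 : v ∈ U3' <;>
    by_cases c4 : w ∈ U4' <;> by_cases d2 : u ∈ U2 <;> by_cases d3 : v ∈ U3 <;>
    by_cases d4 : w ∈ U4 <;> simp only [c1, c2, c3, c4, d2, d3, d4, if_true, if_false, true_and,
      and_true, and_false, false_and, not_true, not_false_eq_true, and_self] <;> linarith

lemma srs_close {α : Type} [DecidableEq α] {V1 V2 V3 V4 : Finset α} (hd : SrsDisj V1 V2 V3 V4)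
    (n : ℕ) (hn : 0 < n) (k1 : V1.card = n) (k2 : V2.card = n) (k3 : V3.card = n) (k4 : V4.card = n)
    (E : Finset (Finset α)) (h : α → α → α → α → ℝ)
    (hh : h = fun x u v w => if ({x, u, v, w} : Finset α) ∈ E then (1 : ℝ) else 0)
    (γ σ ε : ℝ) (hγ : 0 < γ) (hσ : 0 < σ) (hε : 3 * γ + 15 * σ + 12 / n ≤ ε)
    (g2 : ∀ x ∈ V1, ∀ u ∈ V2, 5/9 - γ ≤ 𝔼 v ∈ V3, 𝔼 w ∈ V4, h x u v w)
    (g3 : ∀ x ∈ V1, ∀ v ∈ V3, 5/9 - γ ≤ 𝔼 u ∈ V2, 𝔼 w ∈ V4, h x u v w)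
    (g4 : ∀ x ∈ V1, ∀ w ∈ V4, 5/9 - γ ≤ 𝔼 u ∈ V2, 𝔼 v ∈ V3, h x u v w)
    (U1' U2' U3' U4' : Finset α) (s2 : U2' ⊆ V2) (s3 : U3' ⊆ V3) (s4 : U4' ⊆ V4)
    (m1 : 1 - σ ≤ 𝔼 x ∈ V1, if x ∈ U1' then (1 : ℝ) else 0)
    (m2 : 2/3 - σ ≤ 𝔼 x ∈ V2, if x ∈ U2' then (1 : ℝ) else 0)
    (m3 : 2/3 - σ ≤ 𝔼 x ∈ V3, if x ∈ U3' then (1 : ℝ) else 0)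
    (m4 : 2/3 - σ ≤ 𝔼 x ∈ V4, if x ∈ U4' then (1 : ℝ) else 0)
    (hU : 𝔼 x ∈ V1, 𝔼 u ∈ V2, 𝔼 v ∈ V3, 𝔼 w ∈ V4,
      (if x ∈ U1' ∧ u ∈ U2' ∧ v ∈ U3' ∧ w ∈ U4' then h x u v w else 0) ≤ σ) :
    CloseToH13 ε n V1 V2 V3 V4 E := by
  have hn' : (0 : ℝ) < n := by exact_mod_cast hn
  have n1 : V1.Nonempty := Finset.card_pos.1 (by omega)
  have n2 : V2.Nonempty := Finset.card_pos.1 (by omega)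
  have n3 : V3.Nonempty := Finset.card_pos.1 (by omega)
  have n4 : V4.Nonempty := Finset.card_pos.1 (by omega)
  have size : ∀ t : ℕ, t ≤ n → n ≤ 3 * t + 2 → 3 * t ≤ n + 2 →
      ((n - t : ℕ) : ℝ) ≤ 2 / 3 * n + 1 ∧ 2 / 3 * (n : ℝ) - 2 / 3 ≤ ((n - t : ℕ) : ℝ) := by
    intro t ht a b
    rw [Nat.cast_sub ht]
    have a' : (n : ℝ) ≤ 3 * t + 2 := by exact_mod_cast a
    have b' : 3 * (t : ℝ) ≤ n + 2 := by exact_mod_cast b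
    constructor <;> linarith
  obtain ⟨U2, v2, c2, r2⟩ := srs_resize V2 U2' n (n - n / 3) σ k2 hn s2 (by omega)
    (size _ (by omega) (by omega) (by omega)).1 hσ.le m2
  obtain ⟨U3, v3, c3, r3⟩ := srs_resize V3 U3' n (n - (n + 1) / 3) σ k3 hn s3 (by omega)
    (size _ (by omega) (by omega) (by omega)).1 hσ.le m3
  obtain ⟨U4, v4, c4, r4⟩ := srs_resize V4 U4' n (n - (n + 2) / 3) σ k4 hn s4 (by omega)
    (size _ (by omega) (by omega) (by omega)).1 hσ.le m4
  have q2 : 2 / 3 - 2 / 3 / n ≤ 𝔼 x ∈ V2, if x ∈ U2 then (1 : ℝ) else 0 := by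
    rw [srs_expect_ind V2 U2 v2, c2, k2, le_div_iff₀ hn', sub_mul, div_mul_cancel₀ _ hn'.ne']
    exact (size _ (by omega) (by omega) (by omega)).2
  have q3 : 2 / 3 - 2 / 3 / n ≤ 𝔼 x ∈ V3, if x ∈ U3 then (1 : ℝ) else 0 := by
    rw [srs_expect_ind V3 U3 v3, c3, k3, le_div_iff₀ hn', sub_mul, div_mul_cancel₀ _ hn'.ne']
    exact (size _ (by omega) (by omega) (by omega)).2
  have q4 : 2 / 3 - 2 / 3 / n ≤ 𝔼 x ∈ V4, if x ∈ U4 then (1 : ℝ) else 0 := by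
    rw [srs_expect_ind V4 U4 v4, c4, k4, le_div_iff₀ hn', sub_mul, div_mul_cancel₀ _ hn'.ne']
    exact (size _ (by omega) (by omega) (by omega)).2
  have hinv : 0 ≤ 2 / 3 - 2 / 3 / (n : ℝ) := by
    have : 2 / 3 / (n : ℝ) ≤ 2 / 3 := div_le_self (by norm_num) (by exact_mod_cast hn)
    linarith
  have qq : ∀ a b : ℝ, 2 / 3 - 2 / 3 / (n : ℝ) ≤ a → 2 / 3 - 2 / 3 / (n : ℝ) ≤ b →
      4 / 9 + γ - a * b ≤ γ + 1 / n := by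
    intro a b ha hb
    have := mul_le_mul ha hb hinv (hinv.trans ha)
    have h3 : 2 / 3 / (n : ℝ) = 2 / 3 * (1 / n) := by ring
    have h4 : 0 ≤ 1 / (n : ℝ) := by positivity
    rw [h3] at this
    nlinarith
  have hd0 : 0 ≤ 1 / (n : ℝ) := by positivity
  have h0 : ∀ x u v w, 0 ≤ h x u v w := by
    intro x u v w; rw [hh]; dsimp only; split_ifs <;> norm_num
  have h1 : ∀ x u v w, h x u v w ≤ 1 := by
    intro x u v w; rw [hh]; dsimp only; split_ifs <;> norm_num
  have i0 : ∀ (U : Finset α) (u : α), (0 : ℝ) ≤ if u ∈ U then 1 else 0 := by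
    intro U u; split_ifs <;> norm_num
  have i1 : ∀ (U : Finset α) (u : α), (if u ∈ U then (1 : ℝ) else 0) ≤ 1 := by
    intro U u; split_ifs <;> norm_num
  have T := srs_miss_total V1 V2 V3 V4 n1 n2 n3 n4 (fun u => if u ∈ U2 then (1 : ℝ) else 0)
    (fun u => if u ∈ U3 then (1 : ℝ) else 0) (fun u => if u ∈ U4 then (1 : ℝ) else 0) h γ (γ + 1 / n)
    (i0 _) (i1 _) (i0 _) (i1 _) (i0 _) (i1 _) g2 g3 g4 (by linarith) (qq _ _ q3 q4) (qq _ _ q2 q4)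
    (qq _ _ q2 q3)
  have K := srs_kappa V1 V2 V3 V4 n1 n2 n3 n4 h h0 h1 U1' U2 U2' U3 U3' U4 U4'
  have T2 := T.trans (mul_le_mul_of_nonneg_left (add_le_add_right (K.trans (c := 5 * σ + 3 * (1 / n))
    (by linarith)) _) (by norm_num : (0 : ℝ) ≤ 3))
  have T3 : 3 * (γ + 1 / n + (5 * σ + 3 * (1 / (n : ℝ)))) ≤ ε := by
    have : 12 / (n : ℝ) = 12 * (1 / n) := by ring
    linarith
  have T4 := T2.trans T3
  rw [srs_E4 V1 V2 V3 V4 n k1 k2 k3 k4, div_le_iff₀ (by positivity)] at T4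
  refine ⟨V2 \ U2, V3 \ U3, V4 \ U4, ⟨Finset.sdiff_subset, Finset.sdiff_subset, Finset.sdiff_subset,
    ?_, ?_, ?_, ?_⟩, le_trans ?_ T4⟩
  · rw [Finset.card_sdiff_of_subset v2]; omega
  · rw [Finset.card_sdiff_of_subset v3]; omega
  · rw [Finset.card_sdiff_of_subset v4]; omega
  · rw [Finset.card_sdiff_of_subset v2, Finset.card_sdiff_of_subset v3,
      Finset.card_sdiff_of_subset v4]; omega
  set G := H13edges V1 V2 V3 V4 (V2 \ U2) (V3 \ U3) (V4 \ U4) \ E with hG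
  have hGp : IsPartite4 V1 V2 V3 V4 G := by
    intro e he
    simp only [hG, H13edges, Finset.mem_sdiff, Finset.mem_filter, Finset.mem_powerset] at he
    obtain ⟨⟨a, b1, b2, b3, b4, _⟩, _⟩ := he
    exact ⟨a, b1, b2, b3, b4⟩
  have hc : (G.card : ℝ) = ∑ e ∈ G, (1 : ℝ) := by simp
  rw [hc, srs_tuple_sum hd hGp]
  refine Finset.sum_le_sum fun x hx => Finset.sum_le_sum fun u hu => Finset.sum_le_sum fun v hv =>
    Finset.sum_le_sum fun w hw => ?_
  have nn : ∀ a b c : ℝ, 0 ≤ a → b ≤ 1 → 0 ≤ b → c ≤ 1 → 0 ≤ c →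
      0 ≤ a * (1 - b * c) * (1 - h x u v w) := by
    intro a b c ha hb hb0 hc hc0
    exact mul_nonneg (mul_nonneg ha (by nlinarith)) (by linarith [h1 x u v w])
  have z2 := nn _ _ _ (i0 U2 u) (i1 U3 v) (i0 U3 v) (i1 U4 w) (i0 U4 w)
  have z3 := nn _ _ _ (i0 U3 v) (i1 U2 u) (i0 U2 u) (i1 U4 w) (i0 U4 w)
  have z4 := nn _ _ _ (i0 U4 w) (i1 U2 u) (i0 U2 u) (i1 U3 v) (i0 U3 v)
  by_cases hm : ({x, u, v, w} : Finset α) ∈ G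
  swap
  · rw [if_neg hm]; linarith
  rw [if_pos hm]
  simp only [hG, H13edges, Finset.mem_sdiff, Finset.mem_filter, Finset.mem_powerset] at hm
  obtain ⟨⟨_, _, _, _, _, ⟨p, hp⟩, ⟨q, hq⟩⟩, hne⟩ := hm
  have hz : h x u v w = 0 := by rw [hh]; simp only [hne, if_false]
  rw [hz] at z2 z3 z4 ⊢
  simp only [Finset.mem_inter, Finset.mem_union, Finset.mem_sdiff, not_and, not_not] at hp hq
  obtain ⟨hp, hp'⟩ := hp
  obtain ⟨hq, hq'⟩ := hq
  have P : u ∉ U2 ∨ v ∉ U3 ∨ w ∉ U4 := by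
    rcases hp' with (⟨a, b⟩ | ⟨a, b⟩) | ⟨a, b⟩
    · rw [srs_mem2 hd hx hv hw a hp] at b; exact Or.inl b
    · rw [srs_mem3 hd hx hu hw a hp] at b; exact Or.inr (Or.inl b)
    · rw [srs_mem4 hd hx hu hv a hp] at b; exact Or.inr (Or.inr b)
  have Q : u ∈ U2 ∨ v ∈ U3 ∨ w ∈ U4 := by
    rcases hq' with (⟨a, b⟩ | ⟨a, b⟩) | ⟨a, b⟩
    · rw [srs_mem2 hd hx hv hw a hq] at b a; exact Or.inl (b a)
    · rw [srs_mem3 hd hx hu hw a hq] at b a; exact Or.inr (Or.inl (b a))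
    · rw [srs_mem4 hd hx hu hv a hq] at b a; exact Or.inr (Or.inr (b a))
  by_cases d2 : u ∈ U2 <;> by_cases d3 : v ∈ U3 <;> by_cases d4 : w ∈ U4 <;>
    simp [d2, d3, d4] at P Q ⊢


lemma srs_dualize {α : Type} [DecidableEq α] (V : Finset α) (E : Finset (Finset α)) (M : ℝ)
    (hM : 0 ≤ M) (hE : ∀ e ∈ E, e ⊆ V)
    (H : ∀ y : α → ℝ, ∑ v ∈ V, y v ≤ M * ∑ e ∈ E, max (∑ v ∈ e, y v) 0) :
    ∃ w : Finset α → ℝ, (∀ e, 0 ≤ w e) ∧ (∀ e, w e ≤ M) ∧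
      ∀ v ∈ V, ∑ e ∈ E.filter (fun e => v ∈ e), w e = 1 := by
  classical
  let A : (↥E → ℝ) →ₗ[ℝ] (↥V → ℝ) := 
    { toFun := fun w v => ∑ e : ↥E, if v.1 ∈ e.1 then w e else 0
      map_add' := by
        intro a b; ext v
        simp only [Pi.add_apply, ← Finset.sum_add_distrib]
        exact Finset.sum_congr rfl fun e _ => by split_ifs <;> simp
      map_smul' := by
        intro c a; ext v
        simp only [Pi.smul_apply, smul_eq_mul, RingHom.id_apply, Finset.mul_sum]
        exact Finset.sum_congr rfl fun e _ => by split_ifs <;> simp }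
  have hAc : Continuous A := A.continuous_of_finiteDimensional
  let B : Set (↥E → ℝ) := Set.Icc 0 (fun _ => M)
  have hBc : IsCompact B := isCompact_Icc
  have hBx : Convex ℝ B := convex_Icc _ _
  have hKc : IsClosed (A '' B) := (hBc.image hAc).isClosed
  have hKx : Convex ℝ (A '' B) := hBx.linear_image A
  have hmem : (fun _ => 1 : ↥V → ℝ) ∈ A '' B := by
    by_contra hcon
    obtain ⟨f, s, hs, hf⟩ := geometric_hahn_banach_closed_point hKx hKc hcon
    let y : α → ℝ := fun a => if h : a ∈ V then f (Pi.single (⟨a, h⟩ : ↥V) 1) else 0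
    have hy : ∀ z : ↥V → ℝ, f z = ∑ v : ↥V, z v * y v.1 := by
      intro z
      conv_lhs => rw [← Finset.univ_sum_single z]
      rw [map_sum]
      refine Finset.sum_congr rfl fun v _ => ?_
      have : (Pi.single v (z v) : ↥V → ℝ) = z v • Pi.single v (1 : ℝ) := by
        rw [← Pi.single_smul]; simp
      rw [this, map_smul, smul_eq_mul]
      simp [y]
    have h1 : f (fun _ => 1) = ∑ v ∈ V, y v := by
      rw [hy]; simp only [one_mul]; exact Finset.sum_coe_sort V y
    let w0 : ↥E → ℝ := fun e => if 0 ≤ ∑ v ∈ e.1, y v then M else 0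
    have hw0 : w0 ∈ B := by
      refine ⟨fun e => ?_, fun e => ?_⟩ <;> simp only [w0, Pi.zero_apply] <;> split_ifs <;> linarith
    have h2 : f (A w0) = M * ∑ e ∈ E, max (∑ v ∈ e, y v) 0 := by
      rw [hy]
      change ∑ v : ↥V, (∑ e : ↥E, if v.1 ∈ e.1 then w0 e else 0) * y v.1 = _
      simp only [Finset.sum_mul]
      rw [Finset.sum_comm, Finset.mul_sum, ← Finset.sum_coe_sort E]
      refine Finset.sum_congr rfl fun e _ => ?_
      have e1 : ∑ v : ↥V, (if v.1 ∈ e.1 then w0 e else 0) * y v.1 = w0 e * ∑ v ∈ e.1, y v := by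
        rw [Finset.sum_coe_sort V (fun v => (if v ∈ e.1 then w0 e else 0) * y v), Finset.mul_sum]
        simp only [ite_mul, zero_mul]
        rw [← Finset.sum_filter, Finset.filter_mem_eq_inter, Finset.inter_eq_right.2 (hE e.1 e.2)]
      rw [e1]
      simp only [w0]
      split_ifs with h
      · rw [max_eq_left h]
      · rw [max_eq_right (by linarith)]; simp
    have h3 := hs (A w0) ⟨w0, hw0, rfl⟩
    have h4 := H y
    rw [h1] at hf
    linarith
  obtain ⟨w, hw, hAw⟩ := hmem
  refine ⟨fun e => if h : e ∈ E then w ⟨e, h⟩ else 0, fun e => ?_, fun e => ?_, fun v hv => ?_⟩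
  · dsimp only; split_ifs with h
    · exact hw.1 ⟨e, h⟩
    · exact le_rfl
  · dsimp only; split_ifs with h
    · exact hw.2 ⟨e, h⟩
    · exact hM
  · have := congrFun hAw ⟨v, hv⟩
    change (∑ e : ↥E, if v ∈ e.1 then w e else 0) = 1 at this
    rw [← this, Finset.sum_filter, ← Finset.sum_coe_sort E]
    refine Finset.sum_congr rfl fun e _ => ?_
    simp

lemma srs_weights {α : Type} [DecidableEq α] {V1 V2 V3 V4 : Finset α} (hd : SrsDisj V1 V2 V3 V4)
    (n : ℕ) (hn : 0 < n) (k1 : V1.card = n) (k2 : V2.card = n) (k3 : V3.card = n) (k4 : V4.card = n)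
    (E : Finset (Finset α)) (hE : IsPartite4 V1 V2 V3 V4 E) (C : ℝ) (hC : 0 < C)
    (H : ∀ a b2 b3 b4 : α → ℝ,
      (𝔼 x ∈ V1, a x) + (𝔼 u ∈ V2, b2 u) + (𝔼 v ∈ V3, b3 v) + (𝔼 w ∈ V4, b4 w) ≤
      C * (𝔼 x ∈ V1, 𝔼 u ∈ V2, 𝔼 v ∈ V3, 𝔼 w ∈ V4,
        (if ({x, u, v, w} : Finset α) ∈ E then (1 : ℝ) else 0) *
          max (a x + b2 u + b3 v + b4 w) 0)) :
    ∃ w : Finset α → ℝ, (∀ e, 0 ≤ w e) ∧ (∀ e, w e ≤ C / (n : ℝ) ^ 3) ∧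
      ∀ v ∈ V1 ∪ V2 ∪ V3 ∪ V4, ∑ e ∈ E.filter (fun e => v ∈ e), w e = 1 := by
  have hn' : (0 : ℝ) < n := by exact_mod_cast hn
  apply srs_dualize
  · positivity
  · intro e he; exact (hE e he).1
  intro y
  have h := H y y y y
  rw [srs_E4 V1 V2 V3 V4 n k1 k2 k3 k4] at h
  simp only [Finset.expect_eq_sum_div_card, k1, k2, k3, k4] at h
  have hu : ∑ v ∈ V1 ∪ V2 ∪ V3 ∪ V4, y v =
      ∑ v ∈ V1, y v + ∑ v ∈ V2, y v + ∑ v ∈ V3, y v + ∑ v ∈ V4, y v := by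
    rw [Finset.sum_union, Finset.sum_union, Finset.sum_union hd.d12]
    · exact Finset.disjoint_union_left.2 ⟨hd.d13, hd.d23⟩
    · exact Finset.disjoint_union_left.2 ⟨Finset.disjoint_union_left.2 ⟨hd.d14, hd.d24⟩, hd.d34⟩
  have hs : ∑ e ∈ E, max (∑ v ∈ e, y v) 0 = ∑ x ∈ V1, ∑ u ∈ V2, ∑ v ∈ V3, ∑ w ∈ V4,
      (if ({x, u, v, w} : Finset α) ∈ E then (1 : ℝ) else 0) * max (y x + y u + y v + y w) 0 := by
    rw [srs_tuple_sum hd hE]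
    refine Finset.sum_congr rfl fun x hx => Finset.sum_congr rfl fun u hu =>
      Finset.sum_congr rfl fun v hv => Finset.sum_congr rfl fun w hw => ?_
    have : ∑ z ∈ ({x, u, v, w} : Finset α), y z = y x + y u + y v + y w := by
      have n12 := Finset.disjoint_left.1 hd.d12 hx
      have n13 := Finset.disjoint_left.1 hd.d13 hx
      have n14 := Finset.disjoint_left.1 hd.d14 hx
      have n23 := Finset.disjoint_left.1 hd.d23 hu
      have n24 := Finset.disjoint_left.1 hd.d24 hu
      have n34 := Finset.disjoint_left.1 hd.d34 hv
      rw [Finset.sum_insert, Finset.sum_insert, Finset.sum_insert, Finset.sum_singleton]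
      · ring
      · simp only [Finset.mem_singleton]; rintro rfl; exact n34 hw
      · simp only [Finset.mem_insert, Finset.mem_singleton]; rintro (rfl | rfl)
        · exact n23 hv
        · exact n24 hw
      · simp only [Finset.mem_insert, Finset.mem_singleton]; rintro (rfl | rfl | rfl)
        · exact n12 hu
        · exact n13 hv
        · exact n14 hw
    rw [this]
    split_ifs <;> simp
  rw [hu, hs]
  rw [← add_div, ← add_div, ← add_div, div_le_iff₀ hn'] at h
  refine h.trans (le_of_eq ?_)
  field_simp


lemma srs_random {β ι : Type} [DecidableEq β] (E : Finset β) (p : β → ℝ) (p0 : ∀ e, 0 ≤ p e)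
    (p1 : ∀ e, p e ≤ 1) (J : Finset ι) (t L : ι → ℝ) (S : ι → β → Prop)
    [∀ j, DecidablePred (S j)] (B : ℝ)
    (hB : ∀ j ∈ J, (∑ e ∈ E.filter (S j), p e) * (Real.exp (t j) - 1) - L j ≤ B)
    (hJ : (J.card : ℝ) * Real.exp B < 1) :
    ∃ F ⊆ E, ∀ j ∈ J, t j * ((F.filter (S j)).card : ℝ) < L j := by
  by_contra hcon
  push Not at hcon
  set P : Finset β → ℝ := fun F => (∏ e ∈ F, p e) * ∏ e ∈ E \ F, (1 - p e) with hP
  have hP0 : ∀ F, 0 ≤ P F := fun F => mul_nonneg (Finset.prod_nonneg fun e _ => p0 e)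
    (Finset.prod_nonneg fun e _ => by linarith [p1 e])
  have hP1 : ∑ F ∈ E.powerset, P F = 1 := by
    rw [hP, ← Finset.prod_add]; simp
  have hge : ∀ F ∈ E.powerset, 1 ≤ ∑ j ∈ J, Real.exp (t j * ((F.filter (S j)).card : ℝ) - L j) := by
    intro F hF
    obtain ⟨j, hj, hl⟩ := hcon F (Finset.mem_powerset.1 hF)
    refine le_trans ?_ (Finset.single_le_sum
      (f := fun j => Real.exp (t j * ((F.filter (S j)).card : ℝ) - L j))
      (fun j _ => (Real.exp_pos _).le) hj)
    exact Real.one_le_exp (by linarith)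
  have h1 : (1 : ℝ) ≤ ∑ F ∈ E.powerset, P F *
      ∑ j ∈ J, Real.exp (t j * ((F.filter (S j)).card : ℝ) - L j) := by
    rw [← hP1]
    exact Finset.sum_le_sum fun F hF => le_mul_of_one_le_right (hP0 F) (hge F hF)
  simp only [Finset.mul_sum] at h1
  rw [Finset.sum_comm] at h1
  have h2 : ∀ j ∈ J, ∑ F ∈ E.powerset, P F * Real.exp (t j * ((F.filter (S j)).card : ℝ) - L j) ≤
      Real.exp B := by
    intro j hj
    have e1 : ∀ F ∈ E.powerset, P F * Real.exp (t j * ((F.filter (S j)).card : ℝ) - L j) =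
        Real.exp (- L j) * ((∏ e ∈ F, p e * (if S j e then Real.exp (t j) else 1)) *
          ∏ e ∈ E \ F, (1 - p e)) := by
      intro F _
      rw [Finset.prod_mul_distrib, Finset.prod_ite]
      simp only [Finset.prod_const, one_pow, mul_one, hP]
      rw [← Real.exp_nat_mul, sub_eq_add_neg, Real.exp_add, mul_comm (t j)]
      ring
    rw [Finset.sum_congr rfl e1, ← Finset.mul_sum, ← Finset.prod_add]
    have e2 : ∏ e ∈ E, (p e * (if S j e then Real.exp (t j) else 1) + (1 - p e)) ≤
        ∏ e ∈ E, Real.exp (if S j e then p e * (Real.exp (t j) - 1) else 0) := by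
      apply Finset.prod_le_prod
      · intro e _
        have := p0 e
        have := p1 e
        have := Real.exp_pos (t j)
        refine add_nonneg (mul_nonneg (p0 e) ?_) (by linarith)
        split_ifs <;> positivity
      · intro e _
        split_ifs
        · have := Real.add_one_le_exp (p e * (Real.exp (t j) - 1))
          linarith
        · simp
    rw [← Real.exp_sum, ← Finset.sum_filter, ← Finset.sum_mul] at e2
    calc _ ≤ Real.exp (- L j) * _ := mul_le_mul_of_nonneg_left e2 (Real.exp_pos _).le
      _ = Real.exp ((∑ e ∈ E.filter (S j), p e) * (Real.exp (t j) - 1) - L j) := by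
        rw [← Real.exp_add]; ring_nf
      _ ≤ _ := Real.exp_le_exp.2 (hB j hj)
  have h3 := h1.trans (Finset.sum_le_sum h2)
  rw [Finset.sum_const, nsmul_eq_mul] at h3
  linarith

lemma srs_pair_count {α : Type} [DecidableEq α] (V : Finset α) (n : ℕ) (hV : V.card ≤ 4 * n)
    (E : Finset (Finset α)) (hE : ∀ e ∈ E, e ⊆ V) (h4 : ∀ e ∈ E, e.card = 4) (x y : α) (hxy : x ≠ y) :
    ((E.filter (fun e => x ∈ e ∧ y ∈ e)).card : ℝ) ≤ 8 * (n : ℝ) ^ 2 := by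
  have h1 : (E.filter (fun e => x ∈ e ∧ y ∈ e)).card ≤ (V.powersetCard 2).card := by
    apply Finset.card_le_card_of_injOn (fun e => e \ {x, y})
    · intro e he
      simp only [Finset.coe_filter, Set.mem_setOf_eq] at he
      obtain ⟨he, hx, hy⟩ := he
      simp only [Finset.mem_coe, Finset.mem_powersetCard]
      refine ⟨Finset.sdiff_subset.trans (hE e he), ?_⟩
      rw [Finset.card_sdiff_of_subset, h4 e he, Finset.card_pair hxy]
      intro z hz
      simp only [Finset.mem_insert, Finset.mem_singleton] at hz
      rcases hz with rfl | rfl <;> assumption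
    · intro e he f hf hef
      simp only [Finset.coe_filter, Set.mem_setOf_eq] at he hf
      have hef' := Finset.ext_iff.1 hef
      ext z
      have := hef' z
      simp only [Finset.mem_sdiff, Finset.mem_insert, Finset.mem_singleton] at this
      by_cases hzx : z = x
      · subst hzx; simp [he.2.1, hf.2.1]
      by_cases hzy : z = y
      · subst hzy; simp [he.2.2, hf.2.2]
      simpa [hzx, hzy] using this
  rw [Finset.card_powersetCard] at h1
  have h2 : V.card.choose 2 ≤ (4 * n).choose 2 := Nat.choose_le_choose 2 hV
  have h3 : ((4 * n).choose 2 : ℝ) ≤ ((4 * n : ℕ) : ℝ) ^ 2 / (Nat.factorial 2 : ℝ) :=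
    Nat.choose_le_pow_div 2 (4 * n)
  have h4 : ((E.filter (fun e => x ∈ e ∧ y ∈ e)).card : ℝ) ≤ ((4 * n).choose 2 : ℝ) := by
    exact_mod_cast h1.trans h2
  refine h4.trans (h3.trans (le_of_eq ?_))
  push_cast
  norm_num [Nat.factorial]
  ring

lemma srs_exp_quad (t : ℝ) (ht : |t| ≤ 1) : Real.exp t - 1 ≤ t + t ^ 2 := by
  have := (abs_le.1 (Real.abs_exp_sub_one_sub_id_le ht)).2
  linarith

lemma srs_sparse {α : Type} [DecidableEq α] (V : Finset α) (n : ℕ) (hV : V.card ≤ 4 * n)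
    (E : Finset (Finset α)) (hE : ∀ e ∈ E, e ⊆ V) (h4 : ∀ e ∈ E, e.card = 4) (C : ℝ) (hC : 0 < C)
    (w : Finset α → ℝ) (w0 : ∀ e, 0 ≤ w e) (w1 : ∀ e, w e ≤ C / (n : ℝ) ^ 3)
    (hw : ∀ v ∈ V, ∑ e ∈ E.filter (fun e => v ∈ e), w e = 1)
    (a1 : 1 ≤ n) (a2 : 2 ≤ Real.log n) (a3 : C ≤ n)
    (a4 : 48 * (n : ℝ) ^ 2 * Real.exp (8 * C - (n : ℝ) ^ (0.1 : ℝ) / 2) < 1) :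
    ∃ F ⊆ E, (∀ v ∈ V, |(hdeg F v : ℝ) - (n : ℝ) / Real.log n| ≤ (n : ℝ) ^ (0.9 : ℝ)) ∧
      (∀ x ∈ V, ∀ y ∈ V, x ≠ y → (hdeg2 F x y : ℝ) ≤ (n : ℝ) ^ (0.1 : ℝ)) := by
  have n1 : (1 : ℝ) ≤ n := by exact_mod_cast a1
  have n0 : (0 : ℝ) < n := by linarith
  have l0 : 0 < Real.log n := by linarith
  set μ : ℝ := (n : ℝ) / Real.log n with hμ
  have μ0 : 0 < μ := by positivity
  have μn : μ ≤ n / 2 := by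
    rw [hμ]; exact div_le_div_of_nonneg_left n0.le (by norm_num) a2
  set t : ℝ := (n : ℝ) ^ (-0.1 : ℝ) with ht
  have t0 : 0 < t := by positivity
  have t1 : t ≤ 1 := Real.rpow_le_one_of_one_le_of_nonpos n1 (by norm_num)
  have r1 : t * (n : ℝ) ^ (0.9 : ℝ) = (n : ℝ) ^ (0.8 : ℝ) := by
    rw [ht, ← Real.rpow_add n0]; norm_num
  have r2 : (n : ℝ) * t ^ 2 = (n : ℝ) ^ (0.8 : ℝ) := by
    rw [ht, ← Real.rpow_natCast, ← Real.rpow_mul n0.le]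
    nth_rewrite 1 [← Real.rpow_one (n : ℝ)]
    rw [← Real.rpow_add n0]; norm_num
  have r3 : (n : ℝ) ^ (0.1 : ℝ) ≤ (n : ℝ) ^ (0.8 : ℝ) :=
    Real.rpow_le_rpow_of_exponent_le n1 (by norm_num)
  have r4 : 0 < (n : ℝ) ^ (0.1 : ℝ) := by positivity
  have r5 : μ * t ^ 2 ≤ (n : ℝ) ^ (0.8 : ℝ) / 2 := by
    rw [← r2]
    have : 0 ≤ t ^ 2 := by positivity
    nlinarith
  set p : Finset α → ℝ := fun e => w e * μ with hp
  have p0 : ∀ e, 0 ≤ p e := fun e => mul_nonneg (w0 e) μ0.le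
  have pC : ∀ e, p e ≤ C / (n : ℝ) ^ 2 / 2 := by
    intro e
    calc p e ≤ C / (n : ℝ) ^ 3 * (n / 2) := by
          apply mul_le_mul (w1 e) μn μ0.le; positivity
      _ = _ := by field_simp
  have p1 : ∀ e, p e ≤ 1 := by
    intro e
    refine (pC e).trans ?_
    have : C / (n : ℝ) ^ 2 ≤ 1 := by
      rw [div_le_one (by positivity)]; nlinarith
    linarith
  have hdegm : ∀ v ∈ V, ∑ e ∈ E.filter (fun e => v ∈ e), p e = μ := by
    intro v hv
    simp only [hp]
    rw [← Finset.sum_mul, hw v hv, one_mul]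
  have hpairm : ∀ x y, x ≠ y → ∑ e ∈ E.filter (fun e => x ∈ e ∧ y ∈ e), p e ≤ 4 * C := by
    intro x y hxy
    calc ∑ e ∈ E.filter (fun e => x ∈ e ∧ y ∈ e), p e
        ≤ ∑ e ∈ E.filter (fun e => x ∈ e ∧ y ∈ e), C / (n : ℝ) ^ 2 / 2 :=
          Finset.sum_le_sum fun e _ => pC e
      _ = ((E.filter (fun e => x ∈ e ∧ y ∈ e)).card : ℝ) * (C / (n : ℝ) ^ 2 / 2) := by
          rw [Finset.sum_const, nsmul_eq_mul]
      _ ≤ 8 * (n : ℝ) ^ 2 * (C / (n : ℝ) ^ 2 / 2) :=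
          mul_le_mul_of_nonneg_right (srs_pair_count V n hV E hE h4 x y hxy) (by positivity)
      _ = 4 * C := by field_simp; ring
  let J : Finset (Fin 3 × α × α) := Finset.univ ×ˢ V ×ˢ V
  let T : Fin 3 × α × α → ℝ := fun j => if j.1 = 0 then t else if j.1 = 1 then -t else 1
  let Lj : Fin 3 × α × α → ℝ := fun j => if j.1 = 0 then t * (μ + (n : ℝ) ^ (0.9 : ℝ)) else
    if j.1 = 1 then -t * (μ - (n : ℝ) ^ (0.9 : ℝ)) else (n : ℝ) ^ (0.1 : ℝ)
  let S : Fin 3 × α × α → Finset α → Prop := fun j e =>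
    (j.1 = 2 → j.2.2 ∈ e ∧ j.2.1 ≠ j.2.2) ∧ j.2.1 ∈ e
  have e0 : ∀ (G : Finset (Finset α)) x y, G.filter (S (0, x, y)) = G.filter (fun e => x ∈ e) := by
    intro G x y; apply Finset.filter_congr; intro e _; simp [S]
  have e1 : ∀ (G : Finset (Finset α)) x y, G.filter (S (1, x, y)) = G.filter (fun e => x ∈ e) := by
    intro G x y; apply Finset.filter_congr; intro e _; simp [S]
  have e2 : ∀ (G : Finset (Finset α)) x y, x ≠ y →
      G.filter (S (2, x, y)) = G.filter (fun e => x ∈ e ∧ y ∈ e) := by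
    intro G x y hxy; apply Finset.filter_congr; intro e _; simp [S, hxy, and_comm]
  have e3 : ∀ (G : Finset (Finset α)) x, G.filter (S (2, x, x)) = ∅ := by
    intro G x; apply Finset.filter_false_of_mem; intro e _; simp [S]
  obtain ⟨F, hF, hFJ⟩ := srs_random E p p0 p1 J T Lj S (8 * C - (n : ℝ) ^ (0.1 : ℝ) / 2) (by
    rintro ⟨k, x, y⟩ hj
    simp only [J, Finset.mem_product, Finset.mem_univ, true_and] at hj
    obtain ⟨hx, hy⟩ := hj
    fin_cases k
    · change (∑ e ∈ E.filter (S (0, x, y)), p e) * _ - _ ≤ _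
      rw [e0, hdegm x hx]
      simp only [T, Lj, Fin.zero_eta, if_true]
      have := mul_le_mul_of_nonneg_left (srs_exp_quad t (by rw [abs_of_pos t0]; exact t1)) μ0.le
      nlinarith
    · change (∑ e ∈ E.filter (S (1, x, y)), p e) * _ - _ ≤ _
      rw [e1, hdegm x hx]
      simp only [T, Lj, Fin.mk_one, one_ne_zero, if_false, if_true]
      have := mul_le_mul_of_nonneg_left
        (srs_exp_quad (-t) (by rw [abs_neg, abs_of_pos t0]; exact t1)) μ0.le
      nlinarith
    · change (∑ e ∈ E.filter (S (2, x, y)), p e) * (Real.exp (T (2, x, y)) - 1) - Lj (2, x, y) ≤ _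
      have hT : T (2, x, y) = 1 := by simp [T]
      have hL : Lj (2, x, y) = (n : ℝ) ^ (0.1 : ℝ) := by simp [Lj]
      rw [hT, hL]
      have hexp := Real.exp_one_lt_d9
      have hexp' : 0 ≤ Real.exp 1 - 1 := by linarith [Real.add_one_le_exp 1]
      by_cases hxy : x = y
      · subst hxy
        rw [e3]; simp only [Finset.sum_empty, zero_mul]; linarith
      · rw [e2 _ _ _ hxy]
        have := mul_le_mul_of_nonneg_right (hpairm x y hxy) hexp'
        nlinarith) (by
    refine lt_of_le_of_lt (mul_le_mul_of_nonneg_right ?_ (Real.exp_pos _).le) a4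
    have hc : J.card = 3 * (V.card * V.card) := by simp [J]
    have hV' : (V.card : ℝ) ≤ 4 * n := by exact_mod_cast hV
    have hV0 : (0 : ℝ) ≤ V.card := by positivity
    rw [hc]; push_cast; nlinarith)
  refine ⟨F, hF, fun v hv => ?_, fun x hx y hy hxy => ?_⟩
  · have b0 := hFJ (0, v, v) (by simp [J, hv])
    have b1 := hFJ (1, v, v) (by simp [J, hv])
    rw [e0] at b0
    rw [e1] at b1
    simp only [T, Lj, if_true, one_ne_zero, if_false] at b0 b1
    have c0 := lt_of_mul_lt_mul_left b0 t0.le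
    have c1 : μ - (n : ℝ) ^ (0.9 : ℝ) < ((F.filter (fun e => v ∈ e)).card : ℝ) := by
      have : t * (μ - (n : ℝ) ^ (0.9 : ℝ)) < t * ((F.filter (fun e => v ∈ e)).card : ℝ) := by linarith
      exact lt_of_mul_lt_mul_left this t0.le
    rw [abs_le, hdeg]
    constructor <;> linarith
  · have b2 := hFJ (2, x, y) (by simp [J, hx, hy])
    rw [e2 _ _ _ hxy] at b2
    have hT : T (2, x, y) = 1 := by simp [T]
    have hL : Lj (2, x, y) = (n : ℝ) ^ (0.1 : ℝ) := by simp [Lj]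
    rw [hT, hL, one_mul] at b2
    rw [hdeg2]
    exact b2.le

lemma srs_asymp (C δ : ℝ) (hδ : 0 < δ) : ∀ᶠ n : ℕ in Filter.atTop, 1 ≤ n ∧ 2 ≤ Real.log n ∧ C ≤ n ∧
    12 / (n : ℝ) ≤ δ ∧ 48 * (n : ℝ) ^ 2 * Real.exp (8 * C - (n : ℝ) ^ (0.1 : ℝ) / 2) < 1 := by
  have c := tendsto_natCast_atTop_atTop (R := ℝ)
  have f2 := (Real.tendsto_log_atTop.comp c).eventually_ge_atTop 2
  have f3 := c.eventually_ge_atTop C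
  have f4 := c.eventually_ge_atTop (12 / δ)
  have g1 : Filter.Tendsto (fun n : ℕ => (n : ℝ) ^ (0.1 : ℝ)) Filter.atTop Filter.atTop :=
    (tendsto_rpow_atTop (by norm_num)).comp c
  have g2 := (tendsto_rpow_mul_exp_neg_mul_atTop_nhds_zero 20 (1/2) (by norm_num)).comp g1
  have g3 : (0 : ℝ) < (48 * Real.exp (8 * C))⁻¹ := by positivity
  have f5 := g2.eventually_lt_const g3
  filter_upwards [Filter.eventually_ge_atTop 1, f2, f3, f4, f5] with n a1 a2 a3 a4 a5
  have n0 : (0 : ℝ) < n := by exact_mod_cast a1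
  refine ⟨a1, a2, a3, ?_, ?_⟩
  · rw [div_le_iff₀ hδ] at a4
    rw [div_le_iff₀ n0]; linarith
  · simp only [Function.comp] at a5
    have e20 : (0.1 : ℝ) * 20 = ((2 : ℕ) : ℝ) := by norm_num
    rw [← Real.rpow_mul n0.le, e20, Real.rpow_natCast, ← one_div, lt_div_iff₀ (by positivity)] at a5
    refine lt_of_eq_of_lt ?_ a5
    have e21 : 8 * C - (n : ℝ) ^ (0.1 : ℝ) / 2 = -(1 / 2) * (n : ℝ) ^ (0.1 : ℝ) + 8 * C := by ring
    rw [e21, Real.exp_add]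
    ring

/-- For every sufficiently small `ε > 0` there is `γ0 > 0` such that for every
`γ ∈ (0, γ0)` there is `n0` such that for all `n ≥ n0`: if `H` is a balanced
4-partite 4-graph with classes of size `n`, not `ε`-close to `H'₁,₃(n)`, with
`d_H({x,y}) ≥ (5/9 − γ)n²` for all `x ∈ V1`, `y ∈ V2 ∪ V3 ∪ V4`, then `H` has
a spanning subhypergraph `F` with `|d_F(v) − n/ln n| ≤ n^{0.9}` for every
vertex `v` and `d_F({x,y}) ≤ n^{0.1}` for all pairs of distinct vertices. -/
theorem sparse_regular_subgraph :
    ∃ ε0 : ℝ, 0 < ε0 ∧ ∀ ε : ℝ, 0 < ε → ε < ε0 →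
    ∃ γ0 : ℝ, 0 < γ0 ∧ ∀ γ : ℝ, 0 < γ → γ < γ0 →
    ∃ n0 : ℕ, ∀ n : ℕ, n0 ≤ n →
    ∀ (α : Type) [DecidableEq α], ∀ V1 V2 V3 V4 : Finset α,
      Disjoint V1 V2 → Disjoint V1 V3 → Disjoint V1 V4 →
      Disjoint V2 V3 → Disjoint V2 V4 → Disjoint V3 V4 →
      V1.card = n → V2.card = n → V3.card = n → V4.card = n →
      ∀ E : Finset (Finset α),
        IsPartite4 V1 V2 V3 V4 E →
        ¬ CloseToH13 ε n V1 V2 V3 V4 E →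
        (∀ x ∈ V1, ∀ y ∈ V2 ∪ V3 ∪ V4,
          ((5 : ℝ) / 9 - γ) * n ^ 2 ≤ (hdeg2 E x y : ℝ)) →
        ∃ F : Finset (Finset α),
          F ⊆ E ∧
          (∀ v ∈ V1 ∪ V2 ∪ V3 ∪ V4,
            |(hdeg F v : ℝ) - (n : ℝ) / Real.log n| ≤ (n : ℝ) ^ (0.9 : ℝ)) ∧
          (∀ x ∈ V1 ∪ V2 ∪ V3 ∪ V4, ∀ y ∈ V1 ∪ V2 ∪ V3 ∪ V4, x ≠ y →
            (hdeg2 F x y : ℝ) ≤ (n : ℝ) ^ (0.1 : ℝ)) := by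
  refine ⟨1, by norm_num, fun ε hε _ => ?_⟩
  obtain ⟨C, γ1, hC, hγ1, hdual⟩ := srs_dual (ε / 60) (by positivity)
  refine ⟨min γ1 (ε / 12), lt_min hγ1 (by positivity), fun γ hγ hγ0 => ?_⟩
  have hγa : γ < γ1 := hγ0.trans_le (min_le_left _ _)
  have hγb : γ < ε / 12 := hγ0.trans_le (min_le_right _ _)
  obtain ⟨n0, hn0⟩ := Filter.eventually_atTop.1 (srs_asymp C (ε / 2) (by positivity))
  refine ⟨n0, fun n hn α _ V1 V2 V3 V4 d12 d13 d14 d23 d24 d34 k1 k2 k3 k4 E hE hclose hdg => ?_⟩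
  obtain ⟨a1, a2, a3, a5, a4⟩ := hn0 n hn
  have hd : SrsDisj V1 V2 V3 V4 := ⟨d12, d13, d14, d23, d24, d34⟩
  have hnpos : (0 : ℝ) < n := by exact_mod_cast a1
  have ne1 : V1.Nonempty := Finset.card_pos.1 (by omega)
  have ne2 : V2.Nonempty := Finset.card_pos.1 (by omega)
  have ne3 : V3.Nonempty := Finset.card_pos.1 (by omega)
  have ne4 : V4.Nonempty := Finset.card_pos.1 (by omega)
  have conv : ∀ (A B : Finset α) (f : α → α → ℝ) (d : ℝ), A.card = n → B.card = n →
      (5 / 9 - γ) * (n : ℝ) ^ 2 ≤ d → d ≤ ∑ v ∈ A, ∑ w ∈ B, f v w →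
      5 / 9 - γ ≤ 𝔼 v ∈ A, 𝔼 w ∈ B, f v w := by
    intro A B f d hA hB h1 h2
    simp only [Finset.expect_eq_sum_div_card, hA, hB, ← Finset.sum_div]
    rw [div_div, le_div_iff₀ (by positivity)]
    nlinarith
  set h : α → α → α → α → ℝ := fun x u v w => if ({x, u, v, w} : Finset α) ∈ E then (1 : ℝ) else 0
    with hh
  have g2 : ∀ x ∈ V1, ∀ u ∈ V2, 5 / 9 - γ ≤ 𝔼 v ∈ V3, 𝔼 w ∈ V4, h x u v w := fun x hx u hu =>
    conv V3 V4 (fun v w => h x u v w) _ k3 k4 (hdg x hx u (by simp [hu])) (srs_deg12 hd hE hx hu)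
  have g3 : ∀ x ∈ V1, ∀ v ∈ V3, 5 / 9 - γ ≤ 𝔼 u ∈ V2, 𝔼 w ∈ V4, h x u v w := fun x hx v hv =>
    conv V2 V4 (fun u w => h x u v w) _ k2 k4 (hdg x hx v (by simp [hv])) (srs_deg13 hd hE hx hv)
  have g4 : ∀ x ∈ V1, ∀ w ∈ V4, 5 / 9 - γ ≤ 𝔼 u ∈ V2, 𝔼 v ∈ V3, h x u v w := fun x hx w hw =>
    conv V2 V3 (fun u v => h x u v w) _ k2 k3 (hdg x hx w (by simp [hw])) (srs_deg14 hd hE hx hw)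
  have hh0 : ∀ x u v w, 0 ≤ h x u v w := by
    intro x u v w; simp only [hh]; split_ifs <;> norm_num
  have hh1 : ∀ x u v w, h x u v w ≤ 1 := by
    intro x u v w; simp only [hh]; split_ifs <;> norm_num
  obtain ⟨w, w0, w1, hw⟩ := srs_weights hd n a1 k1 k2 k3 k4 E hE C hC (by
    intro a b2 b3 b4
    by_contra hcon
    obtain ⟨U1, U2, U3, U4, s1, s2, s3, s4, m1, m2, m3, m4, hU⟩ :=
      hdual α V1 V2 V3 V4 ne1 ne2 ne3 ne4 h hh0 hh1
        (fun x hx u hu => le_trans (by linarith) (g2 x hx u hu))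
        (fun x hx u hu => le_trans (by linarith) (g3 x hx u hu))
        (fun x hx u hu => le_trans (by linarith) (g4 x hx u hu)) a b2 b3 b4 (not_le.1 hcon)
    exact hclose (srs_close hd n a1 k1 k2 k3 k4 E h hh γ (ε / 60) ε hγ (by positivity)
      (by linarith) g2 g3 g4 U1 U2 U3 U4 s2 s3 s4 m1 m2 m3 m4 hU))
  have hcardV : (V1 ∪ V2 ∪ V3 ∪ V4).card ≤ 4 * n := by
    have := Finset.card_union_le (V1 ∪ V2 ∪ V3) V4
    have := Finset.card_union_le (V1 ∪ V2) V3
    have := Finset.card_union_le V1 V2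
    omega
  have hcard4 : ∀ e ∈ E, e.card = 4 := by
    intro e he
    obtain ⟨b0, b1, b2, b3, b4⟩ := hE e he
    have : e = (((e ∩ V1) ∪ (e ∩ V2)) ∪ (e ∩ V3)) ∪ (e ∩ V4) := by
      rw [← Finset.inter_union_distrib_left, ← Finset.inter_union_distrib_left,
        ← Finset.inter_union_distrib_left, Finset.inter_eq_left.2 b0]
    rw [this, Finset.card_union_of_disjoint, Finset.card_union_of_disjoint,
      Finset.card_union_of_disjoint, b1, b2, b3, b4]
    · exact d12.mono Finset.inter_subset_right Finset.inter_subset_right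
    · rw [← Finset.inter_union_distrib_left]
      exact (Finset.disjoint_union_left.2 ⟨d13, d23⟩).mono Finset.inter_subset_right
        Finset.inter_subset_right
    · rw [← Finset.inter_union_distrib_left, ← Finset.inter_union_distrib_left]
      exact (Finset.disjoint_union_left.2 ⟨Finset.disjoint_union_left.2 ⟨d14, d24⟩, d34⟩).mono
        Finset.inter_subset_right Finset.inter_subset_right
  obtain ⟨F, hF, hF1, hF2⟩ := srs_sparse (V1 ∪ V2 ∪ V3 ∪ V4) n hcardV E (fun e he => (hE e he).1)
    hcard4 C hC w w0 w1 hw a1 a2 a3 a4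
  exact ⟨F, hF, hF1, hF2⟩
end

section
/- For every η > 0 and every sufficiently small ε > 0 there exists γ0 > 0 such that for every γ ∈ (0, γ0) there exists n0 ∈ ℕ such that the following holds for all n ≥ n0. Let H be a balanced 4-partite 4-graph with vertex classes V1, V2, V3, V4, each of size n, such that H is not ε-close to H'_{1,3}(n) and d_H({x,y}) > (5/9 − γ)n² for every x ∈ V1 and every y ∈ V2 ∪ V3 ∪ V4. Then H has a matching of size at least (1 − η)n. -/
open Finset

namespace Aux

lemma numA (p d p' d' : ℝ) (hp : 0 ≤ p) (hd : 0 ≤ d) (h1 : p + d ≤ 1)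
    (hp' : 0 ≤ p') (hd' : 0 ≤ d') (h1' : p' + d' ≤ 1)
    (h : p * p' + p * d' + p' * d ≤ 4 / 9) : (2 * p + d) * (2 * p' + d') ≤ 16 / 9 := by
  by_cases hc : d * d' ≤ 2 * (p * d') + 2 * (p' * d)
  · nlinarith
  · push Not at hc
    have hd0 : 0 < d := by
      rcases hd.eq_or_lt with h0 | h0
      · rw [← h0] at hc; nlinarith [mul_nonneg hp hd']
      · exact h0
    have hd0' : 0 < d' := by
      rcases hd'.eq_or_lt with h0 | h0
      · rw [← h0] at hc; nlinarith [mul_nonneg hp' hd]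
      · exact h0
    have h2 : p * (d * d') ≤ p * d' := by
      have : d * d' ≤ d' := by nlinarith
      exact mul_le_mul_of_nonneg_left this hp
    have h3 : p' * (d * d') ≤ p' * d := by
      have : d * d' ≤ d := by nlinarith
      exact mul_le_mul_of_nonneg_left this hp'
    have h4 : p + p' < 1 / 2 := by
      have hdd : 0 < d * d' := mul_pos hd0 hd0'
      by_contra hcon
      push Not at hcon
      nlinarith
    have h5 : (2 * p + d) * (2 * p' + d') ≤ (1 + p) * (1 + p') := by
      apply mul_le_mul <;> linarith
    nlinarith [sq_nonneg (p - p')]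

lemma numB' (s1 s2 s3 : ℝ) (k1 : s1 ≤ 2)
    (h12 : s1 * s2 ≤ 16 / 9) (h13 : s1 * s3 ≤ 16 / 9) (l2 : s2 ≤ s1) (l3 : s3 ≤ s1) :
    s1 + s2 + s3 ≤ 4 := by
  by_cases hs : s1 ≤ 4 / 3
  · linarith
  · push Not at hs
    nlinarith

lemma numB (s1 s2 s3 : ℝ) (h1 : 0 ≤ s1) (h2 : 0 ≤ s2) (h3 : 0 ≤ s3) (k1 : s1 ≤ 2)
    (k2 : s2 ≤ 2) (k3 : s3 ≤ 2)
    (h12 : s1 * s2 ≤ 16 / 9) (h13 : s1 * s3 ≤ 16 / 9) (h23 : s2 * s3 ≤ 16 / 9) :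
    s1 + s2 + s3 ≤ 4 := by
  rcases le_total s1 s2 with a | a <;> rcases le_total s2 s3 with b | b <;>
    rcases le_total s1 s3 with c | c
  · linarith [numB' s3 s1 s2 k3 (by linarith) (by linarith) c b]
  · linarith [numB' s3 s1 s2 k3 (by linarith) (by linarith) (by linarith) b]
  · linarith [numB' s2 s1 s3 k2 (by linarith) (by linarith) a b]
  · linarith [numB' s2 s1 s3 k2 (by linarith) (by linarith) a b]
  · linarith [numB' s3 s1 s2 k3 (by linarith) (by linarith) c b]
  · linarith [numB' s1 s2 s3 k1 (by linarith) (by linarith) a c]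
  · linarith [numB' s1 s2 s3 k1 (by linarith) (by linarith) a (by linarith)]
  · linarith [numB' s1 s2 s3 k1 (by linarith) (by linarith) a c]

/-- `p i` proportion of small vertices, `q i` proportion of non-large ones. -/
lemma numC (ζ N : ℝ) (hζ : 0 < ζ) (hN : 0 < N) (p q : Fin 3 → ℝ) (hp : ∀ i, 0 ≤ p i)
    (hpq : ∀ i, p i ≤ q i) (hq : ∀ i, q i ≤ N)
    (h : ∀ i j, i ≠ j → p i * q j + q i * p j - p i * p j ≤ (4 / 9 + 4 / 9 * ζ) * N ^ 2) :
    ∑ i, (p i + q i) ≤ (4 + 2 * ζ) * N := by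
  set c : ℝ := 1 / ((1 + ζ / 2) * N) with hc
  have hc0 : 0 < c := by positivity
  have hcN : c * N ≤ 1 := by
    rw [hc]; field_simp; linarith
  have hc2 : c ^ 2 * ((4 / 9 + 4 / 9 * ζ) * N ^ 2) ≤ 4 / 9 := by
    rw [hc]; field_simp; nlinarith
  have key : ∀ i j, i ≠ j → (c * (p i + q i)) * (c * (p j + q j)) ≤ 16 / 9 := by
    intro i j hij
    have := numA (c * p i) (c * (q i - p i)) (c * p j) (c * (q j - p j))
      (mul_nonneg hc0.le (hp i)) (mul_nonneg hc0.le (by linarith [hpq i]))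
      (by nlinarith [hq i]) (mul_nonneg hc0.le (hp j))
      (mul_nonneg hc0.le (by linarith [hpq j])) (by nlinarith [hq j])
      (by
        have h1 := mul_le_mul_of_nonneg_left (h i j hij) (sq_nonneg c)
        nlinarith)
    calc _ = _ := by ring
      _ ≤ _ := this
  have nn : ∀ i, 0 ≤ c * (p i + q i) := fun i =>
    mul_nonneg hc0.le (by linarith [hp i, hpq i])
  have le2 : ∀ i, c * (p i + q i) ≤ 2 := fun i => by nlinarith [hpq i, hq i]
  have := numB _ _ _ (nn 0) (nn 1) (nn 2) (le2 0) (le2 1) (le2 2)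
    (key 0 1 (by decide)) (key 0 2 (by decide)) (key 1 2 (by decide))
  rw [Fin.sum_univ_three]
  have h2 : c * (p 0 + q 0 + (p 1 + q 1) + (p 2 + q 2)) ≤ 4 := by linarith
  have h3 : c * ((1 + ζ / 2) * N) = 1 := by rw [hc]; field_simp
  have h4 : 0 < (1 + ζ / 2) * N := by positivity
  have := mul_le_mul_of_nonneg_right h2 h4.le
  nlinarith

open MeasureTheory in
lemma intg (f : ℝ) (hf : 0 ≤ f) :
    1 - f ≤ ∫ θ in Set.Ioc (0:ℝ) (1/2), ((Set.Ioi f).indicator (fun _ => (1:ℝ)) θ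
      + (Set.Iic (1 - f)).indicator (fun _ => (1:ℝ)) θ) := by
  rw [integral_add]
  · rw [setIntegral_indicator measurableSet_Ioi, setIntegral_indicator measurableSet_Iic]
    have e1 : Set.Ioc (0:ℝ) (1/2) ∩ Set.Ioi f = Set.Ioc f (1/2) := by
      ext x
      simp only [Set.mem_inter_iff, Set.mem_Ioc, Set.mem_Ioi]
      constructor
      · rintro ⟨⟨a, b⟩, c⟩; exact ⟨c, b⟩
      · rintro ⟨a, b⟩; exact ⟨⟨by linarith, b⟩, a⟩
    have e2 : Set.Ioc (0:ℝ) (1/2) ∩ Set.Iic (1 - f) = Set.Ioc 0 (min (1/2) (1 - f)) := by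
      ext x; simp
    rw [e1, e2]
    simp only [integral_const, smul_eq_mul, mul_one, measureReal_restrict_apply_univ,
      Real.volume_real_Ioc]
    rcases le_total f (1/2) with h | h
    · rw [max_eq_left (by linarith), min_eq_left (by linarith), max_eq_left (by norm_num)]
      linarith
    · rw [min_eq_right (by linarith)]
      have := le_max_right (1/2 - f) 0
      have := le_max_left (1 - f - 0) 0
      linarith
  · exact (integrable_const 1).indicator measurableSet_Ioi
  · exact (integrable_const 1).indicator measurableSet_Iic

open MeasureTheory in
lemma threefun (ζ : ℝ) (hζ : 0 < ζ) (N : ℕ) (hN : 0 < N) (f : Fin 3 → Fin N → ℝ)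
    (hf : ∀ i v, 0 ≤ f i v)
    (h : ∀ i j, i ≠ j → (5 / 9 - 4 / 9 * ζ) * (N:ℝ) ^ 2 ≤
      ((univ.filter (fun x : Fin N × Fin N => 1 ≤ f i x.1 + f j x.2)).card : ℝ)) :
    (1 - ζ) * N ≤ ∑ i, ∑ v, f i v := by
  classical
  have hN' : (0:ℝ) < N := by exact_mod_cast hN
  have pt : ∀ θ ∈ Set.Ioc (0:ℝ) (1/2), ∑ i, ∑ v, ((Set.Ioi (f i v)).indicator (fun _ => (1:ℝ)) θ
      + (Set.Iic (1 - f i v)).indicator (fun _ => (1:ℝ)) θ) ≤ (4 + 2 * ζ) * N := by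
    intro θ hθ
    let P : Fin 3 → Finset (Fin N) := fun i => univ.filter (fun v => f i v < θ)
    let Q : Fin 3 → Finset (Fin N) := fun i => univ.filter (fun v => θ ≤ 1 - f i v)
    have hPQ : ∀ i, P i ⊆ Q i := by
      intro i v hv
      simp only [P, Q, mem_filter, mem_univ, true_and] at hv ⊢
      linarith [hθ.2]
    have := numC ζ N hζ hN' (fun i => ((P i).card : ℝ)) (fun i => ((Q i).card : ℝ))
      (fun i => by positivity) (fun i => by exact_mod_cast card_le_card (hPQ i))
      (fun i => by
        have := card_le_univ (Q i)
        simp at this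
        exact_mod_cast this)
      (by
        intro i j hij
        have h1 := h i j hij
        have hun := card_union_add_card_inter (P i ×ˢ Q j) (Q i ×ˢ P j)
        have hIntg : (P i ×ˢ Q j) ∩ (Q i ×ˢ P j) = P i ×ˢ P j := by
          ext ⟨a, b⟩
          simp only [mem_inter, mem_product]
          have := @hPQ i a
          have := @hPQ j b
          tauto
        have hdis : Disjoint ((P i ×ˢ Q j) ∪ (Q i ×ˢ P j))
            (univ.filter (fun x : Fin N × Fin N => 1 ≤ f i x.1 + f j x.2)) := by
          rw [Finset.disjoint_left]
          rintro ⟨a, b⟩ hab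
          simp only [P, Q, mem_union, mem_product, mem_filter, mem_univ, true_and] at hab ⊢
          rcases hab with ⟨h, h'⟩ | ⟨h, h'⟩ <;> linarith
        have htot := card_le_univ (((P i ×ˢ Q j) ∪ (Q i ×ˢ P j)) ∪
            (univ.filter (fun x : Fin N × Fin N => 1 ≤ f i x.1 + f j x.2)))
        rw [card_union_of_disjoint hdis] at htot
        rw [hIntg] at hun
        simp only [card_product, Fintype.card_prod, Fintype.card_fin] at hun htot
        have hun' : (((P i ×ˢ Q j) ∪ (Q i ×ˢ P j)).card : ℝ) + (P i).card * (P j).card =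
          (P i).card * (Q j).card + (Q i).card * (P j).card := by exact_mod_cast hun
        have htot' : (((P i ×ˢ Q j) ∪ (Q i ×ˢ P j)).card : ℝ) +
          (univ.filter (fun x : Fin N × Fin N => 1 ≤ f i x.1 + f j x.2)).card ≤ N * N := by
            exact_mod_cast htot
        nlinarith)
    convert this using 2 with i
    rw [sum_add_distrib]
    congr 1
    · simp [P, Set.indicator_apply]
    · simp [Q, Set.indicator_apply]
  have hIntg : ∀ i v, Integrable (fun θ => ((Set.Ioi (f i v)).indicator (fun _ => (1:ℝ)) θ
      + (Set.Iic (1 - f i v)).indicator (fun _ => (1:ℝ)) θ))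
      (volume.restrict (Set.Ioc (0:ℝ) (1/2))) := fun i v =>
    ((integrable_const 1).indicator measurableSet_Ioi).add
      ((integrable_const 1).indicator measurableSet_Iic)
  have hI : ∫ θ in Set.Ioc (0:ℝ) (1/2), ∑ i, ∑ v, ((Set.Ioi (f i v)).indicator (fun _ => (1:ℝ)) θ
      + (Set.Iic (1 - f i v)).indicator (fun _ => (1:ℝ)) θ) ≤
      ∫ θ in Set.Ioc (0:ℝ) (1/2), (4 + 2 * ζ) * (N:ℝ) := by
    apply setIntegral_mono_on
    · exact integrable_finsetSum _ (fun i _ => integrable_finsetSum _ (fun v _ => hIntg i v))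
    · exact integrable_const _
    · exact measurableSet_Ioc
    · exact pt
  rw [integral_finsetSum _ (fun i _ => integrable_finsetSum _ (fun v _ => hIntg i v))] at hI
  simp_rw [fun i => integral_finsetSum univ (fun v _ => hIntg i v)] at hI
  have hL : ∑ i : Fin 3, ∑ v : Fin N, (1 - f i v) ≤ _ := 
    (sum_le_sum fun i _ => sum_le_sum fun v _ => intg (f i v) (hf i v)).trans hI
  simp only [integral_const, smul_eq_mul, measureReal_restrict_apply_univ,
      Real.volume_real_Ioc, sum_sub_distrib, sum_const, card_univ, Fintype.card_fin, nsmul_eq_mul] at hL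
  rw [max_eq_left (by norm_num)] at hL
  norm_num at hL
  linarith

lemma duality {ν κ : Type} [Fintype ν] [DecidableEq ν] (R : Finset κ) (vec : κ → ν → ℝ) (c : ℝ)
    (hc : 0 < c)
    (h : ∀ f : ν → ℝ, (∀ v, 0 ≤ f v) → (∀ q ∈ R, 1 ≤ ∑ v, f v * vec q v) → c ≤ ∑ v, f v) :
    ∃ (ι : Type) (_ : Fintype ι) (z : ι → κ) (w : ι → ℝ), Fintype.card ι ≤ Fintype.card ν + 1 ∧
      (∀ a, z a ∈ R) ∧ (∀ a, 0 ≤ w a) ∧ (∀ v, ∑ a, w a * vec (z a) v ≤ 1) ∧ c ≤ ∑ a, w a := by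
  classical
  set K : Set (ν → ℝ) := convexHull ℝ (Set.image vec R) with hK
  have hRne : R.Nonempty := by
    by_contra hR
    rw [not_nonempty_iff_eq_empty] at hR
    have := h 0 (fun _ => le_rfl) (by simp [hR])
    simp at this
    linarith
  by_cases hex : ∃ y ∈ K, ∀ v, y v ≤ 1 / c
  · obtain ⟨y, hy, hyv⟩ := hex
    obtain ⟨ι, hι, z, w, hz, hai, hw, hw1, hwz⟩ := eq_pos_convex_span_of_mem_convexHull hy
    have hz' : ∀ a, ∃ q ∈ R, vec q = z a := fun a => hz ⟨a, rfl⟩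
    choose g hg hgz using hz'
    have hcard := hai.card_le_finrank_succ
    have hfin : Module.finrank ℝ (vectorSpan ℝ (Set.range z)) ≤ Fintype.card ν := by
      have := Submodule.finrank_le (vectorSpan ℝ (Set.range z))
      simpa using this
    have hcard' : Fintype.card ι ≤ Fintype.card ν + 1 := by omega
    refine ⟨Fin (Fintype.card ι), inferInstance, fun a => g ((Fintype.equivFin ι).symm a),
      fun a => c * w ((Fintype.equivFin ι).symm a), by simpa using hcard', fun a => hg _,
      fun a => by have := hw ((Fintype.equivFin ι).symm a); positivity, ?_, ?_⟩
    · intro v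
      rw [Equiv.sum_comp (Fintype.equivFin ι).symm (fun a => c * w a * vec (g a) v)]
      have := hyv v
      rw [← hwz] at this
      simp only [Finset.sum_apply, Pi.smul_apply, smul_eq_mul] at this
      rw [le_div_iff₀ hc] at this
      calc _ = (∑ i, w i * z i v) * c := by
            rw [sum_mul]; apply sum_congr rfl; intro a _; rw [hgz]; ring
        _ ≤ 1 := this
    · rw [Equiv.sum_comp (Fintype.equivFin ι).symm (fun a => c * w a), ← mul_sum, hw1, mul_one]
  · exfalso
    push Not at hex
    set D : Set (ν → ℝ) := {y | ∀ v, y v ≤ 1 / c} with hD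
    have hDc : IsClosed D := by
      have : D = Set.Iic (fun _ => 1 / c) := by ext y; simp [hD, Pi.le_def]
      rw [this]; exact isClosed_Iic
    have hDconv : Convex ℝ D := by
      have : D = Set.Iic (fun _ => 1 / c) := by ext y; simp [hD, Pi.le_def]
      rw [this]; exact convex_Iic _
    have hKc : IsCompact K := (R.finite_toSet.image vec).isCompact_convexHull ℝ
    have hdisj : Disjoint K D := by
      rw [Set.disjoint_left]
      intro y hy hyD
      obtain ⟨v, hv⟩ := hex y hy
      exact absurd (hyD v) (not_le.mpr hv)
    obtain ⟨l, u, v, hlu, huv, hlv⟩ :=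
      geometric_hahn_banach_compact_closed (convex_convexHull ℝ _) hKc hDconv hDc hdisj
    -- l small on K, large on D
    set F : ν → ℝ := fun x => - l (Pi.single x 1) with hF
    have hl : ∀ y : ν → ℝ, l y = - ∑ x, F x * y x := by
      intro y
      have h1 : y = ∑ x, y x • (Pi.single x (1:ℝ) : ν → ℝ) := by
        ext a; simp [Finset.sum_apply, Pi.single_apply]
      conv_lhs => rw [h1]
      rw [map_sum, ← sum_neg_distrib]
      apply sum_congr rfl
      intro x _
      rw [map_smul, smul_eq_mul, hF]; ring
    have hFn : ∀ x, 0 ≤ F x := by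
      intro x
      by_contra hx
      push Not at hx
      -- y = const 1/c - M * single x
      have hy : ∀ M : ℝ, 0 ≤ M → v < l ((fun _ => 1 / c) - M • Pi.single x (1:ℝ)) := by
        intro M hM
        apply hlv
        intro a
        simp only [Pi.sub_apply, Pi.smul_apply, smul_eq_mul]
        by_cases hax : a = x
        · subst hax; simp; exact hM
        · simp [hax]
      have e : ∀ M : ℝ, l ((fun _ => 1 / c) - M • Pi.single x (1:ℝ)) =
          l (fun _ => 1 / c) + M * F x := by
        intro M
        rw [map_sub, map_smul, smul_eq_mul, hF]; ring
      have h0 := hy 0 le_rfl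
      rw [e] at h0
      simp at h0
      have h2 := hy ((l (fun _ => 1 / c) - v) / (- F x)) (by
        apply div_nonneg <;> simp at * <;> linarith)
      rw [e] at h2
      have : (l (fun _ => 1 / c) - v) / (- F x) * F x = -(l (fun _ => 1 / c) - v) := by
        rw [div_neg, neg_mul, div_mul_cancel₀ _ hx.ne]
      linarith
    have hcon := hlv (fun _ => 1 / c) (fun _ => le_rfl)
    rw [hl, ← sum_mul] at hcon
    -- Σ F /c < -v ; on edges Σ F vec > -u
    have hedge : ∀ q ∈ R, -u < ∑ x, F x * vec q x := by
      intro q hq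
      have := hlu (vec q) (subset_convexHull ℝ _ ⟨q, hq, rfl⟩)
      rw [hl] at this; linarith
    have hFs : 0 ≤ ∑ x, F x := sum_nonneg fun x _ => hFn x
    have hu : 0 < -u := by
      have : 0 ≤ (∑ x, F x) * (1 / c) := by positivity
      linarith
    have := h (fun x => F x / (-u)) (fun x => div_nonneg (hFn x) hu.le) (by
      intro q hq
      have := hedge q hq
      have e : ∑ x, F x / (-u) * vec q x = (∑ x, F x * vec q x) / (-u) := by
        rw [sum_div]; apply sum_congr rfl; intro x _; ring
      rw [e, le_div_iff₀ hu]; linarith)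
    rw [← sum_div, le_div_iff₀ hu] at this
    have h3 : (∑ x, F x) * (1 / c) * c = ∑ x, F x := by field_simp
    nlinarith

end Aux

namespace Aux

def DegCond (κ : ℝ) (n : ℕ) (E : Finset (Fin 4 → Fin n)) : Prop :=
  ∀ i : Fin 4, i ≠ 0 → ∀ x y : Fin n,
    κ * (n:ℝ) ^ 2 ≤ ((E.filter (fun q => q 0 = x ∧ q i = y)).card : ℝ)

lemma third (i j : Fin 3) (hij : i ≠ j) : ∃ k : Fin 3,
    (∀ l : Fin 4, l = 0 ∨ l = k.succ ∨ l = i.succ ∨ l = j.succ) ∧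
    ∀ F : Fin 4 → ℝ, ∑ l, F l = F 0 + F k.succ + F i.succ + F j.succ := by
  have : ∃ k : Fin 3, (∀ l : Fin 4, l = 0 ∨ l = k.succ ∨ l = i.succ ∨ l = j.succ) ∧
      (univ : Finset (Fin 4)) = {0, k.succ, i.succ, j.succ} ∧ k.succ ≠ i.succ ∧
      k.succ ≠ j.succ ∧ i.succ ≠ j.succ := by
    revert i j; decide
  obtain ⟨k, h1, h2, h3, h4, h5⟩ := this
  refine ⟨k, h1, fun F => ?_⟩
  rw [h2, sum_insert, sum_insert, sum_insert, sum_singleton]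
  · ring
  · simpa using h5
  · simp only [mem_insert, mem_singleton]; tauto
  · simp only [mem_insert, mem_singleton]
    rintro (h | h | h) <;> exact absurd h.symm (Fin.succ_ne_zero _)

lemma coverbound (ζ : ℝ) (hζ : 0 < ζ) (N : ℕ) (hN : 0 < N) (R : Finset (Fin 4 → Fin N))
    (hR : DegCond (5 / 9 - 4 / 9 * ζ) N R) (f : Fin 4 → Fin N → ℝ) (hf : ∀ i v, 0 ≤ f i v)
    (hc : ∀ q ∈ R, 1 ≤ ∑ i, f i (q i)) : (1 - ζ) * N ≤ ∑ i, ∑ v, f i v := by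
  have : Nonempty (Fin N) := ⟨⟨0, hN⟩⟩
  have hmin : ∀ i, ∃ x, ∀ v, f i x ≤ f i v := fun i => Finite.exists_min (f i)
  choose x hx using hmin
  set S := ∑ i, f i (x i) with hS
  have hN' : (0:ℝ) < N := by exact_mod_cast hN
  have hlow : N * S ≤ ∑ i, ∑ v, f i v := by
    rw [hS, mul_sum]
    apply sum_le_sum
    intro i _
    calc (N:ℝ) * f i (x i) = ∑ v : Fin N, f i (x i) := by simp
      _ ≤ _ := sum_le_sum fun v _ => hx i v
  by_cases h1 : 1 ≤ S
  · nlinarith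
  push Not at h1
  have h1' : 0 < 1 - S := by linarith
  have key := threefun ζ hζ N hN (fun i v => (f i.succ v - f i.succ (x i.succ)) / (1 - S))
    (fun i v => div_nonneg (by linarith [hx i.succ v]) h1'.le) (by
      intro i j hij
      obtain ⟨k, hk, hsum⟩ := third i j hij
      refine (hR k.succ (Fin.succ_ne_zero _) (x 0) (x k.succ)).trans ?_
      norm_cast
      apply card_le_card_of_injOn (fun q => (q i.succ, q j.succ))
      · intro q hq
        simp only [coe_filter, Set.mem_ofPred_eq, mem_univ, true_and] at hq ⊢
        obtain ⟨hqR, hq0, hqk⟩ := hq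
        have h2 := hc q hqR
        rw [hsum, hq0, hqk] at h2
        rw [hsum] at hS
        rw [← add_div, le_div_iff₀ h1']
        linarith
      · intro q hq q' hq' he
        simp only [coe_filter, Set.mem_ofPred_eq] at hq hq'
        simp only [Prod.mk.injEq] at he
        ext l
        rcases hk l with h | h | h | h
        · rw [h, hq.2.1, hq'.2.1]
        · rw [h, hq.2.2, hq'.2.2]
        · rw [h, he.1]
        · rw [h, he.2])
  simp_rw [← sum_div, sum_sub_distrib] at key
  rw [le_div_iff₀ h1'] at key
  simp only [sum_const, card_univ, Fintype.card_fin, nsmul_eq_mul] at key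
  rw [← mul_sum] at key
  have e1 : S = f 0 (x 0) + ∑ i : Fin 3, f i.succ (x i.succ) := by
    rw [hS, Fin.sum_univ_succ]
  rw [Fin.sum_univ_succ]
  have e2 : N * f 0 (x 0) ≤ ∑ v, f 0 v := by
    calc (N:ℝ) * f 0 (x 0) = ∑ v : Fin N, f 0 (x 0) := by simp
      _ ≤ _ := sum_le_sum fun v _ => hx 0 v
  have hS0 : 0 ≤ S := sum_nonneg fun i _ => hf _ _
  have e3 : N * S = N * f 0 (x 0) + N * ∑ i : Fin 3, f i.succ (x i.succ) := by rw [e1]; ring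
  have e4 : 0 ≤ ζ * (N * S) := by positivity
  nlinarith

lemma fracmatch (ζ : ℝ) (hζ : 0 < ζ) (hζ1 : ζ < 1) (N : ℕ) (hN : 0 < N)
    (R : Finset (Fin 4 → Fin N)) (hR : DegCond (5 / 9 - 4 / 9 * ζ) N R) :
    ∃ (ι : Type) (_ : Fintype ι) (z : ι → Fin 4 → Fin N) (w : ι → ℝ),
      Fintype.card ι ≤ 4 * N + 1 ∧
      (∀ a, z a ∈ R) ∧ (∀ a, 0 ≤ w a) ∧
      (∀ i j, ∑ a, w a * (if z a i = j then 1 else 0) ≤ 1) ∧ (1 - ζ) * N ≤ ∑ a, w a := by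
  have hN' : (0:ℝ) < N := by exact_mod_cast hN
  obtain ⟨ι, hι, z, w, h1, h2, h3, h4, h5⟩ := duality (ν := Fin 4 × Fin N) R
    (fun q v => if q v.1 = v.2 then 1 else 0) ((1 - ζ) * N) (by nlinarith) (by
      intro f hf hq
      have := coverbound ζ hζ N hN R hR (fun i v => f (i, v)) (fun i v => hf _) (by
        intro q hqR
        have := hq q hqR
        rw [Fintype.sum_prod_type] at this
        simpa using this)
      rw [Fintype.sum_prod_type]
      exact this)
  refine ⟨ι, hι, z, w, by simpa using h1, h2, h3, fun i j => h4 (i, j), h5⟩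

/-! box lemma -/

lemma topsub {X : Type} [DecidableEq X] (A : Finset X) (d : X → ℝ) (c : ℝ) (m : ℕ) (hm : m ≤ A.card)
    (h : c * A.card ≤ ∑ x ∈ A, d x) : ∃ A' ⊆ A, A'.card = m ∧ c * m ≤ ∑ x ∈ A', d x := by
  induction' hk : A.card - m with k ih generalizing A
  · have : A.card = m := by omega
    exact ⟨A, Subset.rfl, this, by rw [← this]; exact h⟩
  · have hne : A.Nonempty := by rw [← card_pos]; omega
    obtain ⟨x, hxA, hx⟩ := exists_min_image A d hne
    have hsum : (A.card : ℝ) * d x ≤ ∑ y ∈ A, d y := by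
      rw [← nsmul_eq_mul]; exact card_nsmul_le_sum _ _ _ hx
    have hcard : (A.erase x).card = A.card - 1 := card_erase_of_mem hxA
    have hpos : 1 ≤ A.card := card_pos.mpr hne
    have hcr : ((A.erase x).card : ℝ) = A.card - 1 := by rw [hcard]; push_cast [hpos]; ring
    have herase : ∑ y ∈ A.erase x, d y = ∑ y ∈ A, d y - d x := by
      rw [← sum_erase_add _ _ hxA]; ring
    have hp : (1:ℝ) ≤ A.card := by exact_mod_cast hpos
    obtain ⟨A', h1, h2, h3⟩ := ih (A.erase x) (by omega) (by
      rw [herase, hcr]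
      rcases le_total c (d x) with hc | hc
      · rcases le_total (d x) 0 with _ | _ <;> nlinarith
      · nlinarith) (by omega)
    exact ⟨A', h1.trans (erase_subset _ _), h2, h3⟩

lemma pig (β : ℝ) (hβ : 0 < β) (s : ℕ) : ∃ m : ℕ, ∃ β' : ℝ, 0 < β' ∧
    ∀ (X Y : Type) [DecidableEq X] [DecidableEq Y] (A : Finset X) (B : Finset Y)
      (G : Finset (X × Y)), G ⊆ A ×ˢ B → m ≤ A.card → β * (A.card * B.card) ≤ (G.card : ℝ) →
      ∃ S ⊆ A, S.card = s ∧ ∃ B' ⊆ B, β' * B.card ≤ (B'.card : ℝ) ∧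
        ∀ x ∈ S, ∀ y ∈ B', (x, y) ∈ G := by
  obtain ⟨m0, hm0⟩ := exists_nat_ge (2 * s / β)
  set m := m0 + s with hmdef
  have hm : (s:ℝ) ≤ β / 2 * m := by
    rw [div_le_iff₀ hβ] at hm0
    have : (m:ℝ) = m0 + s := by rw [hmdef]; push_cast; ring
    have : 0 ≤ β * (s:ℝ) := by positivity
    nlinarith
  refine ⟨m + 1, β / 2 / ((m + 1 : ℕ) * 2 ^ (m + 1)), by positivity, ?_⟩
  intro X Y _ _ A B G hG hA hd
  set M := m + 1 with hM
  have hGsum : ∀ A' ⊆ A, ((G.filter (fun g => g.1 ∈ A')).card : ℝ) =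
      ∑ x ∈ A', ((B.filter (fun y => (x, y) ∈ G)).card : ℝ) := by
    intro A' hA'
    rw [card_eq_sum_card_fiberwise (f := Prod.fst) (t := A')]
    · push_cast
      apply sum_congr rfl
      intro x hx
      norm_cast
      symm
      apply card_bij (fun y _ => (x, y))
      · intro y hy
        simp only [mem_filter] at hy ⊢
        exact ⟨⟨hy.2, hx⟩, trivial⟩
      · intro y _ y' _ h
        simpa using h
      · rintro ⟨a, b⟩ hab
        simp only [mem_filter] at hab
        obtain ⟨⟨h1, h2⟩, rfl⟩ := hab
        exact ⟨b, by simp [h1, (mem_product.mp (hG h1)).2], rfl⟩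
    · intro g hg
      simp only [coe_filter, Set.mem_ofPred_eq] at hg
      exact hg.2
  obtain ⟨A', hA', hcA', hsA'⟩ := topsub A
    (fun x => ((B.filter (fun y => (x, y) ∈ G)).card : ℝ)) (β * B.card) M hA (by
      rw [← hGsum A Subset.rfl, filter_true_of_mem (fun g hg => (mem_product.mp (hG hg)).1)]
      calc _ = _ := by ring
        _ ≤ _ := hd)
  have hswap : ∑ x ∈ A', ((B.filter (fun y => (x, y) ∈ G)).card : ℝ) =
      ∑ y ∈ B, ((A'.filter (fun x => (x, y) ∈ G)).card : ℝ) := by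
    simp only [card_filter]
    push_cast
    exact sum_comm
  set B1 := B.filter (fun y => s ≤ (A'.filter (fun x => (x, y) ∈ G)).card) with hB1
  have hup : ∑ y ∈ B, ((A'.filter (fun x => (x, y) ∈ G)).card : ℝ) ≤ M * B1.card + s * B.card := by
    have : ∀ y ∈ B, ((A'.filter (fun x => (x, y) ∈ G)).card : ℝ) ≤
        M * (if s ≤ (A'.filter (fun x => (x, y) ∈ G)).card then 1 else 0) + s := by
      intro y _
      split_ifs with h
      · have := card_filter_le A' (fun x => (x, y) ∈ G)
        rw [hcA'] at this
        have : ((A'.filter (fun x => (x, y) ∈ G)).card : ℝ) ≤ M := by exact_mod_cast this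
        have : (0:ℝ) ≤ s := by positivity
        linarith
      · push Not at h
        have : ((A'.filter (fun x => (x, y) ∈ G)).card : ℝ) ≤ s := by exact_mod_cast h.le
        linarith
    refine (sum_le_sum this).trans (le_of_eq ?_)
    rw [sum_add_distrib, ← mul_sum, hB1]
    simp [mul_comm]
  have hB1c : β / 2 * B.card ≤ M * (B1.card : ℝ) := by
    rw [hswap] at hsA'
    have h1 := hsA'.trans hup
    have hMm : (M:ℝ) = m + 1 := by rw [hM]; push_cast; ring
    have hb : (0:ℝ) ≤ B.card := by positivity
    have hs' : (s:ℝ) * B.card ≤ β / 2 * m * B.card := mul_le_mul_of_nonneg_right hm hb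
    have hM1 : (1:ℝ) ≤ M := by rw [hMm]; have : (0:ℝ) ≤ m := by positivity
                               linarith
    have hX : β * B.card ≤ β * B.card * M := le_mul_of_one_le_right (by positivity) hM1
    have h5 : β / 2 * m * B.card ≤ β / 2 * M * B.card := by
      rw [hMm]; have : 0 ≤ β * (B.card:ℝ) := by positivity
      nlinarith
    nlinarith
  have hcov : B1 ⊆ (A'.powersetCard s).biUnion
      (fun S => B.filter (fun y => ∀ x ∈ S, (x, y) ∈ G)) := by
    intro y hy
    simp only [hB1, mem_filter] at hy
    obtain ⟨S, hS, hSc⟩ := exists_subset_card_eq hy.2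
    simp only [mem_biUnion, mem_powersetCard, mem_filter]
    refine ⟨S, ⟨hS.trans (filter_subset _ _), hSc⟩, hy.1, fun x hx => (mem_filter.mp (hS hx)).2⟩
  have hle : (B1.card : ℝ) ≤ ∑ S ∈ A'.powersetCard s,
      ((B.filter (fun y => ∀ x ∈ S, (x, y) ∈ G)).card : ℝ) := by
    exact_mod_cast (card_le_card hcov).trans card_biUnion_le
  by_contra hcon
  push Not at hcon
  have hne : (A'.powersetCard s).Nonempty := by
    apply powersetCard_nonempty.mpr; omega
  have hlt : ∑ S ∈ A'.powersetCard s, ((B.filter (fun y => ∀ x ∈ S, (x, y) ∈ G)).card : ℝ) <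
      ∑ S ∈ A'.powersetCard s, (β / 2 / ((M : ℕ) * 2 ^ M)) * (B.card : ℝ) := by
    apply sum_lt_sum_of_nonempty hne
    intro S hS
    rw [mem_powersetCard] at hS
    by_contra hge
    push Not at hge
    obtain ⟨x, hx, y, hy, hxy⟩ := hcon S (hS.1.trans hA') hS.2
      (B.filter (fun y => ∀ x ∈ S, (x, y) ∈ G)) (filter_subset _ _) hge
    exact hxy ((mem_filter.mp hy).2 x hx)
  rw [sum_const, card_powersetCard, nsmul_eq_mul, hcA'] at hlt
  have hch : ((M.choose s : ℕ) : ℝ) ≤ 2 ^ M := by exact_mod_cast Nat.choose_le_two_pow M s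
  have hMpos : (0:ℝ) < M := by rw [hM]; positivity
  have h7 : (M.choose s : ℝ) * (β / 2 / (M * 2 ^ M) * B.card) ≤ 
      2 ^ M * (β / 2 / (M * 2 ^ M) * B.card) :=
    mul_le_mul_of_nonneg_right hch (by positivity)
  have h8 : 2 ^ M * (β / 2 / (M * 2 ^ M) * B.card) * M = β / 2 * (B.card:ℝ) := by
    field_simp
  have h9 : (B1.card:ℝ) < 2 ^ M * (β / 2 / (M * 2 ^ M) * B.card) := by linarith
  have h10 := mul_lt_mul_of_pos_right h9 hMpos
  rw [h8] at h10
  linarith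

lemma box (β : ℝ) (hβ : 0 < β) (s : ℕ) : ∃ T : ℕ, ∀ (n : ℕ) (E : Finset (Fin 4 → Fin n))
    (D : Fin 4 → Finset (Fin n)), (∀ i, T ≤ (D i).card) →
    β * (((D 0).card : ℝ) * (D 1).card * (D 2).card * (D 3).card) ≤
      ((E ∩ Fintype.piFinset D).card : ℝ) →
    ∃ B : Fin 4 → Finset (Fin n), (∀ i, B i ⊆ D i) ∧ (∀ i, (B i).card = s) ∧
      ∀ q : Fin 4 → Fin n, (∀ i, q i ∈ B i) → q ∈ E := by
  obtain ⟨m1, β1, hβ1, H1⟩ := pig β hβ s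
  obtain ⟨m2, β2, hβ2, H2⟩ := pig β1 hβ1 s
  obtain ⟨m3, β3, hβ3, H3⟩ := pig β2 hβ2 s
  obtain ⟨m4, hm4⟩ := exists_nat_ge (s / β3)
  refine ⟨m1 + m2 + m3 + m4, fun n E D hT hd => ?_⟩
  let φ : (Fin 4 → Fin n) → Fin n × Fin n × Fin n × Fin n := fun q => (q 0, q 1, q 2, q 3)
  have hφ : Function.Injective φ := by
    intro q q' h
    simp only [φ, Prod.mk.injEq] at h
    ext l
    fin_cases l
    · exact congrArg _ h.1
    · exact congrArg _ h.2.1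
    · exact congrArg _ h.2.2.1
    · exact congrArg _ h.2.2.2
  obtain ⟨S0, hS0, cS0, Y1, hY1, cY1, h1⟩ := H1 (Fin n) (Fin n × Fin n × Fin n) (D 0)
    (D 1 ×ˢ D 2 ×ˢ D 3) ((E ∩ Fintype.piFinset D).image φ) (by
      intro g hg
      simp only [mem_image, mem_inter, Fintype.mem_piFinset] at hg
      obtain ⟨q, ⟨_, hq⟩, rfl⟩ := hg
      simp [φ, hq]) (by have := hT 0; omega) (by
      rw [card_image_of_injective _ hφ]
      refine le_trans (le_of_eq ?_) hd
      simp only [card_product]; push_cast; ring)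
  obtain ⟨S1, hS1, cS1, Y2, hY2, cY2, h2⟩ := H2 (Fin n) (Fin n × Fin n) (D 1)
    (D 2 ×ˢ D 3) Y1 hY1 (by have := hT 1; omega) (by
      rw [card_product] at cY1; exact_mod_cast cY1)
  obtain ⟨S2, hS2, cS2, Y3, hY3, cY3, h3⟩ := H3 (Fin n) (Fin n) (D 2)
    (D 3) Y2 hY2 (by have := hT 2; omega) (by
      rw [card_product] at cY2; exact_mod_cast cY2)
  have hs : s ≤ Y3.card := by
    rw [div_le_iff₀ hβ3] at hm4
    have : (m4:ℝ) ≤ (D 3).card := by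
      have := hT 3
      exact_mod_cast (by omega : m4 ≤ (D 3).card)
    have : (s:ℝ) ≤ Y3.card := by nlinarith
    exact_mod_cast this
  obtain ⟨S3, hS3, cS3⟩ := exists_subset_card_eq hs
  refine ⟨![S0, S1, S2, S3], ?_, ?_, ?_⟩
  · intro i; fin_cases i
    · exact hS0
    · exact hS1
    · exact hS2
    · exact hS3.trans hY3
  · intro i; fin_cases i
    · exact cS0
    · exact cS1
    · exact cS2
    · exact cS3
  · intro q hq
    have q0 : q 0 ∈ S0 := hq 0
    have q1 : q 1 ∈ S1 := hq 1
    have q2 : q 2 ∈ S2 := hq 2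
    have q3 : q 3 ∈ S3 := hq 3
    have := h1 _ q0 _ (h2 _ q1 _ (h3 _ q2 _ (hS3 q3)))
    rw [mem_image] at this
    obtain ⟨q', hq', he⟩ := this
    have : q' = q := hφ he
    rw [← this]
    exact (mem_inter.mp hq').1

end Aux

namespace Aux

structure Fam (n s k : ℕ) (E : Finset (Fin 4 → Fin n)) (C : Fin 4 → ℕ → Finset (Fin n)) : Prop where
  card : ∀ i j, j < k → (C i j).card = s
  disj : ∀ i j j', j < k → j' < k → j ≠ j' → Disjoint (C i j) (C i j')
  edge : ∀ j, j < k → ∀ q : Fin 4 → Fin n, (∀ i, q i ∈ C i j) → q ∈ E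

lemma card_used {n t k : ℕ} (C : ℕ → Finset (Fin n))
    (hc : ∀ j, j < k → (C j).card = t) (hd : ∀ j j', j < k → j' < k → j ≠ j' → Disjoint (C j) (C j')) :
    ((range k).biUnion C).card = k * t := by
  rw [card_biUnion]
  · rw [sum_congr rfl (fun j hj => hc j (mem_range.mp hj))]
    simp
  · intro j hj j' hj' hne
    exact hd j j' (by simpa using hj) (by simpa using hj') hne

lemma extcl (n t k : ℕ) (C : ℕ → Finset (Fin n))
    (hc : ∀ j, j < k → (C j).card = t) (hd : ∀ j j', j < k → j' < k → j ≠ j' → Disjoint (C j) (C j'))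
    (N : ℕ) (hk : k ≤ N) (hN : N * t ≤ n) :
    ∃ C' : ℕ → Finset (Fin n), (∀ j, j < k → C' j = C j) ∧ (∀ j, j < N → (C' j).card = t) ∧
      (∀ j j', j < N → j' < N → j ≠ j' → Disjoint (C' j) (C' j')) := by
  induction N, hk using Nat.le_induction with
  | base => exact ⟨C, fun _ _ => rfl, hc, hd⟩
  | succ N hkN ih =>
    obtain ⟨C', h1, h2, h3⟩ := ih (by nlinarith)
    have hcard := card_used C' h2 h3
    have : t ≤ (univ \ (range N).biUnion C').card := by
      rw [card_sdiff_of_subset (subset_univ _), hcard]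
      simp
      have : (N + 1) * t = N * t + t := by ring
      omega
    obtain ⟨S, hS, hSc⟩ := exists_subset_card_eq this
    have hSd : ∀ j, j < N → Disjoint S (C' j) := by
      intro j hj
      rw [Finset.disjoint_left]
      intro x hx hx'
      have := hS hx
      simp only [mem_sdiff, mem_biUnion, mem_range, not_exists, not_and] at this
      exact this.2 j hj hx'
    refine ⟨Function.update C' N S, ?_, ?_, ?_⟩
    · intro j hj
      rw [Function.update_of_ne (by omega)]; exact h1 j hj
    · intro j hj
      by_cases h : j = N
      · subst h; simpa using hSc
      · rw [Function.update_of_ne h]; exact h2 j (by omega)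
    · intro j j' hj hj' hne
      by_cases h : j = N
      · subst h
        rw [Function.update_self, Function.update_of_ne hne.symm]
        exact hSd j' (by omega)
      · by_cases h' : j' = N
        · subst h'
          rw [Function.update_self, Function.update_of_ne hne]
          exact (hSd j (by omega)).symm
        · rw [Function.update_of_ne h, Function.update_of_ne h']
          exact h3 j j' (by omega) (by omega) hne

def Good (n s t u N : ℕ) (E : Finset (Fin 4 → Fin n)) (Cl : Fin 4 → Fin N → Finset (Fin n))
    (q : Fin 4 → Fin N) : Prop :=
  ∀ D : Fin 4 → Finset (Fin n), (∀ i, D i ⊆ Cl i (q i)) → (∀ i, t ≤ (D i).card + u) →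
    ∃ B : Fin 4 → Finset (Fin n), (∀ i, B i ⊆ D i) ∧ (∀ i, (B i).card = s) ∧
      ∀ p : Fin 4 → Fin n, (∀ i, p i ∈ B i) → p ∈ E

lemma greedy (n s t u N : ℕ) (E : Finset (Fin 4 → Fin n)) (Cl : Fin 4 → Fin N → Finset (Fin n))
    (hcard : ∀ i j, (Cl i j).card = t) (hdisj : ∀ i j j', j ≠ j' → Disjoint (Cl i j) (Cl i j'))
    (k : ℕ) (C : Fin 4 → ℕ → Finset (Fin n)) (ℓ : Fin 4 → Fin N → ℕ) (hF : Fam n s k E C)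
    (hℓ : ∀ i j, (Cl i j ∩ (range k).biUnion (C i)).card ≤ ℓ i j)
    (L : Multiset (Fin 4 → Fin N)) (hgood : ∀ q ∈ L, Good n s t u N E Cl q)
    (hL : ∀ i j, ℓ i j + s * L.countP (fun q => q i = j) ≤ u + s) :
    ∃ C' : Fin 4 → ℕ → Finset (Fin n), Fam n s (k + Multiset.card L) E C' ∧
      ∀ i j, (Cl i j ∩ (range (k + Multiset.card L)).biUnion (C' i)).card ≤
        ℓ i j + s * L.countP (fun q => q i = j) := by
  induction L using Multiset.induction_on with
  | empty => exact ⟨C, by simpa using hF, by simpa using hℓ⟩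
  | cons q L ih =>
    obtain ⟨C', hF', hload⟩ := ih (fun q' hq' => hgood q' (Multiset.mem_cons_of_mem hq')) (by
      intro i j
      refine le_trans ?_ (hL i j)
      gcongr
      exact Multiset.le_cons_self _ _)
    set K := k + Multiset.card L with hK
    have hu : ∀ i, (Cl i (q i) ∩ (range K).biUnion (C' i)).card ≤ u := by
      intro i
      have h1 := hload i (q i)
      have h2 := hL i (q i)
      rw [Multiset.countP_cons_of_pos (p := fun q' : Fin 4 → Fin N => q' i = q i) _ (rfl : q i = q i),
        Nat.mul_add] at h2
      omega
    obtain ⟨B, hB1, hB2, hB3⟩ := hgood q (Multiset.mem_cons_self _ _)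
      (fun i => Cl i (q i) \ (range K).biUnion (C' i)) (fun i => sdiff_subset) (by
        intro i
        have h1 := card_sdiff_add_card_inter (Cl i (q i)) ((range K).biUnion (C' i))
        rw [hcard] at h1
        have := hu i
        omega)
    have hBd : ∀ i j, j < K → Disjoint (B i) (C' i j) := by
      intro i j hj
      rw [Finset.disjoint_left]
      intro x hx hx'
      have := hB1 i hx
      simp only [mem_sdiff, mem_biUnion, mem_range, not_exists, not_and] at this
      exact this.2 j hj hx'
    have hK' : k + Multiset.card (q ::ₘ L) = K + 1 := by
      rw [Multiset.card_cons]; omega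
    rw [hK']
    have hU : ∀ i, (range (K + 1)).biUnion (Function.update (C' i) K (B i)) =
        B i ∪ (range K).biUnion (C' i) := by
      intro i
      rw [range_add_one, biUnion_insert, Function.update_self]
      congr 1
      apply biUnion_congr rfl
      intro j hj
      rw [Function.update_of_ne (by have := mem_range.mp hj; omega)]
    refine ⟨fun i => Function.update (C' i) K (B i), ⟨?_, ?_, ?_⟩, ?_⟩
    · intro i j hj
      by_cases h : j = K
      · subst h; simpa using hB2 i
      · simp only [Function.update_of_ne h]; exact hF'.card i j (by omega)
    · intro i j j' hj hj' hne
      by_cases h : j = K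
      · subst h
        simp only [Function.update_self, Function.update_of_ne hne.symm]
        exact hBd i j' (by omega)
      · by_cases h' : j' = K
        · subst h'
          simp only [Function.update_self, Function.update_of_ne hne]
          exact (hBd i j (by omega)).symm
        · simp only [Function.update_of_ne h, Function.update_of_ne h']
          exact hF'.disj i j j' (by omega) (by omega) hne
    · intro j hj p hp
      by_cases h : j = K
      · subst h
        exact hB3 p (fun i => by simpa using hp i)
      · exact hF'.edge j (by omega) p (fun i => by simpa [Function.update_of_ne h] using hp i)
    · intro i j
      rw [hU, inter_union_distrib_left]
      refine (card_union_le _ _).trans ?_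
      by_cases hj : q i = j
      · rw [Multiset.countP_cons_of_pos (p := fun q' : Fin 4 → Fin N => q' i = j) _ hj, Nat.mul_add]
        have h1 := hload i j
        have h2 : (Cl i j ∩ B i).card ≤ s := by
          rw [← hB2 i]; exact card_le_card inter_subset_right
        omega
      · rw [Multiset.countP_cons_of_neg (p := fun q' : Fin 4 → Fin N => q' i = j) _ hj]
        have h1 := hload i j
        have h2 : Cl i j ∩ B i = ∅ := by
          rw [← disjoint_iff_inter_eq_empty]
          apply Disjoint.mono_right _ (hdisj i j (q i) (Ne.symm hj))
          exact (hB1 i).trans sdiff_subset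
        rw [h2]; simpa using h1

lemma goodDiag (n s t N : ℕ) (hst : s ≤ t) (E : Finset (Fin 4 → Fin n))
    (Cl : Fin 4 → Fin N → Finset (Fin n)) (q : Fin 4 → Fin N)
    (h : ∀ p : Fin 4 → Fin n, (∀ i, p i ∈ Cl i (q i)) → p ∈ E) : Good n s t (t - s) N E Cl q := by
  intro D hD hc
  have : ∀ i, ∃ B ⊆ D i, B.card = s := fun i =>
    exists_subset_card_eq (by have := hc i; omega)
  choose B hB hBc using this
  exact ⟨B, hB, hBc, fun p hp => h p fun i => hD i (hB i (hp i))⟩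

lemma prod_one_special (j : Fin 4) (a c : ℕ) :
    ∏ l : Fin 4, (if l = j then a else c) = a * c ^ 3 := by
  fin_cases j <;> simp [Fin.prod_univ_four] <;> ring

lemma prod_two_special (i : Fin 4) (hi : i ≠ 0) (a b c : ℕ) :
    ∏ l : Fin 4, (if l = 0 then a else if l = i then b else c) = a * b * c ^ 2 := by
  fin_cases i
  · exact absurd rfl hi
  all_goals simp [Fin.prod_univ_four]; ring

lemma prod_three_special (i j : Fin 4) (hi : i ≠ 0) (hj : j ≠ 0) (hij : j ≠ i) (a b d c : ℕ) :
    ∏ l : Fin 4, (if l = 0 then a else if l = i then b else if l = j then d else c) =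
      a * b * d * c := by
  have key : ∀ i j : Fin 4, i ≠ 0 → j ≠ 0 → j ≠ i → ∃ m : Fin 4,
      (univ : Finset (Fin 4)) = {0, i, j, m} ∧ i ≠ m ∧ j ≠ m ∧ m ≠ 0 := by decide
  obtain ⟨m, hu, him, hjm, hm⟩ := key i j hi hj hij
  rw [hu, prod_insert (by simp [hi.symm, hj.symm, hm.symm]), prod_insert (by simp [hij.symm, him]),
    prod_insert (by simp [hjm]), prod_singleton]
  simp [hi, hj, hij, hm, him.symm, hjm.symm]
  ring

lemma cardJ : ∀ i : Fin 4, i ≠ 0 →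
    ((univ : Finset (Fin 4)).filter (fun j => j ≠ 0 ∧ j ≠ i)).card = 2 := by decide

lemma goodR (β : ℝ) (hβ : 0 < β) (n s t u N T : ℕ) (E : Finset (Fin 4 → Fin n))
    (Cl : Fin 4 → Fin N → Finset (Fin n)) (hcard : ∀ i j, (Cl i j).card = t) (q : Fin 4 → Fin N)
    (hT : ∀ (n : ℕ) (E : Finset (Fin 4 → Fin n))
    (D : Fin 4 → Finset (Fin n)), (∀ i, T ≤ (D i).card) →
    β / 2 * (((D 0).card : ℝ) * (D 1).card * (D 2).card * (D 3).card) ≤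
      ((E ∩ Fintype.piFinset D).card : ℝ) →
    ∃ B : Fin 4 → Finset (Fin n), (∀ i, B i ⊆ D i) ∧ (∀ i, (B i).card = s) ∧
      ∀ q : Fin 4 → Fin n, (∀ i, q i ∈ B i) → q ∈ E)
    (hu : (u:ℝ) ≤ β / 8 * t) (huT : T + u ≤ t)
    (hq : β * (t:ℝ) ^ 4 ≤ ((E ∩ Fintype.piFinset (fun i => Cl i (q i))).card : ℝ)) :
    Good n s t u N E Cl q := by
  intro D hD hc
  apply hT n E D (fun i => by have := hc i; omega)
  have hsub : E ∩ Fintype.piFinset (fun i => Cl i (q i)) ⊆ (E ∩ Fintype.piFinset D) ∪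
      (univ : Finset (Fin 4)).biUnion (fun j => Fintype.piFinset
        (fun l => if l = j then Cl l (q l) \ D l else Cl l (q l))) := by
    intro p hp
    simp only [mem_inter, Fintype.mem_piFinset, mem_union, mem_biUnion, mem_univ, true_and] at hp ⊢
    by_cases h : ∀ i, p i ∈ D i
    · exact Or.inl ⟨hp.1, h⟩
    · right
      push Not at h
      obtain ⟨j, hj⟩ := h
      refine ⟨j, fun l => ?_⟩
      split_ifs with hl
      · subst hl; exact mem_sdiff.mpr ⟨hp.2 _, hj⟩
      · exact hp.2 l
  have h1 := (card_le_card hsub).trans (card_union_le _ _)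
  have h2 : ((univ : Finset (Fin 4)).biUnion (fun j => Fintype.piFinset
        (fun l => if l = j then Cl l (q l) \ D l else Cl l (q l)))).card ≤ 4 * (u * t ^ 3) := by
    refine card_biUnion_le.trans ?_
    calc _ ≤ ∑ j : Fin 4, u * t ^ 3 := by
          apply sum_le_sum
          intro j _
          rw [Fintype.card_piFinset]
          rw [← prod_one_special j u t]
          apply prod_le_prod'
          intro l _
          split_ifs with hl
          · rw [card_sdiff_of_subset (hD l), hcard]
            have := hc l; omega
          · rw [hcard]
      _ = _ := by simp
  have h3 : ((E ∩ Fintype.piFinset (fun i => Cl i (q i))).card : ℝ) ≤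
      (E ∩ Fintype.piFinset D).card + 4 * (u * t ^ 3) := by
    exact_mod_cast h1.trans (by gcongr)
  have hDt : ∀ i, (D i).card ≤ t := by
    intro i
    have := card_le_card (hD i)
    rwa [hcard] at this
  have h4 : ((D 0).card : ℝ) * (D 1).card * (D 2).card * (D 3).card ≤ t * t * t * t := by
    gcongr <;> apply hDt
  have h5 : (u:ℝ) * t ^ 3 ≤ β / 8 * t * t ^ 3 := by gcongr
  have h6 : β / 2 * (((D 0).card : ℝ) * (D 1).card * (D 2).card * (D 3).card) ≤
    β / 2 * (t * t * t * t) := by gcongr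
  nlinarith

lemma reddeg (κ β : ℝ) (hκ : 0 ≤ κ) (hβ : 0 ≤ β) (n t N : ℕ) (ht : 0 < t) (hNt : N * t ≤ n)
    (hnN : n ≤ (N + 1) * t) (hN : 2 * ((N:ℝ) + 1) ≤ β * N ^ 2) (E : Finset (Fin 4 → Fin n))
    (hE : DegCond κ n E) (Cl : Fin 4 → Fin N → Finset (Fin n)) (hcard : ∀ i j, (Cl i j).card = t)
    (hdisj : ∀ i j j', j ≠ j' → Disjoint (Cl i j) (Cl i j')) :
    DegCond (κ - 2 * β) N (univ.filter (fun p : Fin 4 → Fin N =>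
      β * (t:ℝ) ^ 4 ≤ ((E ∩ Fintype.piFinset (fun i => Cl i (p i))).card : ℝ))) := by
  intro i hi x y
  set R := (univ.filter (fun p : Fin 4 → Fin N =>
      β * (t:ℝ) ^ 4 ≤ ((E ∩ Fintype.piFinset (fun i => Cl i (p i))).card : ℝ))) with hR
  set S := E.filter (fun q => q 0 ∈ Cl 0 x ∧ q i ∈ Cl i y) with hS
  have hlow : (t:ℝ) ^ 2 * (κ * (n:ℝ) ^ 2) ≤ S.card := by
    rw [card_eq_sum_card_fiberwise (f := fun q => (q 0, q i)) (t := Cl 0 x ×ˢ Cl i y)]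
    · push_cast
      calc (t:ℝ) ^ 2 * (κ * (n:ℝ) ^ 2) = ∑ g ∈ Cl 0 x ×ˢ Cl i y, κ * (n:ℝ) ^ 2 := by
            rw [sum_const, card_product, hcard, hcard, nsmul_eq_mul]; push_cast; ring
        _ ≤ _ := by
            apply sum_le_sum
            rintro ⟨a, b⟩ hg
            refine (hE i hi a b).trans ?_
            norm_cast
            apply card_le_card
            intro q hq
            simp only [hS, mem_filter, Prod.mk.injEq] at hq ⊢
            rw [mem_product] at hg
            refine ⟨⟨hq.1, ?_, ?_⟩, hq.2⟩
            · rw [hq.2.1]; exact hg.1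
            · rw [hq.2.2]; exact hg.2
    · intro q hq
      simp only [hS, coe_filter, Set.mem_ofPred_eq] at hq
      simp only [coe_product, Set.mem_prod, mem_coe]
      exact hq.2
  set P := Fintype.piFinset (fun l : Fin 4 => if l = 0 then ({x} : Finset (Fin N)) else
    if l = i then {y} else univ) with hP
  have hPc : P.card = N ^ 2 := by
    have := prod_two_special i hi 1 1 N
    rw [hP, Fintype.card_piFinset]
    simp only [one_mul] at this
    rw [← this]
    apply prod_congr rfl
    intro l _
    split_ifs <;> simp
  set J := (univ : Finset (Fin 4)).filter (fun j => j ≠ 0 ∧ j ≠ i) with hJ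
  have hJc : J.card = 2 := cardJ i hi
  let Out : Fin 4 → Finset (Fin n) := fun j => univ \ univ.biUnion (Cl j)
  have hOut : ∀ j, (Out j).card ≤ t := by
    intro j
    simp only [Out]
    rw [card_sdiff_of_subset (subset_univ _), card_biUnion (fun a _ b _ hab => hdisj j a b hab)]
    simp only [hcard, sum_const, card_univ, Fintype.card_fin, smul_eq_mul]
    have : (N + 1) * t = N * t + t := by ring
    omega
  have hsub : S ⊆ P.biUnion (fun p => E ∩ Fintype.piFinset (fun i => Cl i (p i))) ∪
      J.biUnion (fun j => Fintype.piFinset (fun l => if l = 0 then Cl 0 x else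
        if l = i then Cl i y else if l = j then Out j else univ)) := by
    intro q hq
    simp only [hS, mem_filter] at hq
    rw [mem_union]
    by_cases h : ∀ j, ∃ a, q j ∈ Cl j a
    · left
      choose p hp using h
      rw [mem_biUnion]
      have hu : ∀ j a, q j ∈ Cl j a → p j = a := by
        intro j a ha
        by_contra hne
        exact (Finset.disjoint_left.mp (hdisj j (p j) a hne)) (hp j) ha
      refine ⟨p, ?_, ?_⟩
      · rw [hP, Fintype.mem_piFinset]
        intro l
        split_ifs with h1 h2
        · subst h1; rw [mem_singleton]; exact hu _ _ hq.2.1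
        · subst h2; rw [mem_singleton]; exact hu _ _ hq.2.2
        · exact mem_univ _
      · rw [mem_inter, Fintype.mem_piFinset]
        exact ⟨hq.1, hp⟩
    · right
      push Not at h
      obtain ⟨j, hj⟩ := h
      rw [mem_biUnion]
      refine ⟨j, ?_, ?_⟩
      · rw [hJ, mem_filter]
        refine ⟨mem_univ _, ?_, ?_⟩
        · rintro rfl; exact hj x hq.2.1
        · rintro rfl; exact hj y hq.2.2
      · rw [Fintype.mem_piFinset]
        intro l
        split_ifs with h1 h2 h3
        · subst h1; exact hq.2.1
        · subst h2; exact hq.2.2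
        · subst h3
          simp only [Out, mem_sdiff, mem_univ, mem_biUnion, true_and, not_exists]
          exact hj
        · exact mem_univ _
  have h1 := (card_le_card hsub).trans (card_union_le _ _)
  have h2 : (J.biUnion (fun j => Fintype.piFinset (fun l => if l = 0 then Cl 0 x else
        if l = i then Cl i y else if l = j then Out j else univ))).card ≤ 2 * (t * t * t * n) := by
    refine card_biUnion_le.trans ?_
    rw [← hJc, ← smul_eq_mul, ← sum_const]
    apply sum_le_sum
    intro j hj
    rw [hJ, mem_filter] at hj
    rw [Fintype.card_piFinset, ← prod_three_special i j hi hj.2.1 hj.2.2]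
    apply prod_le_prod'
    intro l _
    split_ifs
    · rw [hcard]
    · rw [hcard]
    · exact hOut j
    · simp
  have h3 : ((P.biUnion (fun p => E ∩ Fintype.piFinset (fun i => Cl i (p i)))).card : ℝ) ≤
      N ^ 2 * (β * t ^ 4) + (R.filter (fun q => q 0 = x ∧ q i = y)).card * t ^ 4 := by
    have h4 : ((P.biUnion (fun p => E ∩ Fintype.piFinset (fun i => Cl i (p i)))).card : ℝ) ≤
        ∑ p ∈ P, ((E ∩ Fintype.piFinset (fun i => Cl i (p i))).card : ℝ) := by
      exact_mod_cast card_biUnion_le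
    refine h4.trans ?_
    have h5 : ∀ p ∈ P, ((E ∩ Fintype.piFinset (fun i => Cl i (p i))).card : ℝ) ≤
        β * t ^ 4 + (if p ∈ R then (t:ℝ) ^ 4 else 0) := by
      intro p _
      split_ifs with hpR
      · have : ((E ∩ Fintype.piFinset (fun i => Cl i (p i))).card : ℝ) ≤ t ^ 4 := by
          have := card_le_card (inter_subset_right (s₁ := E)
            (s₂ := Fintype.piFinset (fun i => Cl i (p i))))
          rw [Fintype.card_piFinset] at this
          simp only [hcard, prod_const, card_univ, Fintype.card_fin] at this
          exact_mod_cast this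
        have : 0 ≤ β * (t:ℝ) ^ 4 := by positivity
        linarith
      · rw [hR, mem_filter] at hpR
        push Not at hpR
        have := hpR (mem_univ _)
        linarith
    refine (sum_le_sum h5).trans ?_
    rw [sum_add_distrib, sum_const, hPc, nsmul_eq_mul]
    push_cast
    gcongr
    rw [← sum_filter, sum_const, nsmul_eq_mul]
    gcongr
    intro p hp
    rw [mem_filter, hP, Fintype.mem_piFinset] at hp
    rw [mem_filter]
    refine ⟨hp.2, ?_, ?_⟩
    · have := hp.1 0; simpa using this
    · have := hp.1 i; simpa [hi] using this
  have h6 : (S.card : ℝ) ≤ (P.biUnion (fun p => E ∩ Fintype.piFinset (fun i => Cl i (p i)))).card +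
      2 * (t * t * t * n) := by
    exact_mod_cast h1.trans (by gcongr)
  have ht' : (0:ℝ) < t := by exact_mod_cast ht
  have hn1 : (n:ℝ) ≤ (N + 1) * t := by exact_mod_cast hnN
  have hn2 : (N:ℝ) * t ≤ n := by exact_mod_cast hNt
  set r : ℝ := ((R.filter (fun q => q 0 = x ∧ q i = y)).card : ℝ) with hr
  have h7 : (t:ℝ) ^ 2 * (κ * (N * t) ^ 2) ≤ (t:ℝ) ^ 2 * (κ * (n:ℝ) ^ 2) := by gcongr
  have h8 : 2 * ((t:ℝ) * t * t * n) ≤ 2 * (t * t * t * ((N + 1) * t)) := by gcongr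
  have h9 : (t:ℝ) ^ 4 * (κ * N ^ 2) ≤ t ^ 4 * (N ^ 2 * β + r + 2 * (N + 1)) := by nlinarith
  have h10 := le_of_mul_le_mul_left h9 (by positivity)
  linarith

end Aux

namespace Aux

lemma countP_msum {ι X : Type} (S : Finset ι) (m : ι → ℕ) (z : ι → X) (p : X → Prop)
    [DecidablePred p] :
    (∑ a ∈ S, m a • ({z a} : Multiset X)).countP p = ∑ a ∈ S, if p (z a) then m a else 0 := by
  classical
  induction S using Finset.induction_on with
  | empty => simp
  | insert a S ha ih =>
    rw [sum_insert ha, sum_insert ha, Multiset.countP_add, ih, Multiset.countP_nsmul]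
    congr 1
    split_ifs with h
    · rw [← Multiset.cons_zero, Multiset.countP_cons_of_pos _ h]; simp
    · rw [← Multiset.cons_zero, Multiset.countP_cons_of_neg _ h]; simp

lemma card_msum {ι X : Type} (S : Finset ι) (m : ι → ℕ) (z : ι → X) :
    Multiset.card (∑ a ∈ S, m a • ({z a} : Multiset X)) = ∑ a ∈ S, m a := by
  rw [Multiset.card_sum]
  simp

lemma mem_msum {ι X : Type} (S : Finset ι) (m : ι → ℕ) (z : ι → X) (x : X)
    (h : x ∈ ∑ a ∈ S, m a • ({z a} : Multiset X)) : ∃ a ∈ S, x = z a := by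
  rw [Multiset.mem_sum] at h
  obtain ⟨a, ha, hx⟩ := h
  have := Multiset.mem_of_mem_nsmul hx
  exact ⟨a, ha, by simpa using this⟩

def PP (κ lam : ℝ) : Prop := ∀ s : ℕ, 1 ≤ s → ∃ n0 : ℕ, ∀ n, n0 ≤ n →
  ∀ E : Finset (Fin 4 → Fin n), DegCond κ n E →
    ∃ (k : ℕ) (C : Fin 4 → ℕ → Finset (Fin n)), Fam n s k E C ∧ (1 - lam) * n ≤ k * s

lemma numfinal (n N t k s δ ζ lam τ M g : ℝ) (hδ0 : 0 ≤ δ) (hδ1 : δ ≤ 1) (hζ0 : 0 ≤ ζ) (hζ1 : ζ ≤ 1)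
    (ht : 0 ≤ t) (hs : 0 ≤ s) (hk0 : 0 ≤ k)
    (h1 : δ * t * (1 - ζ) * N - s * (4 * N + 1) ≤ s * M)
    (h2 : (1 - δ) * t - s ≤ s * g) (h3 : (1 - lam) * n ≤ k * t) (h4 : n - t ≤ N * t)
    (h5 : 12 * s * N ≤ τ * n) (h6 : t ≤ τ / 2 * n) (h7 : k ≤ N) (h8 : 1 ≤ N) :
    (1 - ((1 - δ) * lam + δ * ζ + τ)) * n ≤ (M + k * g) * s := by
  have a1 : k * ((1 - δ) * t - s) ≤ k * (s * g) := by gcongr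
  have a2 : (1 - δ) * ((1 - lam) * n) ≤ (1 - δ) * (k * t) := by
    apply mul_le_mul_of_nonneg_left h3; linarith
  have a3 : (δ * (1 - ζ)) * (n - t) ≤ (δ * (1 - ζ)) * (N * t) := by
    apply mul_le_mul_of_nonneg_left h4
    apply mul_nonneg hδ0; linarith
  have a4 : s * k ≤ s * N := by gcongr
  have a5 : s * 1 ≤ s * N := by gcongr
  have a6 : (δ * (1 - ζ)) * t ≤ 1 * t := by
    gcongr
    nlinarith
  nlinarith

lemma degmono {κ κ' : ℝ} {n : ℕ} {E : Finset (Fin 4 → Fin n)} (h : κ' ≤ κ) (hE : DegCond κ n E) :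
    DegCond κ' n E := by
  intro i hi x y
  refine le_trans ?_ (hE i hi x y)
  gcongr

set_option maxHeartbeats 2000000 in
lemma step (κ β ζ lam τ : ℝ) (hκ : 0 ≤ κ) (hβ : 0 < β) (hβ1 : β ≤ 1) (hζ : 0 < ζ) (hζ1 : ζ < 1)
    (hκβ : 5 / 9 - 4 / 9 * ζ ≤ κ - 2 * β) (hτ : 0 < τ)
    (hP : PP κ lam) : PP κ ((1 - β / 8) * lam + β / 8 * ζ + τ) := by
  intro s hs
  obtain ⟨T, hT⟩ := box (β / 2) (by positivity) s
  obtain ⟨t0, ht0⟩ := exists_nat_ge (12 * (s:ℝ) / τ)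
  set t := 2 * T + s + t0 with ht
  have htpos : 0 < t := by omega
  have htr : (0:ℝ) < t := by exact_mod_cast htpos
  have hsr : (0:ℝ) < s := by exact_mod_cast hs
  obtain ⟨n1, hn1⟩ := hP t (by omega)
  obtain ⟨N0, hN0⟩ := exists_nat_ge (4 / β)
  obtain ⟨n2, hn2⟩ := exists_nat_ge (2 * (t:ℝ) / τ)
  refine ⟨n1 + t * (N0 + 1) + n2, fun n hn E hE => ?_⟩
  obtain ⟨k, C, hF, hk⟩ := hn1 n (by omega) E hE
  set N := n / t with hN
  have hNt : N * t ≤ n := Nat.div_mul_le_self n t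
  have hnN : n ≤ (N + 1) * t := by
    have := Nat.lt_mul_div_succ n htpos
    rw [← hN] at this
    nlinarith
  have hN0' : N0 + 1 ≤ N := by
    rw [hN, Nat.le_div_iff_mul_le htpos]
    nlinarith
  have hkN : k ≤ N := by
    rw [hN, Nat.le_div_iff_mul_le htpos]
    rw [← card_used (C 0) (hF.card 0) (hF.disj 0)]
    simpa using card_le_univ ((range k).biUnion (C 0))
  have hNr : (N0:ℝ) + 1 ≤ N := by exact_mod_cast hN0'
  have hNβ : 2 * ((N:ℝ) + 1) ≤ β * N ^ 2 := by
    have h1 : 4 ≤ β * N := by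
      have : 4 / β ≤ N := by linarith
      rw [div_le_iff₀ hβ] at this
      linarith
    have h2 : (1:ℝ) ≤ N := by
      have : (0:ℝ) ≤ N0 := by positivity
      linarith
    nlinarith
  have hext := fun i => extcl n t k (C i) (hF.card i) (hF.disj i) N hkN hNt
  choose C' hC1 hC2 hC3 using hext
  let Cl : Fin 4 → Fin N → Finset (Fin n) := fun i j => C' i j
  have hcard : ∀ i j, (Cl i j).card = t := fun i j => hC2 i j j.2
  have hdisj : ∀ i j j', j ≠ j' → Disjoint (Cl i j) (Cl i j') := fun i j j' hne =>
    hC3 i j j' j.2 j'.2 (fun h => hne (Fin.ext h))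
  have hRd := reddeg κ β hκ hβ.le n t N htpos hNt hnN hNβ E hE Cl hcard hdisj
  obtain ⟨ι, hι, z, w, hιc, hz, hw, hwl, hwt⟩ := fracmatch ζ hζ hζ1 N (by omega) _
    (degmono hκβ hRd)
  set u := ⌊β / 8 * (t:ℝ)⌋₊ with hu
  have hur : (u:ℝ) ≤ β / 8 * t := Nat.floor_le (by positivity)
  have huT : T + u ≤ t := by
    have h1 : (u:ℝ) ≤ t / 2 := by nlinarith
    have h2 : (T:ℝ) ≤ t / 2 := by rw [ht]; push_cast; nlinarith [(Nat.cast_nonneg t0 : (0:ℝ) ≤ t0)]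
    have : ((T + u : ℕ):ℝ) ≤ t := by push_cast; linarith
    exact_mod_cast this
  let m : ι → ℕ := fun a => ⌊β / 8 * w a * t / s⌋₊
  have hm1 : ∀ a, (s:ℝ) * m a ≤ β / 8 * w a * t := by
    intro a
    have h0 : 0 ≤ β / 8 * w a * t / s := by
      have := hw a; positivity
    have := Nat.floor_le h0
    rw [le_div_iff₀ hsr] at this
    simp only [m]; linarith
  have hm2 : ∀ a, β / 8 * w a * t - s ≤ s * m a := by
    intro a
    have := Nat.lt_floor_add_one (β / 8 * w a * t / s)
    rw [div_lt_iff₀ hsr] at this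
    simp only [m]; linarith
  let L1 : Multiset (Fin 4 → Fin N) := ∑ a, m a • ({z a} : Multiset (Fin 4 → Fin N))
  have hL1 : ∀ i j, s * L1.countP (fun q => q i = j) ≤ u := by
    intro i j
    rw [hu]
    apply Nat.le_floor
    simp only [L1]
    rw [countP_msum]
    push_cast
    rw [mul_sum]
    calc ∑ a, (s:ℝ) * (if z a i = j then (m a:ℝ) else 0)
        ≤ ∑ a, (β / 8 * t) * (w a * (if z a i = j then 1 else 0)) := by
          apply sum_le_sum
          intro a _
          have := hm1 a
          split_ifs
          · linarith
          · simp
      _ = (β / 8 * t) * ∑ a, w a * (if z a i = j then 1 else 0) := by rw [mul_sum]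
      _ ≤ (β / 8 * t) * 1 := by
          have := hwl i j
          gcongr
      _ = _ := by ring
  obtain ⟨C1, hF1, hload1⟩ := greedy n s t u N E Cl hcard hdisj 0 (fun _ _ => ∅) (fun _ _ => 0)
    ⟨fun i j hj => absurd hj (by omega), fun i j j' hj => absurd hj (by omega),
      fun j hj => absurd hj (by omega)⟩ (by intro i j; simp) L1 (by
      intro q hq
      obtain ⟨a, _, rfl⟩ := mem_msum _ _ _ _ hq
      have := hz a
      rw [mem_filter] at this
      exact goodR β hβ n s t u N T E Cl hcard (z a) hT hur huT this.2) (by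
      intro i j
      have := hL1 i j
      omega)
  set g := (t - u) / s with hg
  let J : Finset (Fin N) := univ.filter (fun j => (j:ℕ) < k)
  have hJc : J.card = k := by
    have := Fin.card_filter_val_lt (n := N) (m := k)
    simp only [J]
    rw [this]; omega
  let L2 : Multiset (Fin 4 → Fin N) := ∑ j ∈ J, g • ({fun _ => j} : Multiset (Fin 4 → Fin N))
  have hsg : s * g ≤ t - u := Nat.mul_div_le _ _
  have hst : s ≤ t := by omega
  have hL2 : ∀ i j, L2.countP (fun q => q i = j) ≤ g := by
    intro i j
    simp only [L2]
    rw [countP_msum J (fun _ => g) (fun j _ => j)]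
    rw [sum_ite_eq']
    split_ifs <;> simp
  obtain ⟨C2, hF2, -⟩ := greedy n s t (t - s) N E Cl hcard hdisj _ C1 (fun _ _ => u)
    hF1 (by
      intro i j
      refine (hload1 i j).trans ?_
      have := hL1 i j
      omega) L2 (by
      intro q hq
      obtain ⟨j, hj, rfl⟩ := mem_msum J (fun _ => g) (fun j _ => j) _ hq
      apply goodDiag n s t N hst
      intro p hp
      simp only [J, mem_filter] at hj
      apply hF.edge j hj.2 p
      intro i
      rw [← hC1 i j hj.2]
      exact hp i) (by
      intro i j
      have h1 := Nat.mul_le_mul_left s (hL2 i j)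
      omega)
  refine ⟨_, C2, hF2, ?_⟩
  have hc1 : Multiset.card L1 = ∑ a, m a := card_msum _ _ _
  have hc2 : Multiset.card L2 = k * g := by
    simp only [L2]
    rw [card_msum J (fun _ => g)]
    simp [hJc]
  rw [hc1, hc2]
  push_cast
  rw [zero_add]
  have hτ2 : 12 * (s:ℝ) ≤ τ * t := by
    rw [div_le_iff₀ hτ] at ht0
    have : (t0:ℝ) ≤ t := by rw [ht]; push_cast; linarith [(Nat.cast_nonneg T : (0:ℝ) ≤ T)]
    nlinarith
  have hNtr : (N:ℝ) * t ≤ n := by exact_mod_cast hNt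
  have hnNr : (n:ℝ) ≤ (N + 1) * t := by exact_mod_cast hnN
  have hN0r : (0:ℝ) ≤ N0 := by positivity
  have hN1 : (1:ℝ) ≤ N := by linarith
  have hk' : (k:ℝ) ≤ N := by exact_mod_cast hkN
  apply numfinal n N t k s (β / 8) ζ lam τ (∑ a, (m a:ℝ)) g (by linarith) (by linarith) hζ.le hζ1.le
    htr.le hsr.le (by positivity) _ _ hk (by linarith) _ _ hk' hN1
  · rw [mul_sum]
    have h1 : ∑ a, (β / 8 * w a * t - s) ≤ ∑ a, (s:ℝ) * m a := sum_le_sum fun a _ => hm2 a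
    refine le_trans ?_ h1
    rw [sum_sub_distrib, sum_const, ← sum_mul, ← mul_sum, nsmul_eq_mul, card_univ]
    have h2 : (Fintype.card ι : ℝ) ≤ 4 * N + 1 := by exact_mod_cast hιc
    have h3 : (β / 8 * t) * ((1 - ζ) * N) ≤ (β / 8 * t) * ∑ a, w a := by gcongr
    have h4 : (Fintype.card ι : ℝ) * s ≤ (4 * N + 1) * s := by gcongr
    linarith
  · have h1 : t - u < s * (g + 1) := by
      rw [hg]; exact Nat.lt_mul_div_succ _ (by omega)
    have h2 : t < s * (g + 1) + u := by omega
    have h3 : (t:ℝ) < s * (g + 1) + u := by exact_mod_cast h2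
    linarith
  · nlinarith
  · rw [div_le_iff₀ hτ] at hn2
    have : (n2:ℝ) ≤ n := by
      have : n2 ≤ n := by omega
      exact_mod_cast this
    nlinarith

lemma PPmono {κ lam lam' : ℝ} (h : lam ≤ lam') (hP : PP κ lam) : PP κ lam' := by
  intro s hs
  obtain ⟨n0, hn0⟩ := hP s hs
  refine ⟨n0, fun n hn E hE => ?_⟩
  obtain ⟨k, C, hF, hk⟩ := hn0 n hn E hE
  refine ⟨k, C, hF, le_trans ?_ hk⟩
  gcongr

lemma PPone (κ : ℝ) : PP κ 1 := by
  intro s hs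
  refine ⟨0, fun n _ E _ => ⟨0, fun _ _ => ∅, ?_, by simp⟩⟩
  exact ⟨fun i j hj => absurd hj (by omega), fun i j j' hj => absurd hj (by omega),
      fun j hj => absurd hj (by omega)⟩

lemma PPfin (η γ : ℝ) (hη : 0 < η) (hη1 : η ≤ 1) (hγ : 0 < γ) (hγ1 : γ < η / 27) :
    PP (5 / 9 - γ) η := by
  set β := η / 27 with hβ
  have hβ0 : 0 < β := by positivity
  have hk : ∀ k : ℕ, PP (5 / 9 - γ) (η / 2 + (1 - β / 8) ^ k * (1 - η / 2)) := by
    intro k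
    induction k with
    | zero => simpa using PPone _
    | succ k ih =>
      have := step (5 / 9 - γ) β (η / 4) _ (β / 8 * (η / 4)) (by linarith) hβ0 (by linarith)
        (by linarith) (by linarith) (by linarith) (by positivity) ih
      convert this using 1
      ring
  obtain ⟨k, hk1⟩ := exists_pow_lt_of_lt_one (show 0 < η / 2 by linarith)
    (show 1 - β / 8 < 1 by linarith)
  refine PPmono ?_ (hk k)
  have : 0 ≤ (1 - β / 8) ^ k := pow_nonneg (by linarith) _
  nlinarith

end Aux

namespace Aux

lemma transl {α : Type} [DecidableEq α] (n : ℕ) (κ c : ℝ) (V : Fin 4 → Finset α)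
    (hd : ∀ i j, i ≠ j → Disjoint (V i) (V j)) (hc : ∀ i, (V i).card = n)
    (E : Finset (Finset α))
    (hE : ∀ e ∈ E, (∀ v ∈ e, ∃ i, v ∈ V i) ∧ ∀ i, (e ∩ V i).card = 1)
    (hdeg : ∀ x ∈ V 0, ∀ i, i ≠ 0 → ∀ y ∈ V i, κ * (n:ℝ) ^ 2 ≤ (hdeg2 E x y : ℝ))
    (hP : ∀ E' : Finset (Fin 4 → Fin n), DegCond κ n E' →
      ∃ (k : ℕ) (C : Fin 4 → ℕ → Finset (Fin n)), Fam n 1 k E' C ∧ c ≤ k) :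
    ∃ M : Finset (Finset α), M ⊆ E ∧ (∀ e ∈ M, ∀ f ∈ M, e ≠ f → Disjoint e f) ∧
      c ≤ (M.card : ℝ) := by
  let ee : ∀ i, V i ≃ Fin n := fun i => (V i).equivFinOfCardEq (hc i)
  let f : Fin 4 → Fin n → α := fun i a => ((ee i).symm a : α)
  have hfm : ∀ i a, f i a ∈ V i := fun i a => ((ee i).symm a).2
  have hfi : ∀ i a b, f i a = f i b → a = b := fun i a b h =>
    (ee i).symm.injective (Subtype.ext h)
  have hfs : ∀ i, ∀ v ∈ V i, ∃ a, f i a = v := fun i v hv =>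
    ⟨ee i ⟨v, hv⟩, by simp [f]⟩
  let φ : (Fin 4 → Fin n) → Finset α := fun q => univ.image (fun i => f i (q i))
  let E' : Finset (Fin 4 → Fin n) := univ.filter (fun q => φ q ∈ E)
  have hDC : DegCond κ n E' := by
    intro i hi x y
    refine (hdeg (f 0 x) (hfm 0 x) i hi (f i y) (hfm i y)).trans ?_
    norm_cast
    rw [hdeg2]
    refine le_trans (card_le_card ?_) (card_image_le (f := φ))
    intro e he
    rw [mem_filter] at he
    obtain ⟨heE, hx, hy⟩ := he
    obtain ⟨h1, h2⟩ := hE e heE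
    have h3 : ∀ l, ∃ a, e ∩ V l = {f l a} := by
      intro l
      obtain ⟨v, hv⟩ := card_eq_one.mp (h2 l)
      have : v ∈ e ∩ V l := by rw [hv]; simp
      obtain ⟨a, rfl⟩ := hfs l v (mem_inter.mp this).2
      exact ⟨a, hv⟩
    choose q hq using h3
    have hu : ∀ l, ∀ v ∈ e, v ∈ V l → v = f l (q l) := by
      intro l v hv hvl
      have : v ∈ e ∩ V l := mem_inter.mpr ⟨hv, hvl⟩
      rw [hq l] at this
      simpa using this
    have hφ : φ q = e := by
      ext v
      simp only [φ, mem_image, mem_univ, true_and]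
      constructor
      · rintro ⟨l, rfl⟩
        have : f l (q l) ∈ e ∩ V l := by rw [hq l]; simp
        exact (mem_inter.mp this).1
      · intro hv
        obtain ⟨l, hl⟩ := h1 v hv
        exact ⟨l, (hu l v hv hl).symm⟩
    rw [mem_image]
    refine ⟨q, ?_, hφ⟩
    rw [mem_filter, mem_filter]
    refine ⟨⟨mem_univ _, by rw [hφ]; exact heE⟩, ?_, ?_⟩
    · exact (hfi 0 _ _ (hu 0 _ hx (hfm 0 x))).symm
    · exact (hfi i _ _ (hu i _ hy (hfm i y))).symm
  obtain ⟨k, C, hF, hk⟩ := hP E' hDC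
  have hch : ∀ j : Fin k, ∃ q : Fin 4 → Fin n, ∀ i, q i ∈ C i j := by
    intro j
    have : ∀ i, ∃ a, a ∈ C i j := by
      intro i
      have : (C i j).Nonempty := by rw [← card_pos, hF.card i j j.2]; exact one_pos
      exact this
    choose q hq using this
    exact ⟨q, hq⟩
  choose q hq using hch
  have hdis : ∀ j j', j ≠ j' → Disjoint (φ (q j)) (φ (q j')) := by
    intro j j' hne
    rw [Finset.disjoint_left]
    intro v hv hv'
    simp only [φ, mem_image, mem_univ, true_and] at hv hv'
    obtain ⟨i, rfl⟩ := hv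
    obtain ⟨i', hi'⟩ := hv'
    by_cases hii : i' = i
    · subst hii
      have h1 := hfi _ _ _ hi'
      have h2 := hq j' i'
      rw [h1] at h2
      exact (Finset.disjoint_left.mp (hF.disj i' j j' j.2 j'.2 (fun h => hne (Fin.ext h))))
        (hq j i') h2
    · have h1 := hfm i' (q j' i')
      rw [hi'] at h1
      exact (Finset.disjoint_left.mp (hd i' i hii)) h1 (hfm i _)
  refine ⟨univ.image (fun j => φ (q j)), ?_, ?_, ?_⟩
  · intro e he
    rw [mem_image] at he
    obtain ⟨j, _, rfl⟩ := he
    have := hF.edge j j.2 (q j) (hq j)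
    exact (mem_filter.mp this).2
  · intro e he e' he' hne
    rw [mem_image] at he he'
    obtain ⟨j, _, rfl⟩ := he
    obtain ⟨j', _, rfl⟩ := he'
    exact hdis j j' (fun h => hne (by rw [h]))
  · rw [card_image_of_injective]
    · simpa using hk
    · intro j j' h
      by_contra hne
      have h1 := hdis j j' hne
      simp only at h
      rw [h, disjoint_self] at h1
      have h2 : f 0 (q j' 0) ∈ φ (q j') := by
        simp only [φ, mem_image, mem_univ, true_and]
        exact ⟨0, rfl⟩
      rw [h1] at h2
      simp at h2

end Aux

/-- For every `η > 0` and every sufficiently small `ε > 0` there is `γ0 > 0`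
such that for every `γ ∈ (0, γ0)` there is `n0` such that for all `n ≥ n0`:
if `H` is a balanced 4-partite 4-graph with classes of size `n`, not `ε`-close
to `H'₁,₃(n)`, with `d_H({x,y}) > (5/9 − γ)n²` for all `x ∈ V1`,
`y ∈ V2 ∪ V3 ∪ V4`, then `H` has a matching of size at least `(1 − η)n`. -/
theorem non_close_large_matching :
    ∀ η : ℝ, 0 < η →
    ∃ ε0 : ℝ, 0 < ε0 ∧ ∀ ε : ℝ, 0 < ε → ε < ε0 →
    ∃ γ0 : ℝ, 0 < γ0 ∧ ∀ γ : ℝ, 0 < γ → γ < γ0 →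
    ∃ n0 : ℕ, ∀ n : ℕ, n0 ≤ n →
    ∀ (α : Type) [DecidableEq α], ∀ V1 V2 V3 V4 : Finset α,
      Disjoint V1 V2 → Disjoint V1 V3 → Disjoint V1 V4 →
      Disjoint V2 V3 → Disjoint V2 V4 → Disjoint V3 V4 →
      V1.card = n → V2.card = n → V3.card = n → V4.card = n →
      ∀ E : Finset (Finset α),
        IsPartite4 V1 V2 V3 V4 E →
        ¬ CloseToH13 ε n V1 V2 V3 V4 E →
        (∀ x ∈ V1, ∀ y ∈ V2 ∪ V3 ∪ V4,
          ((5 : ℝ) / 9 - γ) * n ^ 2 < (hdeg2 E x y : ℝ)) →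
        ∃ M : Finset (Finset α),
          M ⊆ E ∧
          (∀ e ∈ M, ∀ f ∈ M, e ≠ f → Disjoint e f) ∧
          (1 - η) * n ≤ (M.card : ℝ) := by
  intro η hη
  refine ⟨1, one_pos, fun ε _ _ => ⟨min η 1 / 27, by positivity, fun γ hγ hγ1 => ?_⟩⟩
  obtain ⟨n0, hn0⟩ := Aux.PPfin (min η 1) γ (by positivity) (min_le_right _ _) hγ hγ1 1 le_rfl
  refine ⟨n0, ?_⟩
  intro n hn α _ V1 V2 V3 V4 h12 h13 h14 h23 h24 h34 c1 c2 c3 c4 E hE _ hdeg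
  apply Aux.transl n (5 / 9 - γ) ((1 - η) * n) ![V1, V2, V3, V4]
  · intro i j hij
    fin_cases i <;> fin_cases j <;> first | exact absurd rfl hij | assumption | (symm; assumption)
  · intro i
    fin_cases i <;> assumption
  · intro e he
    obtain ⟨a1, a2, a3, a4, a5⟩ := hE e he
    constructor
    · intro v hv
      have := a1 hv
      simp only [mem_union] at this
      rcases this with ((h | h) | h) | h
      · exact ⟨0, h⟩
      · exact ⟨1, h⟩
      · exact ⟨2, h⟩
      · exact ⟨3, h⟩
    · intro i
      fin_cases i <;> assumption
  · intro x hx i hi y hy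
    refine (hdeg x hx y ?_).le
    simp only [mem_union]
    fin_cases i
    · exact absurd rfl hi
    · exact Or.inl (Or.inl hy)
    · exact Or.inl (Or.inr hy)
    · exact Or.inr hy
  · intro E' hE'
    obtain ⟨k, C, hF, hk⟩ := hn0 n hn E' hE'
    refine ⟨k, C, hF, ?_⟩
    have h1 : (1 - η) * (n:ℝ) ≤ (1 - min η 1) * n := by
      gcongr
      exact min_le_left _ _
    rw [Nat.cast_one, mul_one] at hk
    exact h1.trans hk
end
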